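/- Let S = (X, Y, Z, W) be the M₄(2,3) balanced excited random walk, τ_k the successive times at which the pair (Z, W) moves, M_m := X_{τ_m} and U_k := (Z_{τ_k}, W_{τ_k}). Then there exist constants C₈ > 0, C₉ > 0 and β > 0 such that for all n large enough, P(M_n = 0 and U_n = 0) ≤ (1/n)·C₈·exp(−C₉·(log n)^β). Consequently, by Borel–Cantelli, the process (M_n, U_n) is transient, and hence the M₄(2,3)-random walk is transient. -/

import Mathlib

open MeasureTheory Filter

/-- The `i`-th canonical unit vector of `ℤ^d`. -/
def unitVec (d : ℕ) (i : Fin d) : Fin d → ℤ := fun j => if j = i then 1 else 0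

/-- `S` is a balanced excited random walk `M_d(d₁,d₂)` under `P`:
it starts at `0` a.s., is measurable, and conditionally on any finite trajectory
`S_0 = h 0, …, S_n = h n`, if `h n` is a new site the walk jumps to `h n ± e_i`
with probability `1/(2d₁)` for each `i < d₁` (`0`-indexed), while if `h n` is an
old site it jumps to `h n ± e_i` with probability `1/(2d₂)` for each
`d - d₂ ≤ i < d` (`0`-indexed). -/
def IsBERW {Ω : Type*} [MeasurableSpace Ω] (d d₁ d₂ : ℕ) (P : Measure Ω)
    (S : ℕ → Ω → Fin d → ℤ) : Prop :=
  (∀ n, Measurable (S n)) ∧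
  (∀ᵐ ω ∂P, S 0 ω = 0) ∧
  (∀ (n : ℕ) (h : ℕ → Fin d → ℤ), (∀ k < n, h n ≠ h k) →
    ∀ i : Fin d, i.1 < d₁ → ∀ ε : ℤ, ε = 1 ∨ ε = -1 →
      P {ω | (∀ k ≤ n, S k ω = h k) ∧ S (n + 1) ω = h n + ε • unitVec d i}
        = P {ω | ∀ k ≤ n, S k ω = h k} / (2 * d₁)) ∧
  (∀ (n : ℕ) (h : ℕ → Fin d → ℤ), (∃ k < n, h n = h k) →
    ∀ i : Fin d, d - d₂ ≤ i.1 → ∀ ε : ℤ, ε = 1 ∨ ε = -1 →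
      P {ω | (∀ k ≤ n, S k ω = h k) ∧ S (n + 1) ω = h n + ε • unitVec d i}
        = P {ω | ∀ k ≤ n, S k ω = h k} / (2 * d₂))

/-- Transience: almost surely, every site is visited only finitely many times. -/
def IsTransientWalk {Ω : Type*} [MeasurableSpace Ω] (d : ℕ) (P : Measure Ω)
    (S : ℕ → Ω → Fin d → ℤ) : Prop :=
  ∀ᵐ ω ∂P, ∀ x : Fin d → ℤ, {n : ℕ | S n ω = x}.Finite

/-- `τ_k`: the successive times at which the pair of the last two coordinates
`(Z, W)` of the walk moves (`τ_0 = 0`). -/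
noncomputable def tau {Ω : Type*} (S : ℕ → Ω → Fin 4 → ℤ) : ℕ → Ω → ℕ
  | 0 => fun _ => 0
  | k + 1 => fun ω => sInf {n : ℕ | tau S k ω < n ∧
      ¬(S n ω 2 = S (n - 1) ω 2 ∧ S n ω 3 = S (n - 1) ω 3)}

/-- `M_m := X_{τ_m}`, the first coordinate of the walk observed at the times `τ`. -/
noncomputable def MartM {Ω : Type*} (S : ℕ → Ω → Fin 4 → ℤ) (m : ℕ) (ω : Ω) : ℝ :=
  (S (tau S m ω) ω 0 : ℝ)

/-- The integer valued version of `M_m = X_{τ_m}`. -/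
noncomputable def MartMZ {Ω : Type*} (S : ℕ → Ω → Fin 4 → ℤ) (m : ℕ) (ω : Ω) : ℤ :=
  S (tau S m ω) ω 0

/-- `U_k := (Z_{τ_k}, W_{τ_k})`, a simple symmetric random walk on `ℤ²`. -/
noncomputable def Uproc {Ω : Type*} (S : ℕ → Ω → Fin 4 → ℤ) (k : ℕ) (ω : Ω) : ℤ × ℤ :=
  (S (tau S k ω) ω 2, S (tau S k ω) ω 3)

/-- The σ-algebra generated by the whole process `U`; conditional expectation
given it realizes conditioning on `U` (the conditional law `P_U`). -/
noncomputable def sigmaU {Ω : Type*} [MeasurableSpace Ω]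
    (S : ℕ → Ω → Fin 4 → ℤ) : MeasurableSpace Ω :=
  MeasurableSpace.comap (fun ω => fun k : ℕ => Uproc S k ω) inferInstance

/-- `𝒢_m = 𝔽_{τ_m}`: the σ-algebra generated by the trajectory of the walk
stopped at `τ_m` (together with `τ_m`), i.e. the natural filtration of `S`
sampled at the stopping time `τ_m`. -/
noncomputable def stoppedSigma {Ω : Type*} [MeasurableSpace Ω]
    (S : ℕ → Ω → Fin 4 → ℤ) (m : ℕ) : MeasurableSpace Ω :=
  MeasurableSpace.comap
    (fun ω => (tau S m ω, fun k : ℕ => S (min k (tau S m ω)) ω)) inferInstance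

namespace BERW

/-- The four unit steps of the simple random walk on `ℤ²`. -/
def vec : Fin 4 → ℤ × ℤ := ![(1, 0), (-1, 0), (0, 1), (0, -1)]

/-- The index of the step opposite to a given one. -/
def opp : Fin 4 → Fin 4 := ![1, 0, 3, 2]

lemma vec_opp (s : Fin 4) : vec (opp s) = -vec s := by
  fin_cases s <;> simp [vec, opp]

/-- Average of `f` over all sequences of `n` steps. -/
noncomputable def avg (n : ℕ) (f : List (Fin 4) → ℝ) : ℝ :=
  (∑ g : Fin n → Fin 4, f (List.ofFn g)) / 4 ^ n

lemma avg_zero (f : List (Fin 4) → ℝ) : avg 0 f = f [] := by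
  simp [avg]

lemma avg_succ (n : ℕ) (f : List (Fin 4) → ℝ) :
    avg (n + 1) f = (∑ s : Fin 4, avg n (fun l => f (s :: l))) / 4 := by
  unfold avg
  rw [← (Fin.consEquiv (fun _ : Fin (n + 1) => Fin 4)).sum_comp, Fintype.sum_prod_type,
    ← Finset.sum_div, div_div, pow_succ]
  simp [Fin.consEquiv, List.ofFn_succ]

lemma avg_mono {n : ℕ} {f g : List (Fin 4) → ℝ} (h : ∀ l, l.length = n → f l ≤ g l) :
    avg n f ≤ avg n g := by
  unfold avg
  gcongr
  exact h _ (by simp)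

lemma avg_congr {n : ℕ} {f g : List (Fin 4) → ℝ} (h : ∀ l, l.length = n → f l = g l) :
    avg n f = avg n g :=
  le_antisymm (avg_mono fun l hl => (h l hl).le) (avg_mono fun l hl => (h l hl).ge)

lemma avg_const (n : ℕ) (c : ℝ) : avg n (fun _ => c) = c := by
  simp [avg]

lemma avg_add (n : ℕ) (f g : List (Fin 4) → ℝ) :
    avg n (fun l => f l + g l) = avg n f + avg n g := by
  simp [avg, Finset.sum_add_distrib, add_div]

lemma avg_const_mul (n : ℕ) (c : ℝ) (f : List (Fin 4) → ℝ) :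
    avg n (fun l => c * f l) = c * avg n f := by
  simp [avg, ← Finset.mul_sum, mul_div_assoc]

lemma avg_sum {ι : Type*} (s : Finset ι) (n : ℕ) (f : ι → List (Fin 4) → ℝ) :
    avg n (fun l => ∑ i ∈ s, f i l) = ∑ i ∈ s, avg n (f i) := by
  unfold avg
  rw [Finset.sum_comm, Finset.sum_div]

lemma avg_nonneg {n : ℕ} {f : List (Fin 4) → ℝ} (h : ∀ l, l.length = n → 0 ≤ f l) :
    0 ≤ avg n f := by
  rw [← avg_const n 0]
  exact avg_mono h

lemma avg_le_const {n : ℕ} {f : List (Fin 4) → ℝ} {c : ℝ}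
    (h : ∀ l, l.length = n → f l ≤ c) : avg n f ≤ c := by
  rw [← avg_const n c]
  exact avg_mono h

lemma avg_append (a b : ℕ) (f : List (Fin 4) → ℝ) :
    avg (a + b) f = avg a (fun l => avg b (fun l' => f (l ++ l'))) := by
  induction a generalizing f with
  | zero => simp [avg_zero]
  | succ a ih =>
    rw [show a + 1 + b = a + b + 1 by ring, avg_succ, avg_succ]
    simp [ih]

lemma avg_comm (a b : ℕ) (F : List (Fin 4) → List (Fin 4) → ℝ) :
    avg a (fun l => avg b (fun l' => F l l')) = avg b (fun l' => avg a (fun l => F l l')) := by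
  unfold avg
  rw [← Finset.sum_div, ← Finset.sum_div, Finset.sum_comm, div_right_comm]

/-- The step sequence of the time-reversed path. -/
def rev (l : List (Fin 4)) : List (Fin 4) := (l.map opp).reverse

lemma rev_cons (s : Fin 4) (l : List (Fin 4)) : rev (s :: l) = rev l ++ [opp s] := by
  simp [rev]

lemma avg_one (f : List (Fin 4) → ℝ) : avg 1 f = (∑ s : Fin 4, f [s]) / 4 := by
  rw [avg_succ]; simp [avg_zero]

lemma avg_rev (n : ℕ) (f : List (Fin 4) → ℝ) : avg n (fun l => f (rev l)) = avg n f := by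
  induction n generalizing f with
  | zero => simp [avg_zero, rev]
  | succ n ih =>
    rw [avg_append n 1 f, avg_succ]
    simp only [rev_cons, avg_one]
    have h : ∀ s : Fin 4, avg n (fun l => f (rev l ++ [opp s]))
        = avg n (fun l => f (l ++ [opp s])) :=
      fun s => ih (fun l => f (l ++ [opp s]))
    simp only [h, ← avg_sum, Fin.sum_univ_four]
    rw [div_eq_inv_mul, ← avg_const_mul]
    apply avg_congr
    intro l _
    simp [opp]
    ring

/-- Total displacement of a step sequence. -/
def disp (l : List (Fin 4)) : ℤ × ℤ := (l.map vec).sum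

@[simp] lemma disp_nil : disp [] = 0 := rfl
@[simp] lemma disp_cons (s : Fin 4) (l : List (Fin 4)) : disp (s :: l) = vec s + disp l := by
  simp [disp]
@[simp] lemma disp_append (l l' : List (Fin 4)) : disp (l ++ l') = disp l + disp l' := by
  simp [disp]

lemma disp_rev (l : List (Fin 4)) : disp (rev l) = -disp l := by
  induction l with
  | nil => simp [rev]
  | cons s l ih => rw [rev_cons, disp_append, ih]; simp [vec_opp]

/-- The sites visited from `x` when following the steps of `l`. -/
def path : ℤ × ℤ → List (Fin 4) → List (ℤ × ℤ)
  | x, [] => [x]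
  | x, s :: l => x :: path (x + vec s) l

lemma start_mem_path (x : ℤ × ℤ) (l : List (Fin 4)) : x ∈ path x l := by
  cases l <;> simp [path]

lemma mem_path_append (x y : ℤ × ℤ) (l l' : List (Fin 4)) :
    y ∈ path x (l ++ l') ↔ y ∈ path x l ∨ y ∈ path (x + disp l) l' := by
  induction l generalizing x with
  | nil =>
    simp only [List.nil_append, path, disp_nil, add_zero, List.mem_singleton]
    constructor
    · exact Or.inr
    · rintro (rfl | h)
      · exact start_mem_path _ _
      · exact h
  | cons s l ih => simp [path, ih, or_assoc, add_assoc]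

lemma mem_path_add (x y c : ℤ × ℤ) (l : List (Fin 4)) :
    y ∈ path (x + c) l ↔ y - c ∈ path x l := by
  induction l generalizing x with
  | nil => simp [path, sub_eq_iff_eq_add]
  | cons s l ih =>
    rw [path, path, List.mem_cons, List.mem_cons, add_right_comm, ih, sub_eq_iff_eq_add]

lemma mem_path_rev (x y : ℤ × ℤ) (l : List (Fin 4)) :
    y ∈ path (x + disp l) (rev l) ↔ y ∈ path x l := by
  induction l generalizing x with
  | nil => simp [rev]
  | cons s l ih =>
    rw [rev_cons, mem_path_append, disp_cons, ← add_assoc, ih, disp_rev]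
    have h1 := start_mem_path (x + vec s) l
    simp only [path, vec_opp, add_neg_cancel_right, List.mem_cons, List.not_mem_nil, or_false]
    constructor
    · rintro (h | rfl | rfl)
      · exact Or.inr h
      · exact Or.inr h1
      · exact Or.inl rfl
    · rintro (h | h)
      · exact Or.inr (Or.inr h)
      · exact Or.inl h

lemma length_path (x : ℤ × ℤ) (l : List (Fin 4)) : (path x l).length = l.length + 1 := by
  induction l generalizing x with
  | nil => simp [path]
  | cons s l ih => simp [path, ih]

lemma mem_path_iff (x y : ℤ × ℤ) (l : List (Fin 4)) :
    y ∈ path x l ↔ ∃ k ≤ l.length, y = x + disp (l.take k) := by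
  induction l generalizing x with
  | nil => simp [path]
  | cons s l ih =>
    rw [path, List.mem_cons, ih]
    constructor
    · rintro (rfl | ⟨k, hk, rfl⟩)
      · exact ⟨0, by simp, by simp⟩
      · exact ⟨k + 1, by simpa using hk, by simp [add_assoc]⟩
    · rintro ⟨k, hk, rfl⟩
      cases k with
      | zero => simp
      | succ k => exact Or.inr ⟨k, by simpa using hk, by simp [add_assoc]⟩

/-- Transition probabilities of the simple random walk on `ℤ`. -/
noncomputable def hk : ℕ → ℤ → ℝ
  | 0, j => if j = 0 then 1 else 0
  | n + 1, j => (hk n (j - 1) + hk n (j + 1)) / 2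

lemma hk_eq_zero_of_lt (n : ℕ) (j : ℤ) (h : j < -n) : hk n j = 0 := by
  induction n generalizing j with
  | zero => simp [hk]; intro h'; simp [h'] at h
  | succ n ih =>
    push_cast at h
    rw [hk, ih _ (by omega), ih _ (by omega)]; simp

lemma hk_eq_zero_of_odd (n : ℕ) (j : ℤ) (h : (n + j) % 2 = 1) : hk n j = 0 := by
  induction n generalizing j with
  | zero => simp [hk]; intro h'; simp [h'] at h
  | succ n ih =>
    push_cast at h
    rw [hk, ih _ (by omega), ih _ (by omega)]; simp

lemma hk_eq_choose (n i : ℕ) : hk n (2 * i - n) = n.choose i / 2 ^ n := by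
  induction n generalizing i with
  | zero =>
    cases i with
    | zero => simp [hk]
    | succ i =>
      simp only [hk, Nat.choose_zero_succ]
      rw [if_neg (by push_cast; omega)]; simp
  | succ n ih =>
    have h2 := ih i
    rw [hk, show (2 * (i : ℤ) - (n + 1 : ℕ) + 1) = 2 * i - n by push_cast; ring, h2]
    cases i with
    | zero =>
      rw [hk_eq_zero_of_lt n _ (by push_cast; omega)]
      simp [pow_succ]; ring
    | succ i =>
      rw [show (2 * ((i + 1 : ℕ) : ℤ) - (n + 1 : ℕ) - 1) = 2 * i - n by push_cast; ring, ih i,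
        Nat.choose_succ_succ]
      push_cast
      field_simp
      ring

lemma hk_nonneg (n : ℕ) (j : ℤ) : 0 ≤ hk n j := by
  induction n generalizing j with
  | zero => simp only [hk]; split_ifs <;> norm_num
  | succ n ih => have := ih (j - 1); have := ih (j + 1); simp only [hk]; positivity

lemma centralBinom_upper (m : ℕ) :
    ((Nat.centralBinom m : ℝ) / 4 ^ m) ^ 2 * (2 * m + 1) ≤ 1 := by
  induction m with
  | zero => simp
  | succ m ih =>
    have h : ((m : ℝ) + 1) * Nat.centralBinom (m + 1) = 2 * (2 * m + 1) * Nat.centralBinom m := by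
      exact_mod_cast Nat.succ_mul_centralBinom_succ m
    have h' : (Nat.centralBinom (m + 1) : ℝ) / 4 ^ (m + 1)
        = (Nat.centralBinom m : ℝ) / 4 ^ m * ((2 * m + 1) / (2 * m + 2)) := by
      field_simp
      rw [pow_succ]
      linear_combination (2 * (4 : ℝ) ^ m) * h
    rw [h']
    refine le_trans ?_ ih
    rw [mul_pow, mul_assoc]
    gcongr
    rw [div_pow, div_mul_eq_mul_div, div_le_iff₀ (by positivity)]
    push_cast
    nlinarith [(Nat.cast_nonneg m : (0 : ℝ) ≤ m)]

lemma centralBinom_lower (m : ℕ) (hm : 1 ≤ m) :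
    1 ≤ ((Nat.centralBinom m : ℝ) / 4 ^ m) ^ 2 * (4 * m) := by
  induction m, hm using Nat.le_induction with
  | base => norm_num [Nat.centralBinom, Nat.choose]
  | succ m hm ih =>
    have h : ((m : ℝ) + 1) * Nat.centralBinom (m + 1) = 2 * (2 * m + 1) * Nat.centralBinom m := by
      exact_mod_cast Nat.succ_mul_centralBinom_succ m
    have h' : (Nat.centralBinom (m + 1) : ℝ) / 4 ^ (m + 1)
        = (Nat.centralBinom m : ℝ) / 4 ^ m * ((2 * m + 1) / (2 * m + 2)) := by
      field_simp
      rw [pow_succ]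
      linear_combination (2 * (4 : ℝ) ^ m) * h
    rw [h']
    refine le_trans ih ?_
    rw [mul_pow, mul_assoc]
    refine mul_le_mul_of_nonneg_left ?_ (by positivity)
    rw [div_pow, div_mul_eq_mul_div, le_div_iff₀ (by positivity)]
    push_cast
    nlinarith [(Nat.cast_nonneg m : (0 : ℝ) ≤ m)]

lemma hk_even_le (m : ℕ) (j : ℤ) : hk (2 * m) j ≤ (Nat.centralBinom m : ℝ) / 4 ^ m := by
  by_cases h1 : j < -((2 * m : ℕ) : ℤ)
  · rw [hk_eq_zero_of_lt _ _ h1]; positivity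
  by_cases h2 : (((2 * m : ℕ) : ℤ) + j) % 2 = 1
  · rw [hk_eq_zero_of_odd _ _ h2]; positivity
  obtain ⟨i, rfl⟩ : ∃ i : ℕ, j = 2 * i - (2 * m : ℕ) :=
    ⟨((j + (2 * m : ℕ)) / 2).toNat, by omega⟩
  rw [hk_eq_choose, pow_mul]
  norm_num
  gcongr
  exact Nat.choose_le_centralBinom i m

lemma hk_even_sq_le (m : ℕ) (i j : ℤ) : hk (2 * m) i * hk (2 * m) j ≤ 1 / (2 * m + 1) := by
  rw [le_div_iff₀ (by positivity)]
  refine le_trans ?_ (centralBinom_upper m)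
  rw [sq]
  gcongr
  · exact hk_nonneg _ _
  · exact hk_even_le m i
  · exact hk_even_le m j

lemma hk_mul_le (n : ℕ) (hn : 1 ≤ n) (i j : ℤ) : hk n i * hk n j ≤ 1 / n := by
  obtain ⟨m, rfl | rfl⟩ := Nat.even_or_odd' n
  · refine (hk_even_sq_le m i j).trans ?_
    push_cast
    gcongr
    · exact_mod_cast (by omega : 0 < 2 * m)
    · linarith
  · push_cast
    simp only [hk]
    have := hk_even_sq_le m (i - 1) (j - 1)
    have := hk_even_sq_le m (i - 1) (j + 1)
    have := hk_even_sq_le m (i + 1) (j - 1)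
    have := hk_even_sq_le m (i + 1) (j + 1)
    linarith

/-- Transition probabilities of the simple random walk on `ℤ²`. -/
noncomputable def trans (n : ℕ) (z : ℤ × ℤ) : ℝ :=
  avg n (fun l => if disp l = z then 1 else 0)

lemma trans_nonneg (n : ℕ) (z : ℤ × ℤ) : 0 ≤ trans n z :=
  avg_nonneg fun l _ => by split_ifs <;> norm_num

lemma trans_zero (z : ℤ × ℤ) : trans 0 z = if z = 0 then 1 else 0 := by
  by_cases h : z = 0
  · simp [trans, avg_zero, h]
  · simp [trans, avg_zero, h, Ne.symm h]

lemma trans_succ (n : ℕ) (z : ℤ × ℤ) :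
    trans (n + 1) z = (∑ s : Fin 4, trans n (z - vec s)) / 4 := by
  simp [trans, avg_succ, eq_sub_iff_add_eq, add_comm]

lemma trans_eq (n : ℕ) (z : ℤ × ℤ) : trans n z = hk n (z.1 + z.2) * hk n (z.1 - z.2) := by
  induction n generalizing z with
  | zero =>
    rw [trans_zero]
    simp only [hk]
    by_cases h : z = 0
    · simp [h]
    · have : ¬(z.1 + z.2 = 0 ∧ z.1 - z.2 = 0) := fun h' => h (by ext <;> simp <;> omega)
      rw [if_neg h]
      by_cases h1 : z.1 + z.2 = 0
      · rw [if_neg (fun h2 => this ⟨h1, h2⟩)]; simp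
      · simp [h1]
  | succ n ih =>
    rw [trans_succ, Fin.sum_univ_four]
    simp only [ih, hk, vec]
    simp
    ring_nf

lemma trans_le (n : ℕ) (hn : 1 ≤ n) (z : ℤ × ℤ) : trans n z ≤ 1 / n := by
  rw [trans_eq]; exact hk_mul_le n hn _ _

lemma trans_even_zero_ge (m : ℕ) (hm : 1 ≤ m) : 1 / (4 * m) ≤ trans (2 * m) 0 := by
  have h : hk (2 * m) 0 = (Nat.centralBinom m : ℝ) / 4 ^ m := by
    have := hk_eq_choose (2 * m) m
    rw [pow_mul] at this
    norm_num at this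
    rw [this, Nat.centralBinom]
  rw [trans_eq]
  simp only [Prod.fst_zero, Prod.snd_zero, add_zero, sub_zero, h, ← sq]
  rw [div_le_iff₀ (by positivity)]
  exact centralBinom_lower m hm

/-- Truncated Green function of the simple random walk on `ℤ²`. -/
noncomputable def green (L : ℕ) (z : ℤ × ℤ) : ℝ := ∑ k ∈ Finset.range (L + 1), trans k z

lemma green_mono {L L' : ℕ} (h : L ≤ L') (z : ℤ × ℤ) : green L z ≤ green L' z :=
  Finset.sum_le_sum_of_subset_of_nonneg (Finset.range_subset_range.2 (by omega))
    fun _ _ _ => trans_nonneg _ _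

lemma green_zero_ge (m : ℕ) : Real.log (m + 1) / 4 ≤ green (2 * m) 0 := by
  have h1 : Real.log (m + 1) ≤ (harmonic m : ℝ) := by exact_mod_cast log_add_one_le_harmonic m
  have h2 : (harmonic m : ℝ) / 4 ≤ green (2 * m) 0 := by
    have : ∑ i ∈ Finset.range m, trans (2 * (i + 1)) 0 ≤ green (2 * m) 0 := by
      unfold green
      rw [← Finset.sum_image (f := fun k => trans k 0) (g := fun i => 2 * (i + 1))
        (by intro a _ b _ h; simpa using h)]
      apply Finset.sum_le_sum_of_subset_of_nonneg
      · intro k hk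
        simp only [Finset.mem_image, Finset.mem_range] at hk ⊢
        omega
      · exact fun _ _ _ => trans_nonneg _ _
    refine le_trans ?_ this
    rw [harmonic]
    push_cast
    rw [Finset.sum_div]
    apply Finset.sum_le_sum
    intro i _
    refine le_trans (le_of_eq ?_) (trans_even_zero_ge (i + 1) (by omega))
    push_cast
    field_simp
  linarith

lemma green_succ (L : ℕ) (z : ℤ × ℤ) :
    green (L + 1) z = (if z = 0 then 1 else 0) + (∑ s : Fin 4, green L (z - vec s)) / 4 := by
  unfold green
  rw [Finset.sum_range_succ', trans_zero, add_comm, Finset.sum_comm, Finset.sum_div]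
  simp [trans_succ]

open Classical in
/-- Real-valued indicator of a proposition. -/
noncomputable def ind (p : Prop) : ℝ := if p then 1 else 0

lemma ind_of {p : Prop} (h : p) : ind p = 1 := by simp [ind, h]
lemma ind_not {p : Prop} (h : ¬p) : ind p = 0 := by simp [ind, h]
lemma ind_nonneg (p : Prop) : 0 ≤ ind p := by unfold ind; split_ifs <;> norm_num
lemma ind_le_one (p : Prop) : ind p ≤ 1 := by unfold ind; split_ifs <;> norm_num
lemma ind_mono {p q : Prop} (h : p → q) : ind p ≤ ind q := by
  by_cases hp : p
  · rw [ind_of hp, ind_of (h hp)]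
  · rw [ind_not hp]; exact ind_nonneg q
lemma ind_and (p q : Prop) : ind (p ∧ q) = ind p * ind q := by
  by_cases hp : p <;> by_cases hq : q <;> simp [ind, hp, hq]
lemma ind_or_le (p q : Prop) : ind (p ∨ q) ≤ ind p + ind q := by
  by_cases hp : p <;> by_cases hq : q <;> simp [ind, hp, hq]

lemma trans_eq_avg_ind (n : ℕ) (z : ℤ × ℤ) : trans n z = avg n (fun l => ind (disp l = z)) :=
  avg_congr fun l _ => by by_cases h : disp l = z <;> simp [ind, h]

lemma trans_add (a b : ℕ) (z : ℤ × ℤ) :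
    trans (a + b) z = avg a (fun l => trans b (z - disp l)) := by
  simp only [trans_eq_avg_ind, avg_append]
  refine avg_congr fun l _ => avg_congr fun l' _ => ?_
  rw [disp_append, eq_sub_iff_add_eq, add_comm]

lemma hit_mul_green_le (n L : ℕ) (x y : ℤ × ℤ) :
    avg n (fun l => ind (y ∈ path x l)) * green L 0 ≤ green (n + L) (y - x) := by
  have hg : ∀ L z, 0 ≤ green L z := fun L z => Finset.sum_nonneg fun _ _ => trans_nonneg _ _
  induction n generalizing x with
  | zero =>
    rw [avg_zero, zero_add]
    by_cases h : y = x
    · rw [ind_of (by simp [path, h])]; simp [h]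
    · rw [ind_not (by simp [path, h])]; simp [hg]
  | succ n ih =>
    by_cases h : y = x
    · have h1 : avg (n + 1) (fun l => ind (y ∈ path x l)) ≤ 1 :=
        avg_le_const fun l _ => ind_le_one _
      subst h
      rw [sub_self]
      have h2 : green L 0 ≤ green (n + 1 + L) 0 := green_mono (by omega) _
      nlinarith [hg L 0]
    · rw [add_right_comm, green_succ, if_neg (sub_ne_zero.2 h), zero_add, avg_succ,
        div_mul_eq_mul_div,
        Finset.sum_mul]
      gcongr with s
      refine le_trans (le_of_eq ?_) ((ih (x + vec s)).trans (le_of_eq ?_))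
      · simp [path, h]
      · congr 1; abel

lemma late_hit_mul_green_le (a n L : ℕ) (x y : ℤ × ℤ) :
    avg a (fun l => avg n (fun l' => ind (y ∈ path (x + disp l) l'))) * green L 0
      ≤ ∑ k ∈ Finset.range (n + L + 1), trans (a + k) (y - x) := by
  simp only [trans_add, ← avg_sum]
  rw [mul_comm, ← avg_const_mul]
  refine avg_mono fun l _ => ?_
  rw [mul_comm]
  refine (hit_mul_green_le n L _ y).trans (le_of_eq ?_)
  unfold green
  simp only [sub_sub]

lemma sum_inv_le (a K : ℕ) (ha : 1 ≤ a) :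
    ∑ k ∈ Finset.range (K + 1), 1 / ((a + k : ℕ) : ℝ) ≤ 1 + Real.log ((a + K) / a) := by
  have ha' : (1 : ℝ) ≤ a := by exact_mod_cast ha
  induction K with
  | zero =>
    simp only [zero_add, Finset.sum_range_one, Nat.cast_zero, add_zero]
    rw [div_self (by positivity), Real.log_one, add_zero, div_le_one (by positivity)]
    exact ha'
  | succ K ih =>
    rw [Finset.sum_range_succ]
    have h1 := Real.one_sub_inv_le_log_of_pos
      (show (0 : ℝ) < (a + (K + 1 : ℕ)) / (a + K) by positivity)
    have h2 : Real.log (((a : ℝ) + (K + 1 : ℕ)) / a)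
        = Real.log ((a + K) / a) + Real.log ((a + (K + 1 : ℕ)) / (a + K)) := by
      rw [← Real.log_mul (by positivity) (by positivity)]
      congr 1
      field_simp
    have h3 : (1 : ℝ) - (((a : ℝ) + (K + 1 : ℕ)) / (a + K))⁻¹ = 1 / ((a + (K + 1) : ℕ) : ℝ) := by
      push_cast
      field_simp
      ring
    linarith

/-- The number of sites of `G` visited from `x` along `l`. -/
noncomputable def hits (G : Finset (ℤ × ℤ)) (x : ℤ × ℤ) (l : List (Fin 4)) : ℕ :=
  (G.filter (· ∈ path x l)).card

lemma hits_le_length (G : Finset (ℤ × ℤ)) (x : ℤ × ℤ) (l : List (Fin 4)) :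
    hits G x l ≤ l.length + 1 := by
  rw [← length_path x l]
  refine le_trans (Finset.card_le_card ?_) (List.toFinset_card_le _)
  intro y; simp

lemma hits_nil (G : Finset (ℤ × ℤ)) (x : ℤ × ℤ) : hits G x [] = if x ∈ G then 1 else 0 := by
  simp [hits, path, Finset.filter_eq', apply_ite]

lemma hits_cons (G : Finset (ℤ × ℤ)) (x : ℤ × ℤ) (s : Fin 4) (l : List (Fin 4)) :
    hits G x (s :: l) = (if x ∈ G then 1 else 0) + hits (G.erase x) (x + vec s) l := by
  unfold hits
  by_cases h : x ∈ G
  · conv_lhs => rw [← Finset.insert_erase h]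
    rw [Finset.filter_insert, if_pos (by simp [path]), Finset.card_insert_of_notMem (by simp),
        if_pos h,
      add_comm]
    congr 2
    refine Finset.filter_congr fun y hy => ?_
    simp [path, (Finset.mem_erase.1 hy).1]
  · rw [Finset.erase_eq_of_notMem h, if_neg h, zero_add]
    congr 1
    refine Finset.filter_congr fun y hy => ?_
    have : y ≠ x := fun e => h (e ▸ hy)
    simp [path, this]

lemma hits_eq_sum (G : Finset (ℤ × ℤ)) (x : ℤ × ℤ) (l : List (Fin 4)) :
    (hits G x l : ℝ) = ∑ y ∈ G, ind (y ∈ path x l) := by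
  unfold hits ind
  rw [Finset.card_filter]
  push_cast
  exact Finset.sum_congr rfl fun y _ => by by_cases h : y ∈ path x l <;> simp [h]

lemma avg_hits_le (G : Finset (ℤ × ℤ)) (x : ℤ × ℤ) (N a L : ℕ) (ha : 1 ≤ a)
    (hL : 0 < green L 0) :
    avg N (fun l => (hits G x l : ℝ))
      ≤ (a + 1) + G.card * ((1 + Real.log ((a + N + L) / a)) / green L 0) := by
  have ha' : (1 : ℝ) ≤ a := by exact_mod_cast ha
  have hlog : 0 ≤ Real.log (((a : ℝ) + N + L) / a) := by
    apply Real.log_nonneg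
    rw [le_div_iff₀ (by positivity)]
    linarith [(Nat.cast_nonneg N : (0 : ℝ) ≤ N), (Nat.cast_nonneg L : (0 : ℝ) ≤ L)]
  by_cases hN : N ≤ a
  · refine le_add_of_le_of_nonneg ?_ (by positivity)
    refine avg_le_const fun l hl => ?_
    have h1 := hits_le_length G x l
    exact_mod_cast (by omega : hits G x l ≤ a + 1)
  · obtain ⟨n, rfl⟩ : ∃ n, N = a + n := ⟨N - a, by omega⟩
    rw [avg_append]
    have h1 : ∀ l l', (hits G x (l ++ l') : ℝ)
        ≤ hits G x l + ∑ y ∈ G, ind (y ∈ path (x + disp l) l') := by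
      intro l l'
      rw [hits_eq_sum, hits_eq_sum, ← Finset.sum_add_distrib]
      refine Finset.sum_le_sum fun y _ => ?_
      rw [mem_path_append]
      exact ind_or_le _ _
    refine (avg_mono fun l _ => avg_mono fun l' _ => h1 l l').trans ?_
    simp only [avg_add, avg_const, avg_sum]
    refine add_le_add ?_ ?_
    · refine avg_le_const fun l hl => ?_
      have h1 := hits_le_length G x l
      exact_mod_cast (by omega : hits G x l ≤ a + 1)
    · rw [← nsmul_eq_mul]
      refine Finset.sum_le_card_nsmul _ _ _ fun y _ => ?_
      rw [le_div_iff₀ hL]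
      refine (late_hit_mul_green_le a n L x y).trans ?_
      refine (Finset.sum_le_sum fun k _ => trans_le (a + k) (by omega) _).trans ?_
      refine (sum_inv_le a (n + L) ha).trans ?_
      push_cast
      gcongr 1 + Real.log (?_ / _)
      linarith [(Nat.cast_nonneg a : (0 : ℝ) ≤ a)]

lemma avg_exp_hits_le (N : ℕ) (θ B : ℝ) (hθ : 0 ≤ θ) (hB : 2 * θ * B ≤ 1)
    (G : Finset (ℤ × ℤ))
    (H : ∀ n ≤ N, ∀ G' ⊆ G, ∀ x, avg n (fun l => (hits G' x l : ℝ)) ≤ B) (x : ℤ × ℤ) :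
    avg N (fun l => (1 + θ) ^ hits G x l) ≤ 1 + 2 * θ * avg N (fun l => (hits G x l : ℝ)) := by
  induction N generalizing G x with
  | zero =>
    simp only [avg_zero, hits_nil]
    split_ifs <;> simp
    linarith
  | succ n ih =>
    rw [avg_succ, avg_succ, ← mul_div_assoc, Finset.mul_sum]
    have key : ∀ s : Fin 4, avg n (fun l => (1 + θ) ^ hits G x (s :: l))
        ≤ 1 + 2 * θ * avg n (fun l => (hits G x (s :: l) : ℝ)) := by
      intro s
      have hH : ∀ m ≤ n, ∀ G' ⊆ G.erase x, ∀ x, avg m (fun l => (hits G' x l : ℝ)) ≤ B :=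
        fun m hm G' hG' => H m (by omega) G' (hG'.trans (Finset.erase_subset _ _))
      have h1 := ih (G.erase x) hH (x + vec s)
      have h2 := hH n le_rfl (G.erase x) subset_rfl (x + vec s)
      simp only [hits_cons]
      by_cases hx : x ∈ G
      · simp only [if_pos hx, pow_add, pow_one, Nat.cast_add, Nat.cast_one, avg_const_mul, avg_add,
          avg_const]
        have h3 : 2 * θ * avg n (fun l => (hits (G.erase x) (x + vec s) l : ℝ)) ≤ 1 :=
          (mul_le_mul_of_nonneg_left h2 (by positivity)).trans hB
        nlinarith [mul_le_mul_of_nonneg_left (h1.trans (add_le_add_right h3 1)) hθ]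
      · simp only [if_neg hx, zero_add]
        exact h1
    have := Finset.sum_le_sum fun s (_ : s ∈ Finset.univ) => key s
    rw [Finset.sum_add_distrib] at this
    simp only [Finset.sum_const, Finset.card_univ, Fintype.card_fin, nsmul_eq_mul] at this
    push_cast at this
    linarith

lemma avg_ind_hits_le (N a L : ℕ) (ha : 1 ≤ a) (hL : 0 < green L 0) (G : Finset (ℤ × ℤ)) (x : ℤ × ℤ)
    (η : ℝ) (hη : 0 < η) (h1 : 1 ≤ 2 * (η * G.card))
    (hB : (a + 1) + G.card * ((1 + Real.log ((a + N + L) / a)) / green L 0) ≤ η * G.card) :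
    avg N (fun l => ind ((G.card : ℝ) ≤ 4 * hits G x l)) ≤ 2 * Real.exp (-(1 / (16 * η))) := by
  set B := η * G.card with hBdef
  have ha' : (1 : ℝ) ≤ a := by exact_mod_cast ha
  have hBpos : 0 < B := by linarith
  have hH : ∀ n ≤ N, ∀ G' ⊆ G, ∀ x, avg n (fun l => (hits G' x l : ℝ)) ≤ B := by
    intro n hn G' hG' x
    refine (avg_hits_le G' x n a L ha hL).trans (le_trans ?_ hB)
    have hc : (G'.card : ℝ) ≤ G.card := by exact_mod_cast Finset.card_le_card hG'
    have hn' : (n : ℝ) ≤ N := by exact_mod_cast hn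
    have hlog : 0 ≤ Real.log (((a : ℝ) + n + L) / a) := by
      apply Real.log_nonneg
      rw [le_div_iff₀ (by positivity)]
      linarith [(Nat.cast_nonneg n : (0 : ℝ) ≤ n), (Nat.cast_nonneg L : (0 : ℝ) ≤ L)]
    gcongr
  set θ : ℝ := 1 / (2 * B) with hθ
  have hθ0 : 0 < θ := by positivity
  have hθ1 : θ ≤ 1 := by rw [hθ, div_le_one (by positivity)]; exact h1
  have hθB : 2 * θ * B = 1 := by rw [hθ]; field_simp
  have hE := avg_exp_hits_le N θ B hθ0.le hθB.le G hH x
  have hE2 : avg N (fun l => (1 + θ) ^ hits G x l) ≤ 2 := by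
    have := hH N le_rfl G subset_rfl x
    nlinarith
  have hexp : Real.exp (θ / 2) ≤ 1 + θ := by
    have := Real.exp_bound_div_one_sub_of_interval (show 0 ≤ θ / 2 by positivity)
      (show θ / 2 < 1 by linarith)
    refine this.trans ?_
    rw [div_le_iff₀ (by linarith)]
    nlinarith
  have hpt : ∀ l, ind ((G.card : ℝ) ≤ 4 * hits G x l)
      ≤ Real.exp (-(1 / (16 * η))) * (1 + θ) ^ hits G x l := by
    intro l
    by_cases h : (G.card : ℝ) ≤ 4 * hits G x l
    · rw [ind_of h]
      have h2 : Real.exp (θ / 2 * hits G x l) ≤ (1 + θ) ^ hits G x l := by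
        rw [mul_comm, Real.exp_nat_mul]
        gcongr
      have h3 : 1 / (16 * η) ≤ θ / 2 * hits G x l := by
        have : 1 / (16 * η) = θ / 2 * (G.card / 4) := by
          have : (0 : ℝ) < G.card := by
            by_contra hc
            have : (G.card : ℝ) = 0 := le_antisymm (not_lt.1 hc) (Nat.cast_nonneg _)
            rw [hBdef, this] at hBpos
            simp at hBpos
          rw [hθ, hBdef]; field_simp; norm_num
        rw [this]
        gcongr
        linarith
      calc (1 : ℝ) = Real.exp (-(1 / (16 * η))) * Real.exp (1 / (16 * η)) := by
            rw [← Real.exp_add]; simp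
        _ ≤ _ := by
            gcongr
            exact (Real.exp_le_exp.2 h3).trans h2
    · rw [ind_not h]; positivity
  refine (avg_mono fun l _ => hpt l).trans ?_
  rw [avg_const_mul, mul_comm]
  gcongr

/-- The number of distinct sites visited along `l`. -/
def rangeCard (l : List (Fin 4)) : ℕ := (path 0 l).toFinset.card

lemma toFinset_path_add (x c : ℤ × ℤ) (l : List (Fin 4)) :
    (path (x + c) l).toFinset = (path x l).toFinset.image (· + c) := by
  ext y
  simp only [List.mem_toFinset, mem_path_add, Finset.mem_image]
  exact ⟨fun h => ⟨_, h, by simp⟩, by rintro ⟨z, hz, rfl⟩; simpa using hz⟩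

lemma card_toFinset_path (x : ℤ × ℤ) (l : List (Fin 4)) :
    (path x l).toFinset.card = rangeCard l := by
  have := toFinset_path_add 0 x l
  rw [zero_add] at this
  rw [this, Finset.card_image_of_injective _ (add_left_injective x), rangeCard]

lemma hits_path_add (z : ℤ × ℤ) (l l' : List (Fin 4)) :
    hits (path z l).toFinset z l' = hits (path 0 l).toFinset 0 l' := by
  have h := toFinset_path_add 0 z l
  rw [zero_add] at h
  unfold hits
  rw [h, Finset.filter_image, Finset.card_image_of_injective _ (add_left_injective z)]
  congr 1
  refine Finset.filter_congr fun y _ => ?_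
  have := mem_path_add 0 (y + z) z l'
  simpa using this

lemma hits_rev (G : Finset (ℤ × ℤ)) (x : ℤ × ℤ) (l : List (Fin 4)) :
    hits G x l = hits G (x + disp l) (rev l) := by
  unfold hits
  simp only [mem_path_rev]

lemma rangeCard_append_left (l l' : List (Fin 4)) : rangeCard l ≤ rangeCard (l ++ l') := by
  refine Finset.card_le_card fun y => ?_
  simp only [List.mem_toFinset, mem_path_append]
  exact Or.inl

lemma rangeCard_append_right (l l' : List (Fin 4)) : rangeCard l' ≤ rangeCard (l ++ l') := by
  rw [← card_toFinset_path (0 + disp l) l']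
  refine Finset.card_le_card fun y => ?_
  simp only [List.mem_toFinset, mem_path_append]
  exact Or.inr

/-- The number of pairs of equal entries of a list. -/
def selfPairs (p : List (ℤ × ℤ)) : ℕ := ∑ y ∈ p.toFinset, p.count y ^ 2

lemma selfPairs_cons (x : ℤ × ℤ) (p : List (ℤ × ℤ)) :
    selfPairs (x :: p) = selfPairs p + 2 * p.count x + 1 := by
  unfold selfPairs
  have h1 : ∑ y ∈ p.toFinset, p.count y ^ 2 = ∑ y ∈ (x :: p).toFinset, p.count y ^ 2 := by
    apply Finset.sum_subset
    · intro y; simp; exact Or.inr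
    · intro y _ hy
      rw [List.mem_toFinset] at hy
      simp [List.count_eq_zero_of_not_mem hy]
  rw [h1]
  have h2 : ∀ y, (x :: p).count y ^ 2
      = p.count y ^ 2 + if y = x then 2 * p.count x + 1 else 0 := by
    intro y
    rw [List.count_cons]
    by_cases h : y = x
    · subst h; simp; ring
    · simp [h, Ne.symm h]
  simp only [h2, Finset.sum_add_distrib, Finset.sum_ite_eq']
  simp [add_assoc]

lemma sq_length_le (p : List (ℤ × ℤ)) : p.length ^ 2 ≤ p.toFinset.card * selfPairs p := by
  have := sq_sum_le_card_mul_sum_sq (s := p.toFinset) (f := fun y => p.count y)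
  have h : ∑ y ∈ p.toFinset, p.count y = p.length := by
    convert List.sum_toFinset_count_eq_length p
  rwa [h] at this

lemma avg_count (n : ℕ) (x y : ℤ × ℤ) :
    avg n (fun l => ((path x l).count y : ℝ)) = green n (y - x) := by
  induction n generalizing x with
  | zero =>
    rw [avg_zero, green]
    by_cases h : x = y
    · simp [path, trans_zero, h]
    · simp [path, trans_zero, h, sub_eq_zero, Ne.symm h]
  | succ n ih =>
    rw [avg_succ, green_succ]
    have h1 : ∀ s : Fin 4, avg n (fun l => ((path x (s :: l)).count y : ℝ))
        = (if y - x = 0 then 1 else 0) + green n (y - x - vec s) := by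
      intro s
      rw [sub_sub, ← ih (x + vec s), ← avg_const n (if y - x = 0 then 1 else 0), ← avg_add]
      refine avg_congr fun l _ => ?_
      rw [path, List.count_cons]
      by_cases h : x = y
      · simp [h, add_comm]
      · simp [h, sub_eq_zero, Ne.symm h]
    simp only [h1, Finset.sum_add_distrib]
    simp
    split_ifs <;> ring

lemma green_zero_ge_one (n : ℕ) : 1 ≤ green n 0 := by
  refine le_trans (le_of_eq ?_) (green_mono (Nat.zero_le n) 0)
  simp [green, trans_zero]

lemma avg_selfPairs_le (n : ℕ) (x : ℤ × ℤ) :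
    avg n (fun l => (selfPairs (path x l) : ℝ)) ≤ (n + 1) * (2 * green n 0) := by
  induction n generalizing x with
  | zero =>
    rw [avg_zero]
    simp [path, selfPairs, green, trans_zero]
  | succ n ih =>
    rw [avg_succ]
    have h1 : ∀ s : Fin 4, avg n (fun l => (selfPairs (path x (s :: l)) : ℝ))
        ≤ (n + 1) * (2 * green n 0) + 2 * green n (0 - vec s) + 1 := by
      intro s
      have h2 : avg n (fun l => (selfPairs (path x (s :: l)) : ℝ))
          = avg n (fun l => (selfPairs (path (x + vec s) l) : ℝ))
            + 2 * avg n (fun l => ((path (x + vec s) l).count x : ℝ)) + 1 := by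
        rw [← avg_const_mul, ← avg_add, ← avg_const n 1, ← avg_add]
        refine avg_congr fun l _ => ?_
        rw [path, selfPairs_cons]
        push_cast
        rfl
      rw [h2, avg_count]
      have h3 := ih (x + vec s)
      rw [show x - (x + vec s) = 0 - vec s by abel]
      linarith
    have h4 := Finset.sum_le_sum fun s (_ : s ∈ Finset.univ) => h1 s
    simp only [Finset.sum_add_distrib, ← Finset.mul_sum] at h4
    have h5 := green_succ n 0
    rw [if_pos rfl] at h5
    have h6 := green_mono (Nat.le_succ n) 0
    simp only [Finset.sum_const, Finset.card_univ, Fintype.card_fin, nsmul_eq_mul] at h4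
    push_cast at h4 ⊢
    have h7 : ((n : ℝ) + 1) * green n 0 ≤ (n + 1) * green (n + 1) 0 := by gcongr
    linarith [green_zero_ge_one (n + 1)]

lemma avg_ind_rangeCard_lt_le_half (n : ℕ) (g : ℝ) (hg : g * (4 * green n 0) ≤ n + 1) :
    avg n (fun l => ind ((rangeCard l : ℝ) < g)) ≤ 1 / 2 := by
  have hG := green_zero_ge_one n
  have hpt : ∀ l : List (Fin 4), l.length = n → ind ((rangeCard l : ℝ) < g)
      ≤ 1 / ((n + 1) * (4 * green n 0)) * selfPairs (path 0 l) := by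
    intro l hl
    by_cases h : (rangeCard l : ℝ) < g
    · rw [ind_of h, div_mul_eq_mul_div, one_mul, le_div_iff₀ (by positivity), one_mul]
      have h1 := sq_length_le (path 0 l)
      rw [length_path, hl] at h1
      have h2 : ((n : ℝ) + 1) ^ 2 ≤ rangeCard l * selfPairs (path 0 l) := by exact_mod_cast h1
      have h3 : (rangeCard l : ℝ) * (4 * green n 0) ≤ n + 1 := by
        refine le_trans ?_ hg
        gcongr
      have h4 : (0 : ℝ) < rangeCard l := by
        by_contra hc
        have : (rangeCard l : ℝ) = 0 := le_antisymm (not_lt.1 hc) (Nat.cast_nonneg _)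
        rw [this, zero_mul] at h2
        nlinarith [(Nat.cast_nonneg n : (0 : ℝ) ≤ n)]
      have h5 : (rangeCard l : ℝ) * ((n + 1) * (4 * green n 0))
          ≤ rangeCard l * selfPairs (path 0 l) := by nlinarith
      exact le_of_mul_le_mul_left h5 h4
    · rw [ind_not h]; positivity
  refine (avg_mono hpt).trans ?_
  rw [avg_const_mul, div_mul_eq_mul_div, one_mul, div_le_iff₀ (by positivity)]
  have := avg_selfPairs_le n 0
  linarith

lemma avg_ind_rangeCard_lt_le (b j m : ℕ) (g : ℝ) (hg : g * (4 * green b 0) ≤ b + 1)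
    (hm : j * b ≤ m) : avg m (fun l => ind ((rangeCard l : ℝ) < g)) ≤ (1 / 2) ^ j := by
  induction j generalizing m with
  | zero => simpa using avg_le_const fun l _ => ind_le_one _
  | succ j ih =>
    obtain ⟨m', rfl⟩ : ∃ m', m = b + m' := ⟨m - b, by rw [add_mul] at hm; omega⟩
    have h1 := ih m' (by rw [add_mul] at hm; omega)
    rw [avg_append]
    have hpt : ∀ l l' : List (Fin 4), ind ((rangeCard (l ++ l') : ℝ) < g)
        ≤ ind ((rangeCard l : ℝ) < g) * ind ((rangeCard l' : ℝ) < g) := by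
      intro l l'
      rw [← ind_and]
      refine ind_mono fun h => ⟨lt_of_le_of_lt ?_ h, lt_of_le_of_lt ?_ h⟩
      · exact_mod_cast rangeCard_append_left l l'
      · exact_mod_cast rangeCard_append_right l l'
    refine (avg_mono fun l _ => avg_mono fun l' _ => hpt l l').trans ?_
    simp only [avg_const_mul]
    refine (avg_mono (g := fun l => (1 / 2) ^ j * ind ((rangeCard l : ℝ) < g))
      fun l _ => ?_).trans ?_
    · rw [mul_comm]
      exact mul_le_mul_of_nonneg_right h1 (ind_nonneg _)
    · rw [avg_const_mul, pow_succ]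
      gcongr
      exact avg_ind_rangeCard_lt_le_half b g hg

/-- The position at time `k` of the planar walk with steps `l`. -/
def pos (l : List (Fin 4)) (k : ℕ) : ℤ × ℤ := disp (l.take k)

/-- The number of times in `[a, b)` at which `u` visits a new site. -/
def newCount (u : ℕ → ℤ × ℤ) (a b : ℕ) : ℕ :=
  ((Finset.Ico a b).filter (fun k => ∀ j < k, u j ≠ u k)).card

lemma card_le_newCount_add_hits (l₁ l₂ l₃ l₄ : List (Fin 4)) :
    (path (disp l₁ + disp l₂) l₃).toFinset.card
      ≤ newCount (pos (l₁ ++ (l₂ ++ (l₃ ++ l₄)))) (l₁.length + l₂.length)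
          (l₁.length + l₂.length + l₃.length + 1)
        + hits (path (disp l₁ + disp l₂) l₃).toFinset 0 l₁
        + hits (path (disp l₁ + disp l₂) l₃).toFinset (disp l₁) l₂ := by
  set G := (path (disp l₁ + disp l₂) l₃).toFinset with hG
  set u := pos (l₁ ++ (l₂ ++ (l₃ ++ l₄))) with hu
  set N := l₁.length + l₂.length with hN
  have hsub : G ⊆ (((Finset.Ico N (N + l₃.length + 1)).filter
      (fun k => ∀ j < k, u j ≠ u k)).image u ∪ G.filter (· ∈ path 0 l₁))
        ∪ G.filter (· ∈ path (disp l₁) l₂) := by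
    intro y hy
    by_cases h1 : y ∈ path 0 l₁
    · simp [hy, h1]
    by_cases h2 : y ∈ path (disp l₁) l₂
    · simp [hy, h2]
    have hy' := hy
    rw [hG, List.mem_toFinset, mem_path_iff] at hy'
    obtain ⟨k, hk, hyk⟩ := hy'
    have hex : u (N + k) = y := by
      rw [hyk, hu, pos, List.take_append, List.take_append, List.take_append,
        List.take_of_length_le (by omega), List.take_of_length_le (by omega)]
      have e1 : N + k - l₁.length - l₂.length = k := by omega
      have e2 : N + k - l₁.length - l₂.length - l₃.length = 0 := by omega
      rw [e2, e1, List.take_zero, List.append_nil, disp_append, disp_append, add_assoc]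
    classical
    obtain ⟨j, hj, hjle, hjmin⟩ : ∃ j, u j = y ∧ j ≤ N + k ∧ ∀ i < j, u i ≠ y := by
      have hE : ∃ j, u j = y := ⟨_, hex⟩
      exact ⟨Nat.find hE, Nat.find_spec hE, Nat.find_min' hE hex, fun i => Nat.find_min hE⟩
    have hjge : N ≤ j := by
      by_contra hlt
      push Not at hlt
      have hj' := hj
      rw [hu, pos, ← List.append_assoc, List.take_append_of_le_length (by simp; omega)] at hj'
      have : y ∈ path 0 (l₁ ++ l₂) := by
        rw [mem_path_iff]
        exact ⟨j, by simp; omega, by rw [zero_add]; exact hj'.symm⟩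
      rw [mem_path_append, zero_add] at this
      tauto
    simp only [Finset.mem_union, Finset.mem_image, Finset.mem_filter, Finset.mem_Ico]
    refine Or.inl (Or.inl ⟨j, ⟨⟨hjge, by omega⟩, fun i hi => ?_⟩, hj⟩)
    rw [hj]
    exact hjmin i hi
  refine (Finset.card_le_card hsub).trans ((Finset.card_union_le _ _).trans ?_)
  refine Nat.add_le_add ((Finset.card_union_le _ _).trans ?_) le_rfl
  exact Nat.add_le_add Finset.card_image_le le_rfl

lemma avg_ind_disp_mul_le (a : ℕ) (ha : 1 ≤ a) (w : List (Fin 4) → ℤ × ℤ) (m : ℕ)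
    (f : List (Fin 4) → ℝ) (hf : ∀ l, 0 ≤ f l) :
    avg a (fun l => avg m (fun l' => ind (disp l = w l') * f l')) ≤ 1 / a * avg m f := by
  rw [avg_comm, ← avg_const_mul]
  refine avg_mono fun l' _ => ?_
  simp only [mul_comm (ind _)]
  rw [avg_const_mul, ← trans_eq_avg_ind, mul_comm]
  exact mul_le_mul_of_nonneg_right (trans_le a ha _) (hf l')

lemma avg_window_le (N₁ N₂ n₃ n₄ : ℕ) (h₁ : 1 ≤ N₁) (h₂ : 1 ≤ N₂) (g α γ : ℝ) (v : ℤ × ℤ)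
    (hα : avg n₃ (fun l => ind ((rangeCard l : ℝ) < 2 * g)) ≤ α)
    (hγ₁ : ∀ (G : Finset (ℤ × ℤ)) x, 2 * g ≤ G.card →
      avg N₁ (fun l => ind ((G.card : ℝ) ≤ 4 * hits G x l)) ≤ γ)
    (hγ₂ : ∀ (G : Finset (ℤ × ℤ)) x, 2 * g ≤ G.card →
      avg N₂ (fun l => ind ((G.card : ℝ) ≤ 4 * hits G x l)) ≤ γ) :
    avg (N₁ + (N₂ + (n₃ + n₄))) (fun l => ind (disp l = v) *
      ind ((newCount (pos l) (N₁ + N₂) (N₁ + N₂ + n₃ + 1) : ℝ) < g))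
      ≤ 1 / N₁ * α + 1 / N₁ * γ + 1 / N₂ * γ := by
  have hγ : 0 ≤ γ := by
    obtain ⟨G, hG⟩ : ∃ G : Finset (ℤ × ℤ), 2 * g ≤ G.card := by
      obtain ⟨k, hk⟩ := exists_nat_ge (2 * g)
      obtain ⟨G, hG⟩ := Infinite.exists_subset_card_eq (ℤ × ℤ) k
      exact ⟨G, by rw [hG]; exact hk⟩
    exact (avg_nonneg fun _ _ => ind_nonneg _).trans (hγ₁ G 0 hG)
  let bad : Finset (ℤ × ℤ) → ℤ × ℤ → List (Fin 4) → ℝ := fun G x l =>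
    ind (2 * g ≤ (G.card : ℝ) ∧ (G.card : ℝ) ≤ 4 * hits G x l)
  have hbad : ∀ N, (∀ (G : Finset (ℤ × ℤ)) x, 2 * g ≤ G.card →
      avg N (fun l => ind ((G.card : ℝ) ≤ 4 * hits G x l)) ≤ γ) →
      ∀ G x, avg N (bad G x) ≤ γ := by
    intro N hN G x
    by_cases hG : 2 * g ≤ (G.card : ℝ)
    · simpa [bad, hG] using hN G x hG
    · refine avg_le_const fun l _ => ?_
      simp only [bad]
      rw [ind_not fun h => hG h.1]
      exact hγ
  have hbad0 : ∀ G x l, 0 ≤ bad G x l := fun _ _ _ => ind_nonneg _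
  have hpt : ∀ l₁ l₂ l₃ l₄ : List (Fin 4), l₁.length = N₁ → l₂.length = N₂ → l₃.length = n₃ →
      ind (disp (l₁ ++ (l₂ ++ (l₃ ++ l₄))) = v) *
        ind ((newCount (pos (l₁ ++ (l₂ ++ (l₃ ++ l₄)))) (N₁ + N₂) (N₁ + N₂ + n₃ + 1) : ℝ) < g)
      ≤ (ind (disp l₁ = v - disp (l₂ ++ (l₃ ++ l₄))) * ind ((rangeCard l₃ : ℝ) < 2 * g)
        + ind (disp l₁ = v - disp (l₂ ++ (l₃ ++ l₄))) * bad (path 0 l₃).toFinset 0 (rev l₂))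
        + ind (disp l₂ = v - disp l₁ - disp l₃ - disp l₄)
            * bad (path (v - disp l₄ - disp l₃) l₃).toFinset 0 l₁ := by
    intro l₁ l₂ l₃ l₄ e₁ e₂ e₃
    by_cases hv : disp (l₁ ++ (l₂ ++ (l₃ ++ l₄))) = v
    swap
    · rw [ind_not hv, zero_mul]
      exact add_nonneg (add_nonneg (mul_nonneg (ind_nonneg _) (ind_nonneg _))
        (mul_nonneg (ind_nonneg _) (hbad0 _ _ _))) (mul_nonneg (ind_nonneg _) (hbad0 _ _ _))
    have hv1 : disp l₁ = v - disp (l₂ ++ (l₃ ++ l₄)) := by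
      rw [← hv, disp_append]; abel
    have hv2 : disp l₂ = v - disp l₁ - disp l₃ - disp l₄ := by
      rw [← hv]; simp only [disp_append]; abel
    have hv3 : v - disp l₄ - disp l₃ = disp l₁ + disp l₂ := by rw [hv2]; abel
    rw [ind_of hv, ind_of hv1, ind_of hv2, one_mul, one_mul, one_mul, one_mul, hv3]
    have hdet := card_le_newCount_add_hits l₁ l₂ l₃ l₄
    rw [e₁, e₂, e₃] at hdet
    have hr : hits (path (disp l₁ + disp l₂) l₃).toFinset (disp l₁) l₂
        = hits (path 0 l₃).toFinset 0 (rev l₂) := by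
      rw [hits_rev, hits_path_add]
    rw [hr] at hdet
    have hc := card_toFinset_path (disp l₁ + disp l₂) l₃
    have hc0 : (path 0 l₃).toFinset.card = rangeCard l₃ := rfl
    simp only [bad, hc0]
    rw [hc] at hdet ⊢
    refine (ind_mono (q := ((rangeCard l₃ : ℝ) < 2 * g ∨ _) ∨ _) fun h => ?_).trans
      ((ind_or_le _ _).trans (add_le_add_left (ind_or_le _ _) _))
    have hdet' : (rangeCard l₃ : ℝ) ≤ _ := Nat.cast_le.2 hdet
    push_cast at hdet'
    by_contra hcon
    push Not at hcon
    have := hcon.1.2 hcon.1.1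
    have := hcon.2 hcon.1.1
    have := hcon.1.1
    linarith
  simp only [avg_append]
  refine (avg_mono fun l₁ e₁ => avg_mono fun l₂ e₂ => avg_mono fun l₃ e₃ => avg_mono fun l₄ _ =>
    hpt l₁ l₂ l₃ l₄ e₁ e₂ e₃).trans ?_
  simp only [avg_add]
  refine add_le_add (add_le_add ?_ ?_) ?_
  · have := avg_ind_disp_mul_le N₁ h₁ (fun l => v - disp l) (N₂ + (n₃ + n₄))
      (fun l => ind ((rangeCard ((l.drop N₂).take n₃) : ℝ) < 2 * g)) fun _ => ind_nonneg _
    simp only [avg_append] at this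
    have e : ∀ l₂ l₃ l₄ : List (Fin 4), l₂.length = N₂ → l₃.length = n₃ →
        ((l₂ ++ (l₃ ++ l₄)).drop N₂).take n₃ = l₃ := by
      intro l₂ l₃ l₄ e₂ e₃
      subst e₂ e₃
      simp
    refine le_trans (le_of_eq ?_) (this.trans ?_)
    · refine avg_congr fun l₁ _ => avg_congr fun l₂ e₂ => avg_congr fun l₃ e₃ =>
        avg_congr fun l₄ _ => ?_
      rw [e l₂ l₃ l₄ e₂ e₃]
    · gcongr
      refine avg_le_const fun l₂ e₂ => le_trans (le_of_eq ?_) hα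
      refine avg_congr fun l₃ e₃ => ?_
      rw [← avg_const n₄ (ind ((rangeCard l₃ : ℝ) < 2 * g))]
      refine avg_congr fun l₄ _ => ?_
      rw [e l₂ l₃ l₄ e₂ e₃]
  · have := avg_ind_disp_mul_le N₁ h₁ (fun l => v - disp l) (N₂ + (n₃ + n₄))
      (fun l => bad (path 0 ((l.drop N₂).take n₃)).toFinset 0 (rev (l.take N₂)))
      fun _ => hbad0 _ _ _
    simp only [avg_append] at this
    have e : ∀ l₂ l₃ l₄ : List (Fin 4), l₂.length = N₂ → l₃.length = n₃ →
        ((l₂ ++ (l₃ ++ l₄)).drop N₂).take n₃ = l₃ ∧ (l₂ ++ (l₃ ++ l₄)).take N₂ = l₂ := by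
      intro l₂ l₃ l₄ e₂ e₃
      subst e₂ e₃
      simp
    refine le_trans (le_of_eq ?_) (this.trans ?_)
    · refine avg_congr fun l₁ _ => avg_congr fun l₂ e₂ => avg_congr fun l₃ e₃ =>
        avg_congr fun l₄ _ => ?_
      rw [(e l₂ l₃ l₄ e₂ e₃).1, (e l₂ l₃ l₄ e₂ e₃).2]
    · gcongr
      have h3 : avg N₂ (fun l₂ => avg n₃ (fun l₃ => bad (path 0 l₃).toFinset 0 (rev l₂))) ≤ γ := by
        rw [avg_comm]
        refine avg_le_const fun l₃ _ => ?_
        rw [avg_rev N₂ (bad (path 0 l₃).toFinset 0)]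
        exact hbad N₂ hγ₂ _ _
      refine le_trans (le_of_eq ?_) h3
      refine avg_congr fun l₂ e₂ => avg_congr fun l₃ e₃ => ?_
      rw [← avg_const n₄ (bad (path 0 l₃).toFinset 0 (rev l₂))]
      refine avg_congr fun l₄ _ => ?_
      rw [(e l₂ l₃ l₄ e₂ e₃).1, (e l₂ l₃ l₄ e₂ e₃).2]
  · have key : ∀ l₃ l₄ : List (Fin 4), avg N₁ (fun l₁ => avg N₂ (fun l₂ =>
        ind (disp l₂ = v - disp l₁ - disp l₃ - disp l₄)
            * bad (path (v - disp l₄ - disp l₃) l₃).toFinset 0 l₁)) ≤ 1 / N₂ * γ := by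
      intro l₃ l₄
      rw [avg_comm]
      refine (avg_ind_disp_mul_le N₂ h₂ (fun l₁ => v - disp l₁ - disp l₃ - disp l₄) N₁ _
        fun _ => hbad0 _ _ _).trans ?_
      gcongr
      exact hbad N₁ hγ₁ _ _
    have sw : ∀ F : List (Fin 4) → List (Fin 4) → List (Fin 4) → List (Fin 4) → ℝ,
        avg N₁ (fun l₁ => avg N₂ (fun l₂ => avg n₃ (fun l₃ => avg n₄ (fun l₄ => F l₁ l₂ l₃ l₄))))
        = avg n₃ (fun l₃ => avg n₄ (fun l₄ =>
            avg N₁ (fun l₁ => avg N₂ (fun l₂ => F l₁ l₂ l₃ l₄)))) := by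
      intro F
      calc _ = avg N₁ (fun l₁ => avg n₃ (fun l₃ => avg n₄ (fun l₄ =>
            avg N₂ (fun l₂ => F l₁ l₂ l₃ l₄)))) := by
            refine avg_congr fun l₁ _ => ?_
            rw [avg_comm]
            exact avg_congr fun l₃ _ => avg_comm _ _ _
        _ = _ := by
            rw [avg_comm]
            exact avg_congr fun l₃ _ => avg_comm _ _ _
    rw [sw]
    exact avg_le_const fun l₃ _ => avg_le_const fun l₄ _ => key l₃ l₄

/-- The last two coordinates of a site. -/
def zw (p : Fin 4 → ℤ) : ℤ × ℤ := (p 2, p 3)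

/-- The step `vec s` in the first two coordinates. -/
def nb (s : Fin 4) : Fin 4 → ℤ := ![(vec s).1, (vec s).2, 0, 0]

/-- The site `p` with its last two coordinates replaced by `z`. -/
def exitPos (p : Fin 4 → ℤ) (z : ℤ × ℤ) : Fin 4 → ℤ := ![p 0, p 1, z.1, z.2]

@[simp] lemma zw_add_nb (p : Fin 4 → ℤ) (s : Fin 4) : zw (p + nb s) = zw p := by
  simp [zw, nb]

@[simp] lemma zw_exitPos (p : Fin 4 → ℤ) (z : ℤ × ℤ) : zw (exitPos p z) = z := by
  simp [zw, exitPos]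

lemma add_nb_zero (p : Fin 4 → ℤ) (s : Fin 4) : (p + nb s) 0 = p 0 + (vec s).1 := by
  simp [nb]

lemma add_nb_zero_of_old (p : Fin 4 → ℤ) : (p + nb 2) 0 = p 0 ∧ (p + nb 3) 0 = p 0 := by
  simp [nb, vec]

lemma exitPos_zero (p : Fin 4 → ℤ) (z : ℤ × ℤ) : exitPos p z 0 = p 0 := by
  simp [exitPos]

lemma add_nb_add_nb_opp (p : Fin 4 → ℤ) (s : Fin 4) : p + nb s + nb (opp s) = p := by
  ext i
  have := vec_opp s
  fin_cases i <;> simp [nb, this] <;> rfl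

open Classical in
/-- The probability that, within `T` further steps and given that the last two coordinates follow
`u`, the walk standing at `p` after `k` moves of those coordinates, with set `A` of past sites,
makes their `n`-th move at first coordinate `x`. -/
noncomputable def hitProb (u : ℕ → ℤ × ℤ) (n : ℕ) (x : ℤ) :
    ℕ → Set (Fin 4 → ℤ) → (Fin 4 → ℤ) → ℕ → ℝ
  | 0, _, p, k => if k = n then ind (p 0 = x) else 0
  | T + 1, A, p, k => if k = n then ind (p 0 = x) else
      if p ∈ A then
        (hitProb u n x T (insert p A) (p + nb 2) k + hitProb u n x T (insert p A) (p + nb 3) k) / 6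
          + 2 / 3 * hitProb u n x T (insert p A) (exitPos p (u (k + 1))) (k + 1)
      else (∑ s : Fin 4, hitProb u n x T (insert p A) (p + nb s) k) / 4

section

variable {u : ℕ → ℤ × ℤ} {n : ℕ} {x : ℤ}

lemma hitProb_end (T : ℕ) (A : Set (Fin 4 → ℤ)) (p : Fin 4 → ℤ) :
    hitProb u n x T A p n = ind (p 0 = x) := by
  cases T <;> simp [hitProb]

lemma hitProb_zero (A : Set (Fin 4 → ℤ)) (p : Fin 4 → ℤ) {k : ℕ} (hk : k ≠ n) :
    hitProb u n x 0 A p k = 0 := by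
  simp [hitProb, hk]

lemma hitProb_old (T : ℕ) {A : Set (Fin 4 → ℤ)} {p : Fin 4 → ℤ} {k : ℕ} (hk : k ≠ n)
    (hp : p ∈ A) : hitProb u n x (T + 1) A p k
      = (hitProb u n x T A (p + nb 2) k + hitProb u n x T A (p + nb 3) k) / 6
          + 2 / 3 * hitProb u n x T A (exitPos p (u (k + 1))) (k + 1) := by
  rw [hitProb, if_neg hk, if_pos hp, Set.insert_eq_of_mem hp]

lemma hitProb_new (T : ℕ) {A : Set (Fin 4 → ℤ)} {p : Fin 4 → ℤ} {k : ℕ} (hk : k ≠ n)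
    (hp : p ∉ A) : hitProb u n x (T + 1) A p k
      = (∑ s : Fin 4, hitProb u n x T (insert p A) (p + nb s) k) / 4 := by
  rw [hitProb, if_neg hk, if_neg hp]

lemma hitProb_nonneg (T : ℕ) (A : Set (Fin 4 → ℤ)) (p : Fin 4 → ℤ) (k : ℕ) :
    0 ≤ hitProb u n x T A p k := by
  induction T generalizing A p k with
  | zero =>
    rw [hitProb]
    split_ifs
    · exact ind_nonneg _
    · exact le_rfl
  | succ T ih =>
    rw [hitProb]
    split_ifs
    · exact ind_nonneg _
    · have h1 := ih (insert p A) (p + nb 2) k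
      have h2 := ih (insert p A) (p + nb 3) k
      have h3 := ih (insert p A) (exitPos p (u (k + 1))) (k + 1)
      positivity
    · have : 0 ≤ ∑ s : Fin 4, hitProb u n x T (insert p A) (p + nb s) k :=
        Finset.sum_nonneg fun _ _ => ih _ _ _
      positivity

open Classical in
/-- The loss coefficient of a state in the exponential moment bound. -/
noncomputable def coef (A : Set (Fin 4 → ℤ)) (p : Fin 4 → ℤ) : ℝ :=
  if p ∈ A then 4 else if ∃ s, p + nb s ∈ A then 10 else 12

lemma coef_le (A : Set (Fin 4 → ℤ)) (p : Fin 4 → ℤ) : coef A p ≤ 12 := by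
  unfold coef; split_ifs <;> norm_num

lemma coef_old {A : Set (Fin 4 → ℤ)} {p : Fin 4 → ℤ} (h : p ∈ A) : coef A p = 4 := by
  simp [coef, h]

lemma coef_next_le {A : Set (Fin 4 → ℤ)} {p : Fin 4 → ℤ} (h : p ∈ A) (s : Fin 4) :
    coef A (p + nb s) ≤ 10 := by
  unfold coef
  split_ifs with h1 h2
  · norm_num
  · norm_num
  · exact absurd ⟨opp s, by rwa [add_nb_add_nb_opp]⟩ h2

lemma sum_exp_vec_le {θ : ℝ} (hθ : |θ| ≤ 1 / 4) :
    ∑ s : Fin 4, Real.exp (θ * (vec s).1) ≤ 4 + 2 * θ ^ 2 := by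
  have h := Real.cosh_le_exp_half_sq θ
  have hsq : θ ^ 2 ≤ 1 / 16 := by
    rw [← sq_abs]; nlinarith [abs_nonneg θ]
  have h2 := Real.exp_bound' (x := θ ^ 2 / 2) (by positivity) (by linarith) (n := 1) (by norm_num)
  have h3 : Real.exp (θ ^ 2 / 2) ≤ 1 + θ ^ 2 := by
    simp at h2
    nlinarith
  rw [Real.cosh_eq] at h
  simp [Fin.sum_univ_four, vec]
  linarith

lemma hitProb_le_coef_mul {θ : ℝ} (hθ : |θ| ≤ 1 / 4) (T : ℕ) (A : Set (Fin 4 → ℤ))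
    (p : Fin 4 → ℤ) (k : ℕ) (hk : k < n) :
    hitProb u n x T A p k ≤ (1 + coef A p * θ ^ 2) * (1 + 12 * θ ^ 2) ^ (n - (k + 1))
      * Real.exp (θ * (p 0 - x)) := by
  have hsq : θ ^ 2 ≤ 1 / 16 := by
    rw [← sq_abs]; nlinarith [abs_nonneg θ]
  have hc : ∀ A p, 0 ≤ coef A p := by
    intro A p; unfold coef; split_ifs <;> norm_num
  induction T generalizing A p k with
  | zero =>
    rw [hitProb_zero _ _ hk.ne]
    have := hc A p
    positivity
  | succ T ih =>
    set E := Real.exp (θ * (p 0 - x)) with hE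
    have hEpos : 0 < E := Real.exp_pos _
    have hC : 0 < (1 + 12 * θ ^ 2) ^ (n - (k + 1)) := by positivity
    by_cases hp : p ∈ A
    · rw [hitProb_old T hk.ne hp, coef_old hp]
      have h1 : ∀ s, (p + nb s) 0 = p 0 → hitProb u n x T A (p + nb s) k
          ≤ (1 + 10 * θ ^ 2) * (1 + 12 * θ ^ 2) ^ (n - (k + 1)) * E := by
        intro s hs
        have := ih A (p + nb s) k hk
        rw [hs] at this
        refine this.trans ?_
        gcongr
        exact coef_next_le hp s
      have h2 : hitProb u n x T A (exitPos p (u (k + 1))) (k + 1)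
          ≤ (1 + 12 * θ ^ 2) ^ (n - (k + 1)) * E := by
        rcases (Nat.succ_le_iff.2 hk).lt_or_eq with hlt | heq
        · have := ih A (exitPos p (u (k + 1))) (k + 1) hlt
          rw [exitPos_zero] at this
          refine this.trans ?_
          rw [show n - (k + 1) = n - (k + 1 + 1) + 1 by omega,
            pow_succ' (1 + 12 * θ ^ 2)]
          gcongr
          exact coef_le _ _
        · rw [show k + 1 = n from heq, hitProb_end, exitPos_zero]
          simp only [Nat.sub_self, pow_zero, one_mul]
          by_cases hx : p 0 = x
          · rw [ind_of hx, hE, hx]; simp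
          · rw [ind_not hx]; positivity
      have h3 := h1 2 (add_nb_zero_of_old p).1
      have h4 := h1 3 (add_nb_zero_of_old p).2
      have h5 : 0 ≤ θ ^ 2 * ((1 + 12 * θ ^ 2) ^ (n - (k + 1)) * E) := by positivity
      nlinarith
    · rw [hitProb_new T hk.ne hp]
      have h1 : ∀ s, hitProb u n x T (insert p A) (p + nb s) k
          ≤ (1 + coef (insert p A) (p + nb s) * θ ^ 2) * Real.exp (θ * (vec s).1)
            * ((1 + 12 * θ ^ 2) ^ (n - (k + 1)) * E) := by
        intro s
        refine (ih (insert p A) (p + nb s) k hk).trans (le_of_eq ?_)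
        rw [add_nb_zero, hE]
        push_cast
        rw [show θ * ((p 0 : ℝ) + (vec s).1 - x) = θ * (vec s).1 + θ * (p 0 - x) by ring,
          Real.exp_add]
        ring
      have hsum : ∑ s : Fin 4, (1 + coef (insert p A) (p + nb s) * θ ^ 2)
          * Real.exp (θ * (vec s).1) ≤ 4 * (1 + coef A p * θ ^ 2) := by
        classical
        have hexp := sum_exp_vec_le hθ
        have hs0 : ∑ s : Fin 4, (1 + coef (insert p A) (p + nb s) * θ ^ 2)
            * Real.exp (θ * (vec s).1) ≤ ∑ s : Fin 4, (1 + 10 * θ ^ 2)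
            * Real.exp (θ * (vec s).1) - ∑ s : Fin 4,
              (if p + nb s ∈ A then 6 * θ ^ 2 * Real.exp (θ * (vec s).1) else 0) := by
          rw [← Finset.sum_sub_distrib]
          refine Finset.sum_le_sum fun s _ => ?_
          split_ifs with hs
          · rw [coef_old (Set.mem_insert_of_mem _ hs)]
            nlinarith
          · rw [sub_zero]
            gcongr
            exact coef_next_le (Set.mem_insert _ _) s
        rw [← Finset.mul_sum] at hs0
        by_cases hs : ∃ s, p + nb s ∈ A
        · have hco : coef A p = 10 := by simp [coef, hp, hs]
          obtain ⟨s, hs⟩ := hs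
          have h2 : 6 * θ ^ 2 * (3 / 4) ≤ ∑ s : Fin 4,
              (if p + nb s ∈ A then 6 * θ ^ 2 * Real.exp (θ * (vec s).1) else 0) := by
            refine le_trans ?_ (Finset.single_le_sum (f := fun s =>
              (if p + nb s ∈ A then 6 * θ ^ 2 * Real.exp (θ * (vec s).1) else 0))
              (fun s _ => by split_ifs <;> positivity) (Finset.mem_univ s))
            simp only [if_pos hs]
            have h3 : |θ * (vec s).1| ≤ 1 / 4 := by
              rw [abs_mul]
              have : |((vec s).1 : ℝ)| ≤ 1 := by fin_cases s <;> simp [vec]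
              nlinarith [abs_nonneg θ]
            have h4 := Real.add_one_le_exp (θ * (vec s).1)
            have h5 := (abs_le.1 h3).1
            gcongr
            linarith
          rw [hco]
          nlinarith [sq_nonneg θ]
        · have hco : coef A p = 12 := by simp [coef, hp, hs]
          have h2 : 0 ≤ ∑ s : Fin 4,
              (if p + nb s ∈ A then 6 * θ ^ 2 * Real.exp (θ * (vec s).1) else 0) :=
            Finset.sum_nonneg fun s _ => by split_ifs <;> positivity
          rw [hco]
          nlinarith [sq_nonneg θ]
      have h2 := Finset.sum_le_sum fun s (_ : s ∈ Finset.univ) => h1 s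
      rw [← Finset.sum_mul] at h2
      have h3 : 0 < (1 + 12 * θ ^ 2) ^ (n - (k + 1)) * E := by positivity
      have h4 := mul_le_mul_of_nonneg_right hsum h3.le
      linarith

lemma hitProb_le_exp {θ : ℝ} (hθ : |θ| ≤ 1 / 4) (T : ℕ) (A : Set (Fin 4 → ℤ))
    (p : Fin 4 → ℤ) (k : ℕ) (hk : k ≤ n) :
    hitProb u n x T A p k ≤ Real.exp (12 * θ ^ 2 * (n - k : ℕ) + θ * (p 0 - x)) := by
  rcases hk.lt_or_eq with h | rfl
  · refine (hitProb_le_coef_mul hθ T A p k h).trans ?_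
    rw [Real.exp_add]
    gcongr
    have h1 : 1 + 12 * θ ^ 2 ≤ Real.exp (12 * θ ^ 2) := by
      linarith [Real.add_one_le_exp (12 * θ ^ 2)]
    rw [mul_comm (12 * θ ^ 2), Real.exp_nat_mul, show n - k = n - (k + 1) + 1 by omega,
      pow_succ' (Real.exp _)]
    gcongr
    refine le_trans ?_ h1
    gcongr
    exact coef_le _ _
  · rw [hitProb_end]
    by_cases hx : p 0 = x
    · rw [ind_of hx, hx]; simp
    · rw [ind_not hx]; positivity

lemma hitProb_le_one (T : ℕ) (A : Set (Fin 4 → ℤ)) (p : Fin 4 → ℤ) (k : ℕ) (hk : k ≤ n) :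
    hitProb u n x T A p k ≤ 1 := by
  have := hitProb_le_exp (u := u) (n := n) (x := x) (θ := 0) (by norm_num) T A p k hk
  simpa using this

/-- Far from the target, the target is unlikely to be hit. -/
lemma hitProb_le_of_far {R q : ℝ} (hR : 0 < R) (hq : 0 ≤ q) (hqR : q ≤ 6 * R) (T : ℕ)
    (A : Set (Fin 4 → ℤ)) (p : Fin 4 → ℤ) (k : ℕ) (hk : k ≤ n) (hn : ((n - k : ℕ) : ℝ) ≤ R ^ 2)
    (hfar : q * R ≤ |(p 0 : ℝ) - x|) :
    hitProb u n x T A p k ≤ Real.exp (-(q ^ 2 / 48)) := by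
  have hθ0 : q / (24 * R) ≤ 1 / 4 := by
    rw [div_le_iff₀ (by positivity)]; linarith
  have hθ1 : 0 ≤ q / (24 * R) := by positivity
  have key : ∀ θ : ℝ, |θ| = q / (24 * R) → θ * (p 0 - x) = -(|θ| * |(p 0 : ℝ) - x|) →
      hitProb u n x T A p k ≤ Real.exp (-(q ^ 2 / 48)) := by
    intro θ h1 h2
    refine (hitProb_le_exp (θ := θ) (by rw [h1]; exact hθ0) T A p k hk).trans ?_
    rw [h2, ← sq_abs, h1]
    gcongr
    have h3 : 12 * (q / (24 * R)) ^ 2 * (n - k : ℕ) ≤ 12 * (q / (24 * R)) ^ 2 * R ^ 2 := by gcongr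
    have h4 : q / (24 * R) * (q * R) ≤ q / (24 * R) * |(p 0 : ℝ) - x| := by gcongr
    have h5 : 12 * (q / (24 * R)) ^ 2 * R ^ 2 = q ^ 2 / 48 := by field_simp; ring
    have h6 : q / (24 * R) * (q * R) = q ^ 2 / 24 := by field_simp
    linarith
  rcases le_total 0 ((p 0 : ℝ) - x) with h | h
  · refine key (-(q / (24 * R))) (by rw [abs_neg, abs_of_nonneg hθ1]) ?_
    rw [abs_neg, abs_of_nonneg hθ1, abs_of_nonneg h]; ring
  · refine key (q / (24 * R)) (abs_of_nonneg hθ1) ?_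
    rw [abs_of_nonneg hθ1, abs_of_nonpos h]; ring

end

/-- A substitute for the expected modulus at time `s` of a random walk started at `y`, with `a²`
an upper bound for `s`. -/
noncomputable def expAbs (a y s : ℝ) : ℝ :=
  if |y| ≤ a then max |y| ((y ^ 2 + s / 2) / (2 * a)) else |y|

lemma abs_le_expAbs (a y s : ℝ) : |y| ≤ expAbs a y s := by
  unfold expAbs; split_ifs
  · exact le_max_left _ _
  · exact le_rfl

lemma expAbs_zero {a : ℝ} (ha : 0 < a) (y : ℝ) : expAbs a y 0 = |y| := by
  unfold expAbs
  split_ifs with h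
  · apply max_eq_left
    rw [div_le_iff₀ (by positivity), zero_div, add_zero, ← sq_abs]
    nlinarith [abs_nonneg y]
  · rfl

lemma expAbs_sq_ge {a : ℝ} (ha : 0 < a) (y : ℝ) : max |y| (a / 4) ≤ expAbs a y (a ^ 2) := by
  refine max_le (abs_le_expAbs _ _ _) ?_
  unfold expAbs
  split_ifs with h
  · refine le_trans ?_ (le_max_right _ _)
    rw [le_div_iff₀ (by positivity)]
    nlinarith [sq_nonneg y]
  · linarith

lemma expAbs_le_max {a : ℝ} (ha : 0 < a) (y : ℝ) {s : ℝ} (hs : s ≤ a ^ 2) :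
    expAbs a y s ≤ max |y| a := by
  unfold expAbs
  split_ifs with h
  · refine max_le_max le_rfl ?_
    rw [div_le_iff₀ (by positivity)]
    have : y ^ 2 ≤ a ^ 2 := by rw [← sq_abs]; gcongr
    nlinarith
  · exact le_max_left _ _

lemma sq_div_le_expAbs {a : ℝ} (ha : 0 < a) (ha2 : 2 ≤ a ^ 2) {y s : ℝ} (hs : s ≤ a ^ 2)
    (hy : |y| ≤ a + 1) : (y ^ 2 + s / 2) / (2 * a) ≤ expAbs a y s := by
  unfold expAbs
  split_ifs with h
  · exact le_max_right _ _
  · rw [div_le_iff₀ (by positivity), ← sq_abs]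
    nlinarith [abs_nonneg y]

lemma expAbs_le_average {a : ℝ} (ha : 0 < a) (ha2 : 2 ≤ a ^ 2) {y s s' : ℝ} (hs : s ≤ a ^ 2)
    (hs' : s' ≤ s + 1) :
    expAbs a y s' ≤ (expAbs a (y + 1) s + expAbs a (y - 1) s + 2 * expAbs a y s) / 4 := by
  have h1 := abs_le_expAbs a (y + 1) s
  have h2 := abs_le_expAbs a (y - 1) s
  have h3 := abs_le_expAbs a y s
  have habs : |y| ≤ (expAbs a (y + 1) s + expAbs a (y - 1) s + 2 * expAbs a y s) / 4 := by
    have := abs_add_le (y + 1) (y - 1)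
    rw [show y + 1 + (y - 1) = 2 * y by ring, abs_mul, abs_two] at this
    linarith
  rw [expAbs]
  split_ifs with h
  · refine max_le habs ?_
    have hy1 : |y + 1| ≤ a + 1 := (abs_add_le _ _).trans (by simpa using h)
    have hy2 : |y - 1| ≤ a + 1 := (abs_sub _ _).trans (by simpa using h)
    have h4 := sq_div_le_expAbs ha ha2 hs hy1
    have h5 := sq_div_le_expAbs ha ha2 hs hy2
    have h6 := sq_div_le_expAbs ha ha2 (y := y) hs (by linarith)
    have h7 : (y ^ 2 + s' / 2) / (2 * a) ≤ (((y + 1) ^ 2 + s / 2) / (2 * a)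
        + ((y - 1) ^ 2 + s / 2) / (2 * a) + 2 * ((y ^ 2 + s / 2) / (2 * a))) / 4 := by
      rw [← sub_nonneg]
      have : (((y + 1) ^ 2 + s / 2) / (2 * a)
        + ((y - 1) ^ 2 + s / 2) / (2 * a) + 2 * ((y ^ 2 + s / 2) / (2 * a))) / 4
          - (y ^ 2 + s' / 2) / (2 * a) = (s + 1 - s') / (4 * a) := by
        field_simp; ring
      rw [this]
      exact div_nonneg (by linarith) (by positivity)
    linarith
  · exact habs

/-- The states from which the walk with `k` moves of the last coordinates behind it, whose last
coordinates follow `u`, may continue. -/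
def Compat (u : ℕ → ℤ × ℤ) (k : ℕ) (A : Set (Fin 4 → ℤ)) (p : Fin 4 → ℤ) : Prop :=
  zw p = u k ∧ ∀ y ∈ A, ∃ j ≤ k, zw y = u j

/-- The states of the walk just after the `k`-th move of its last coordinates. -/
def Arrival (u : ℕ → ℤ × ℤ) (k : ℕ) (A : Set (Fin 4 → ℤ)) (p : Fin 4 → ℤ) : Prop :=
  zw p = u k ∧ ∀ y ∈ A, ∃ j < k, zw y = u j

section

variable {u : ℕ → ℤ × ℤ} {n : ℕ} {x : ℤ} {k : ℕ} {A : Set (Fin 4 → ℤ)} {p : Fin 4 → ℤ}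

lemma Arrival.compat (h : Arrival u k A p) : Compat u k A p :=
  ⟨h.1, fun y hy => let ⟨j, hj, e⟩ := h.2 y hy; ⟨j, hj.le, e⟩⟩

lemma Compat.move (h : Compat u k A p) (s : Fin 4) : Compat u k (insert p A) (p + nb s) := by
  refine ⟨by rw [zw_add_nb, h.1], fun y hy => ?_⟩
  rcases Set.mem_insert_iff.1 hy with rfl | hy
  · exact ⟨k, le_rfl, h.1⟩
  · exact h.2 y hy

lemma Compat.move_old (h : Compat u k A p) (s : Fin 4) : Compat u k A (p + nb s) :=
  ⟨by rw [zw_add_nb, h.1], h.2⟩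

lemma Compat.exit (h : Compat u k A p) : Arrival u (k + 1) A (exitPos p (u (k + 1))) :=
  ⟨zw_exitPos _ _, fun y hy => let ⟨j, hj, e⟩ := h.2 y hy; ⟨j, by omega, e⟩⟩

open Classical in
/-- The number of new sites of `u` ahead of a state and before level `t`. -/
noncomputable def ahead (u : ℕ → ℤ × ℤ) (t k : ℕ) (A : Set (Fin 4 → ℤ)) : ℕ :=
  newCount u (k + 1) t + if (∀ j < k, u j ≠ u k) ∧ ∀ y ∈ A, zw y ≠ u k then 1 else 0

lemma ahead_of_mem (t : ℕ) {y : Fin 4 → ℤ} (hy : y ∈ A) (hz : zw y = u k) :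
    ahead u t k A = newCount u (k + 1) t := by
  rw [ahead, if_neg fun h => h.2 y hy hz, add_zero]

lemma ahead_le (t k : ℕ) (A : Set (Fin 4 → ℤ)) : ahead u t k A ≤ newCount u (k + 1) t + 1 := by
  unfold ahead; split_ifs <;> omega

lemma ahead_of_arrival {t : ℕ} (ht : k < t) (h : Arrival u k A p) :
    ahead u t k A = newCount u k t := by
  have hiff : ((∀ j < k, u j ≠ u k) ∧ ∀ y ∈ A, zw y ≠ u k) ↔ ∀ j < k, u j ≠ u k := by
    refine ⟨fun h => h.1, fun h' => ⟨h', fun y hy e => ?_⟩⟩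
    obtain ⟨j, hj, e'⟩ := h.2 y hy
    exact h' j hj (e'.symm.trans e)
  simp only [ahead, hiff, newCount]
  rw [← Finset.insert_Ico_add_one_left_eq_Ico ht, Finset.filter_insert]
  split_ifs with hnew
  · rw [Finset.card_insert_of_notMem (by simp)]
  · rw [add_zero]

/-- The gain over one scale: at level `t` the hitting probability is controlled by the number of
new sites of `u` between the levels `t` and `t'`. -/
lemma hitProb_scale {t t' : ℕ} (htt : t < t') (htn : t' ≤ n) {ε ρ D b a : ℝ} (hε : 0 ≤ ε)
    (hρ : 0 ≤ ρ) (ha2 : 2 ≤ a ^ 2) (ha : 0 < a) (haD : a ≤ D) (hbD : b + 1 ≤ D)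
    (hcount : a ^ 2 ≤ newCount u t t')
    (hfar : ∀ T A p k, t ≤ k → k ≤ t' → b ≤ |(p 0 : ℝ) - x| → hitProb u n x T A p k ≤ ε)
    (hend : ∀ T A p, Arrival u t' A p → |(p 0 : ℝ) - x| ≤ b →
      hitProb u n x T A p t' ≤ ε + ρ * (1 - |(p 0 : ℝ) - x| / D))
    (T : ℕ) (A : Set (Fin 4 → ℤ)) (p : Fin 4 → ℤ) (hA : Arrival u t A p)
    (hb : |(p 0 : ℝ) - x| ≤ b) :
    hitProb u n x T A p t ≤ ε + ρ * (1 - max |(p 0 : ℝ) - x| (a / 4) / D) := by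
  have hD : 0 < D := by linarith
  have hpos : ∀ {y s : ℝ}, |y| ≤ D → s ≤ a ^ 2 → 0 ≤ ρ * (1 - expAbs a y s / D) := by
    intro y s hy hs
    refine mul_nonneg hρ (sub_nonneg.2 ?_)
    rw [div_le_one hD]
    exact (expAbs_le_max ha y hs).trans (max_le hy haD)
  have main : ∀ (T : ℕ) (A : Set (Fin 4 → ℤ)) (p : Fin 4 → ℤ) (k : ℕ), t ≤ k → k < t' →
      Compat u k A p → |(p 0 : ℝ) - x| ≤ b → hitProb u n x T A p k
        ≤ ε + ρ * (1 - expAbs a (p 0 - x) (min (ahead u t' k A) (a ^ 2)) / D) := by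
    intro T
    induction T with
    | zero =>
      intro A p k h1 h2 hC hb
      rw [hitProb_zero _ _ (by omega)]
      have := hpos (y := p 0 - x) (by linarith) (min_le_right (ahead u t' k A : ℝ) (a ^ 2))
      linarith
    | succ T ih =>
      intro A p k h1 h2 hC hb
      by_cases hp : p ∈ A
      · rw [hitProb_old T (by omega) hp]
        have h3 := ih A (p + nb 2) k h1 h2 (hC.move_old 2) (by rwa [(add_nb_zero_of_old p).1])
        have h4 := ih A (p + nb 3) k h1 h2 (hC.move_old 3) (by rwa [(add_nb_zero_of_old p).2])
        rw [(add_nb_zero_of_old p).1] at h3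
        rw [(add_nb_zero_of_old p).2] at h4
        have h5 : hitProb u n x T A (exitPos p (u (k + 1))) (k + 1)
            ≤ ε + ρ * (1 - expAbs a (p 0 - x) (min (ahead u t' k A) (a ^ 2)) / D) := by
          rw [ahead_of_mem t' hp hC.1]
          rcases (Nat.succ_le_iff.2 h2).lt_or_eq with hlt | heq
          · have := ih A (exitPos p (u (k + 1))) (k + 1) (by omega) hlt hC.exit.compat
              (by rwa [exitPos_zero])
            rwa [exitPos_zero, ahead_of_arrival hlt hC.exit] at this
          · have h6 := hend T A (exitPos p (u (k + 1))) (by rw [← heq]; exact hC.exit)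
              (by rwa [exitPos_zero])
            rw [exitPos_zero, ← heq] at h6
            refine h6.trans (le_of_eq ?_)
            have : newCount u (k + 1) t' = 0 := by simp [newCount, ← heq]
            rw [this, Nat.cast_zero, min_eq_left (by positivity), expAbs_zero ha]
        linarith
      · rw [hitProb_new T (by omega) hp]
        set s := min (newCount u (k + 1) t' : ℝ) (a ^ 2) with hs
        have h3 : ∀ σ : Fin 4, hitProb u n x T (insert p A) (p + nb σ) k
            ≤ ε + ρ * (1 - expAbs a (p 0 - x + (vec σ).1) s / D) := by
          intro σ
          have hcast : (((p + nb σ) 0 : ℤ) : ℝ) - x = p 0 - x + (vec σ).1 := by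
            rw [add_nb_zero]; push_cast; ring
          by_cases hσ : |((p + nb σ) 0 : ℝ) - x| ≤ b
          · have := ih (insert p A) (p + nb σ) k h1 h2 (hC.move σ) hσ
            rwa [hcast, ahead_of_mem t' (Set.mem_insert p A) hC.1] at this
          · push Not at hσ
            have h4 := hfar T (insert p A) (p + nb σ) k h1 h2.le hσ.le
            have h5 : |(p 0 : ℝ) - x + (vec σ).1| ≤ D := by
              refine (abs_add_le _ _).trans ?_
              have : |((vec σ).1 : ℝ)| ≤ 1 := by fin_cases σ <;> simp [vec]
              linarith
            have := hpos h5 (min_le_right (newCount u (k + 1) t' : ℝ) (a ^ 2))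
            linarith
        have h4 := Finset.sum_le_sum fun σ (_ : σ ∈ Finset.univ) => h3 σ
        have h5 := expAbs_le_average ha ha2 (y := p 0 - x) (s := s)
          (s' := min (ahead u t' k A) (a ^ 2)) (min_le_right _ _) (by
            have : (ahead u t' k A : ℝ) ≤ newCount u (k + 1) t' + 1 := by
              exact_mod_cast ahead_le t' k A
            rw [hs, min_add_add_right .. |>.symm]
            exact min_le_min this (by linarith))
        have h6 : ∑ σ : Fin 4, (ε + ρ * (1 - expAbs a (p 0 - x + (vec σ).1) s / D))
            = 4 * (ε + ρ * (1 - (expAbs a (p 0 - x + 1) s + expAbs a (p 0 - x - 1) s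
              + 2 * expAbs a (p 0 - x) s) / 4 / D)) := by
          simp [Fin.sum_univ_four, vec, ← sub_eq_add_neg]
          ring
        rw [h6] at h4
        have h7 : ρ * (1 - (expAbs a (p 0 - x + 1) s + expAbs a (p 0 - x - 1) s
              + 2 * expAbs a (p 0 - x) s) / 4 / D)
            ≤ ρ * (1 - expAbs a (p 0 - x) (min (ahead u t' k A) (a ^ 2)) / D) := by gcongr
        linarith
  refine (main T A p t le_rfl htt hA.compat hb).trans ?_
  rw [ahead_of_arrival htt hA, min_eq_right hcount]
  gcongr
  exact expAbs_sq_ge ha _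

/-- A bound valid at all arrivals at level `t` is valid before level `t`. -/
lemma hitProb_le_of_arrival {t : ℕ} (htn : t ≤ n) {c : ℝ} (hc : 0 ≤ c)
    (hend : ∀ T A p, Arrival u t A p → hitProb u n x T A p t ≤ c)
    (T : ℕ) (A : Set (Fin 4 → ℤ)) (p : Fin 4 → ℤ) (k : ℕ) (hk : k < t) (hC : Compat u k A p) :
    hitProb u n x T A p k ≤ c := by
  induction T generalizing A p k with
  | zero => rwa [hitProb_zero _ _ (by omega)]
  | succ T ih =>
    by_cases hp : p ∈ A
    · rw [hitProb_old T (by omega) hp]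
      have h3 := ih A (p + nb 2) k hk (hC.move_old 2)
      have h4 := ih A (p + nb 3) k hk (hC.move_old 3)
      have h5 : hitProb u n x T A (exitPos p (u (k + 1))) (k + 1) ≤ c := by
        rcases (Nat.succ_le_iff.2 hk).lt_or_eq with hlt | heq
        · exact ih A _ (k + 1) hlt hC.exit.compat
        · have := hend T A (exitPos p (u (k + 1))) (by rw [← heq]; exact hC.exit)
          rwa [← heq] at this
      linarith
    · rw [hitProb_new T (by omega) hp]
      have h4 := Finset.sum_le_sum fun σ (_ : σ ∈ Finset.univ) =>
        ih (insert p A) (p + nb σ) k hk (hC.move σ)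
      simp only [Finset.sum_const, Finset.card_univ, Fintype.card_fin, nsmul_eq_mul] at h4
      push_cast at h4
      linarith

/-- The hitting probability when each of the scales `e₀ < e ≤ e₀ + I` contains a large number of
new sites of `u`. -/
lemma hitProb_le_of_counts {κ q : ℝ} (hq : 1 ≤ q) (hκ : 0 < κ) (hκ1 : κ ≤ 1) (e₀ I : ℕ)
    (hn : 4 ^ (e₀ + I) < n) (hκe : 2 ≤ κ ^ 2 * 4 ^ e₀) (hqe : q ≤ 6 * 2 ^ e₀)
    (hcount : ∀ e, e₀ ≤ e → e < e₀ + I →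
      κ ^ 2 * 4 ^ (e + 1) ≤ newCount u (n - 4 ^ (e + 1)) (n - 4 ^ e))
    (hu : u 0 = 0) (T : ℕ) :
    hitProb u n x T ∅ 0 0
      ≤ Real.exp (-(q ^ 2 / 48)) + 2 * (1 - κ / (16 * q)) ^ I := by
  set ε := Real.exp (-(q ^ 2 / 48)) with hε
  have hεpos : 0 < ε := Real.exp_pos _
  have hκq : κ / (16 * q) ≤ 1 / 16 := by
    rw [div_le_div_iff₀ (by positivity) (by norm_num)]; nlinarith
  have hκq0 : 0 < κ / (16 * q) := by positivity
  have h4le : ∀ e, e ≤ e₀ + I → (4 : ℕ) ^ e < n := fun e he =>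
    (Nat.pow_le_pow_right (by norm_num) he).trans_lt hn
  have h24 : ∀ e : ℕ, ((2 : ℝ) ^ e) ^ 2 = 4 ^ e := by
    intro e; rw [← pow_mul, mul_comm, pow_mul]; norm_num
  have hfar : ∀ e, e₀ ≤ e → e ≤ e₀ + I → ∀ T A p k, n - 4 ^ e ≤ k → k ≤ n →
      q * 2 ^ e ≤ |(p 0 : ℝ) - x| → hitProb u n x T A p k ≤ ε := by
    intro e he he' T A p k hk hkn hfar
    refine hitProb_le_of_far (R := 2 ^ e) (by positivity) (by linarith) ?_ T A p k hkn ?_ hfar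
    · refine hqe.trans ?_
      gcongr
      norm_num
    · rw [h24]
      have : n - k ≤ 4 ^ e := by omega
      exact_mod_cast this
  have hr0 : 0 ≤ 1 - κ / (16 * q) := by linarith
  have main : ∀ i, i ≤ I → ∀ T A p, Arrival u (n - 4 ^ (e₀ + i)) A p →
      |(p 0 : ℝ) - x| ≤ q * 2 ^ (e₀ + i + 1) → hitProb u n x T A p (n - 4 ^ (e₀ + i))
        ≤ ε + 2 * (1 - κ / (16 * q)) ^ i
          * (1 - |(p 0 : ℝ) - x| / (2 * (q * 2 ^ (e₀ + i + 1)))) := by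
    intro i
    induction i with
    | zero =>
      intro _ T A p _ hp
      have h1 := hitProb_le_one (u := u) (x := x) T A p (n - 4 ^ (e₀ + 0)) (Nat.sub_le _ _)
      have h2 : |(p 0 : ℝ) - x| / (2 * (q * 2 ^ (e₀ + 0 + 1))) ≤ 1 / 2 := by
        rw [div_le_div_iff₀ (by positivity) (by norm_num)]
        linarith
      rw [pow_zero]
      linarith
    | succ i ih =>
      intro hi T A p hA hp
      set b := q * 2 ^ (e₀ + i + 1) with hb
      have h2pos : (1 : ℝ) ≤ 2 ^ (e₀ + i + 1) := one_le_pow₀ (by norm_num)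
      have hb1 : 1 ≤ b := by nlinarith
      have hb2 : q * 2 ^ (e₀ + (i + 1) + 1) = 2 * b := by
        rw [hb, show e₀ + (i + 1) + 1 = e₀ + i + 1 + 1 by ring, pow_succ]; ring
      rw [hb2] at hp ⊢
      have hrpow : 0 ≤ 2 * (1 - κ / (16 * q)) ^ i := by positivity
      rcases le_or_gt |(p 0 : ℝ) - x| b with hyb | hyb
      · have hlt : 4 ^ (e₀ + i) < 4 ^ (e₀ + (i + 1)) :=
          Nat.pow_lt_pow_right (by norm_num) (by omega)
        have hlt' := h4le (e₀ + (i + 1)) (by omega)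
        have h4 := hitProb_scale (u := u) (x := x) (t := n - 4 ^ (e₀ + (i + 1)))
          (t' := n - 4 ^ (e₀ + i)) (n := n) (ε := ε) (ρ := 2 * (1 - κ / (16 * q)) ^ i)
          (D := 2 * b) (b := b) (a := κ * 2 ^ (e₀ + i + 1)) (by omega) (Nat.sub_le _ _) hεpos.le
          hrpow ?_ (by positivity) (by nlinarith) (by linarith) ?_ ?_ ?_ T A p hA hyb
        · refine h4.trans ?_
          have key : 1 - max |(p 0 : ℝ) - x| (κ * 2 ^ (e₀ + i + 1) / 4) / (2 * b)
              ≤ (1 - κ / (16 * q)) * (1 - |(p 0 : ℝ) - x| / (2 * (2 * b))) := by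
            have hm : κ * 2 ^ (e₀ + i + 1) / 4 = 2 * (κ / (16 * q)) * (2 * b) := by
              rw [hb]; field_simp; norm_num
            rw [← max_div_div_right (by positivity : (0 : ℝ) ≤ 2 * b), hm,
              mul_div_cancel_right₀ _ (by positivity : 2 * b ≠ 0)]
            have hY : |(p 0 : ℝ) - x| / (2 * (2 * b)) = |(p 0 : ℝ) - x| / (2 * b) / 2 := by
              field_simp
            rw [hY]
            have hY1 : |(p 0 : ℝ) - x| / (2 * b) ≤ 1 := by
              rw [div_le_one (by positivity)]; linarith
            rcases le_total (|(p 0 : ℝ) - x| / (2 * b)) (2 * (κ / (16 * q))) with h | h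
            · rw [max_eq_right h]; nlinarith
            · rw [max_eq_left h]; nlinarith
          have := mul_le_mul_of_nonneg_left key hrpow
          rw [pow_succ (1 - κ / (16 * q))]
          linarith
        · rw [mul_pow, h24]
          refine hκe.trans ?_
          gcongr
          · norm_num
          · omega
        · rw [mul_pow, h24]
          exact hcount (e₀ + i) (by omega) (by omega)
        · intro T A p k h5 h6 h7
          exact hfar (e₀ + (i + 1)) (by omega) (by omega) T A p k h5 (h6.trans (Nat.sub_le _ _)) h7
        · exact ih (by omega)
      · have h5 := hfar (e₀ + (i + 1)) (by omega) (by omega) T A p _ le_rfl (Nat.sub_le _ _) hyb.le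
        have h6 : |(p 0 : ℝ) - x| / (2 * (2 * b)) ≤ 1 := by
          rw [div_le_one (by positivity)]; linarith
        have h7 : 0 ≤ 2 * (1 - κ / (16 * q)) ^ (i + 1)
            * (1 - |(p 0 : ℝ) - x| / (2 * (2 * b))) :=
          mul_nonneg (by positivity) (by linarith)
        linarith
  have hrI : 0 ≤ 2 * (1 - κ / (16 * q)) ^ I := by positivity
  refine hitProb_le_of_arrival (t := n - 4 ^ (e₀ + I)) (Nat.sub_le _ _) (by linarith) ?_ T ∅ 0 0
    (by omega) ⟨by rw [hu]; rfl, by simp⟩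
  intro T A p hA
  rcases le_or_gt |(p 0 : ℝ) - x| (q * 2 ^ (e₀ + I + 1)) with hy | hy
  · refine (main I le_rfl T A p hA hy).trans ?_
    have : 0 ≤ |(p 0 : ℝ) - x| / (2 * (q * 2 ^ (e₀ + I + 1))) := by positivity
    nlinarith
  · refine (hfar (e₀ + I) (by omega) le_rfl T A p _ le_rfl (Nat.sub_le _ _) ?_).trans (by linarith)
    refine le_trans ?_ hy.le
    have : (2 : ℝ) ^ (e₀ + I) ≤ 2 ^ (e₀ + I + 1) := pow_le_pow_right₀ (by norm_num) (by omega)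
    gcongr

end

lemma green_zero_le (b : ℕ) : green b 0 ≤ 2 + Real.log b := by
  have h1 : green b 0 ≤ 1 + (harmonic b : ℝ) := by
    unfold green
    rw [Finset.sum_range_succ', trans_zero, if_pos rfl, add_comm]
    unfold harmonic
    push_cast
    gcongr with i
    have := trans_le (i + 1) (by omega) 0
    push_cast at this
    rwa [one_div] at this
  have h2 := harmonic_le_one_add_log b
  linarith

lemma avg_ind_hits_le_of_scale {q n e N : ℕ} (hq : 2 ^ 12 ≤ q) (hlog : (q : ℝ) ^ 16 ≤ Real.log n)
    (hN : N ≤ n) (hen : 4 ^ e ≤ n) (hne : n ≤ 4 ^ (e + q ^ 12 + 2))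
    (he : 2 ^ 50 * q ^ 42 ≤ 4 ^ e) (G : Finset (ℤ × ℤ)) (x : ℤ × ℤ)
    (hG : 2 * ((1 / (2 ^ 11 * (q : ℝ) ^ 9)) ^ 2 * 4 ^ (e + 1)) ≤ G.card) :
    avg N (fun l => ind ((G.card : ℝ) ≤ 4 * hits G x l)) ≤ 2 * Real.exp (-(q / 16)) := by
  have hq' : (2 : ℝ) ^ 12 ≤ q := by exact_mod_cast hq
  have hqpos : (0 : ℝ) < q := lt_of_lt_of_le (by norm_num) hq'
  have he' : (2 : ℝ) ^ 50 * q ^ 42 ≤ 4 ^ e := by exact_mod_cast he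
  have hen' : (4 : ℝ) ^ e ≤ n := by exact_mod_cast hen
  have hne' : (n : ℝ) ≤ 4 ^ (e + q ^ 12 + 2) := by exact_mod_cast hne
  have hq1 : (1 : ℝ) ≤ q := by linarith
  have h21 : q ^ 21 ≤ 4 ^ e := by
    refine le_trans ?_ he
    have : q ^ 21 ≤ q ^ 42 := Nat.pow_le_pow_right (by omega) (by norm_num)
    omega
  set a := 4 ^ e / q ^ 21 with ha
  have ha1 : 1 ≤ a := (Nat.one_le_div_iff (by positivity)).2 h21
  have ha1' : (1 : ℝ) ≤ a := by exact_mod_cast ha1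
  have haup : (a : ℝ) * q ^ 21 ≤ 4 ^ e := by exact_mod_cast Nat.div_mul_le_self (4 ^ e) (q ^ 21)
  have halow : (4 : ℝ) ^ e ≤ 2 * a * q ^ 21 := by
    have h1 : 4 ^ e < (a + 1) * q ^ 21 := by
      rw [mul_comm]; exact Nat.lt_mul_div_succ _ (by positivity)
    have h2 : (4 : ℝ) ^ e < (a + 1) * q ^ 21 := by exact_mod_cast h1
    have h3 : ((a : ℝ) + 1) * q ^ 21 ≤ (2 * a) * q ^ 21 := by gcongr; linarith
    linarith
  have hG' : (4 : ℝ) ^ e ≤ G.card * (2 ^ 19 * q ^ 18) := by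
    have : 2 * ((1 / (2 ^ 11 * (q : ℝ) ^ 9)) ^ 2 * 4 ^ (e + 1)) = 4 ^ e / (2 ^ 19 * q ^ 18) := by
      rw [pow_succ (4 : ℝ) e]; field_simp; norm_num
    rw [this, div_le_iff₀ (by positivity)] at hG
    exact hG
  have hGq : 2 * (2 : ℝ) * q ≤ G.card := by
    have h1 : (2 : ℝ) ^ 50 * q ^ 42 ≤ G.card * (2 ^ 19 * q ^ 18) := he'.trans hG'
    have h2 : (2 * 2 * (q : ℝ)) * (2 ^ 19 * q ^ 18) ≤ 2 ^ 50 * q ^ 42 := by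
      have : (q : ℝ) ^ 19 ≤ q ^ 42 := pow_le_pow_right₀ hq1 (by norm_num)
      have e1 : (2 * 2 * (q : ℝ)) * (2 ^ 19 * q ^ 18) = 2 ^ 21 * q ^ 19 := by ring
      rw [e1]
      have : (0 : ℝ) < q ^ 42 := by positivity
      linarith
    exact le_of_mul_le_mul_right (h2.trans h1) (by positivity)
  have hgreen : (q : ℝ) ^ 16 / 4 ≤ green (2 * n) 0 := by
    refine le_trans ?_ (green_zero_ge n)
    have hn0 : (0 : ℝ) < n := lt_of_lt_of_le (by positivity) hen'
    have : Real.log n ≤ Real.log (n + 1) := Real.log_le_log hn0 (by linarith)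
    linarith
  have hgpos : 0 < green (2 * n) 0 := lt_of_lt_of_le (by positivity) hgreen
  have hlogb : 1 + Real.log (((a : ℝ) + N + (2 * n : ℕ)) / a) ≤ 64 * q ^ 12 := by
    have han : (a : ℝ) ≤ n := by
      have : (1 : ℝ) ≤ q ^ 21 := one_le_pow₀ hq1
      have h1 : (a : ℝ) * 1 ≤ a * q ^ 21 := by gcongr
      linarith
    have hN' : (N : ℝ) ≤ n := by exact_mod_cast hN
    have h1 : ((a : ℝ) + N + (2 * n : ℕ)) / a ≤ 2 ^ 7 * q ^ 21 * 4 ^ (q ^ 12) := by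
      rw [div_le_iff₀ (by positivity)]
      push_cast
      have h2 : (4 : ℝ) ^ (e + q ^ 12 + 2) = 4 ^ e * (16 * 4 ^ (q ^ 12)) := by
        rw [pow_add, pow_add]; ring
      have h3 : (4 : ℝ) ^ e * (16 * 4 ^ (q ^ 12)) ≤ (2 * a * q ^ 21) * (16 * 4 ^ (q ^ 12)) := by
        gcongr
      rw [h2] at hne'
      linarith
    have h2 : Real.log (((a : ℝ) + N + (2 * n : ℕ)) / a)
        ≤ Real.log (2 ^ 7 * q ^ 21 * 4 ^ (q ^ 12)) := Real.log_le_log (by positivity) h1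
    rw [Real.log_mul (by positivity) (by positivity), Real.log_mul (by positivity) (by positivity),
      Real.log_pow, Real.log_pow, Real.log_pow] at h2
    have h3 : Real.log 2 ≤ 1 := by linarith [Real.log_two_lt_d9]
    have h4 : Real.log 4 ≤ 2 := by
      rw [show (4 : ℝ) = 2 ^ 2 by norm_num, Real.log_pow]; push_cast; linarith
    have h5 : Real.log q ≤ q := (Real.log_le_sub_one_of_pos hqpos).trans (by linarith)
    have h6 : (q : ℝ) ≤ q ^ 12 := by simpa using pow_le_pow_right₀ hq1 (show 1 ≤ 12 by norm_num)
    have h7 : ((q ^ 12 : ℕ) : ℝ) * Real.log 4 ≤ q ^ 12 * 2 := by push_cast; gcongr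
    push_cast at h2 h7 ⊢
    linarith
  have key := avg_ind_hits_le N a (2 * n) ha1 hgpos G x (1 / q) (by positivity) ?_ ?_
  · refine key.trans (le_of_eq ?_)
    congr 2
    field_simp
  · rw [one_div, inv_mul_eq_div, ← mul_div_assoc, le_div_iff₀ hqpos]
    linarith
  · have h1 : (1 + Real.log (((a : ℝ) + N + (2 * n : ℕ)) / a)) / green (2 * n) 0 ≤ 1 / (2 * q) := by
      rw [div_le_div_iff₀ hgpos (by positivity), one_mul]
      refine le_trans ?_ hgreen
      have h2 : (1 + Real.log (((a : ℝ) + N + (2 * n : ℕ)) / a)) * (2 * q)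
          ≤ 64 * q ^ 12 * (2 * q) := by gcongr
      have h3 : (2 : ℝ) ^ 12 * 2 ^ 12 * 2 ^ 12 ≤ q * q * q := by gcongr
      have h4 : (0 : ℝ) ≤ q ^ 13 := by positivity
      have h5 : (q : ℝ) ^ 16 = q ^ 13 * (q * q * q) := by ring
      have h6 : (q : ℝ) ^ 13 * (2 ^ 12 * 2 ^ 12 * 2 ^ 12) ≤ q ^ 13 * (q * q * q) := by gcongr
      rw [h5]
      linarith
    have h2 : (a : ℝ) + 1 ≤ G.card * (1 / (2 * q)) := by
      rw [mul_one_div, le_div_iff₀ (by positivity)]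
      have h3 : ((a : ℝ) + 1) * (2 * q) * q ^ 21 ≤ G.card * q ^ 21 := by
        have h4 : (a : ℝ) * q ^ 21 * (4 * q) ≤ G.card * (2 ^ 19 * q ^ 18) * (4 * q) := by
          exact mul_le_mul_of_nonneg_right (haup.trans hG') (by positivity)
        have h5 : ((a : ℝ) + 1) * (2 * q) * q ^ 21 ≤ (a + a) * (2 * q) * q ^ 21 := by gcongr
        have h6 : (2 : ℝ) ^ 12 * 2 ^ 12 ≤ q * q := by gcongr
        have h7 : (G.card : ℝ) * q ^ 19 * (2 ^ 12 * 2 ^ 12) ≤ G.card * q ^ 19 * (q * q) := by gcongr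
        have h8 : (0 : ℝ) ≤ G.card * q ^ 19 := by positivity
        have e1 : (G.card : ℝ) * q ^ 21 = G.card * q ^ 19 * (q * q) := by ring
        have e2 : (G.card : ℝ) * (2 ^ 19 * q ^ 18) * (4 * q) = 2 ^ 21 * (G.card * q ^ 19) := by ring
        have e3 : ((a : ℝ) + a) * (2 * q) * q ^ 21 = a * q ^ 21 * (4 * q) := by ring
        linarith
      exact le_of_mul_le_mul_right h3 (by positivity)
    have h3 : (G.card : ℝ) * ((1 + Real.log (((a : ℝ) + N + (2 * n : ℕ)) / a)) / green (2 * n) 0)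
        ≤ G.card * (1 / (2 * q)) := by gcongr
    have h4 : (G.card : ℝ) * (1 / (2 * q)) + G.card * (1 / (2 * q)) = 1 / q * G.card := by
      field_simp; norm_num
    linarith

lemma avg_bad_scale_le {q n e : ℕ} (hq : 2 ^ 12 ≤ q) (hlog : (q : ℝ) ^ 16 ≤ Real.log n)
    (hlog' : Real.log n ≤ 2 ^ 16 * (q : ℝ) ^ 16)
    (hen : 4 ^ (e + 2) ≤ n) (hne : n ≤ 4 ^ (e + q ^ 12 + 2))
    (he : 2 ^ 50 * q ^ 42 ≤ 4 ^ e) (v : ℤ × ℤ) :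
    avg n (fun l => ind (disp l = v) * ind ((newCount (pos l) (n - 4 ^ (e + 1)) (n - 4 ^ e) : ℝ)
      < (1 / (2 ^ 11 * (q : ℝ) ^ 9)) ^ 2 * 4 ^ (e + 1))) ≤ 20 / n * Real.exp (-(q / 16)) := by
  have hq' : (2 : ℝ) ^ 12 ≤ q := by exact_mod_cast hq
  have hqpos : (0 : ℝ) < q := lt_of_lt_of_le (by norm_num) hq'
  have hq1 : (1 : ℝ) ≤ q := by linarith
  have h4e : 1 ≤ 4 ^ e := Nat.one_le_pow _ _ (by norm_num)
  have hpow1 : 4 ^ (e + 1) = 4 * 4 ^ e := by rw [pow_succ, mul_comm]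
  have hpow2 : 4 ^ (e + 2) = 16 * 4 ^ e := by rw [pow_add, mul_comm]; norm_num
  rw [hpow2] at hen
  set g := (1 / (2 ^ 11 * (q : ℝ) ^ 9)) ^ 2 * 4 ^ (e + 1) with hg
  set N := n - 4 ^ (e + 1) with hN
  set N₁ := N / 2 with hN1
  set N₂ := N - N / 2 with hN2
  have hn1 : n ≤ 4 * N₁ := by omega
  have hn2 : n ≤ 4 * N₂ := by omega
  have hγ : ∀ M ≤ n, ∀ (G : Finset (ℤ × ℤ)) x, 2 * g ≤ G.card →
      avg M (fun l => ind ((G.card : ℝ) ≤ 4 * hits G x l)) ≤ 2 * Real.exp (-(q / 16)) :=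
    fun M hM G x hG => avg_ind_hits_le_of_scale hq hlog hM (by omega) hne he G x hG
  have hα : avg (3 * 4 ^ e - 1) (fun l => ind ((rangeCard l : ℝ) < 2 * g))
      ≤ Real.exp (-(q / 16)) := by
    have hqe : q ≤ 4 ^ e := by
      refine le_trans ?_ he
      have : q ≤ q ^ 42 := Nat.le_self_pow (by norm_num) q
      omega
    have hb1 : 1 ≤ 4 ^ e / q := (Nat.one_le_div_iff (by omega)).2 hqe
    refine (avg_ind_rangeCard_lt_le (4 ^ e / q) q (3 * 4 ^ e - 1) (2 * g) ?_ ?_).trans ?_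
    · have h1 : green (4 ^ e / q) 0 ≤ 2 ^ 17 * q ^ 16 := by
        refine (green_zero_le _).trans ?_
        have h2 : Real.log ((4 ^ e / q : ℕ) : ℝ) ≤ Real.log n := by
          apply Real.log_le_log (by exact_mod_cast hb1)
          exact_mod_cast (Nat.div_le_self _ _).trans (by omega)
        have : (1 : ℝ) ≤ q ^ 16 := one_le_pow₀ hq1
        linarith
      have h2 : (4 : ℝ) ^ e ≤ ((4 ^ e / q : ℕ) + 1 : ℝ) * q := by
        have : 4 ^ e < (4 ^ e / q + 1) * q := by
          rw [mul_comm]; exact Nat.lt_mul_div_succ _ (by omega)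
        exact_mod_cast this.le
      have h3 : 2 * g = 4 ^ e / (2 ^ 19 * q ^ 18) := by
        rw [hg, pow_succ (4 : ℝ) e]; field_simp; norm_num
      rw [h3]
      have h4 : (4 : ℝ) ^ e / (2 ^ 19 * q ^ 18) * (4 * green (4 ^ e / q) 0)
          ≤ 4 ^ e / (2 ^ 19 * q ^ 18) * (4 * (2 ^ 17 * q ^ 16)) := by gcongr
      have h5 : (4 : ℝ) ^ e / (2 ^ 19 * q ^ 18) * (4 * (2 ^ 17 * q ^ 16)) = 4 ^ e / (q * q) := by
        field_simp; norm_num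
      rw [h5] at h4
      refine h4.trans ?_
      rw [div_le_iff₀ (by positivity), ← mul_assoc]
      have : ((4 ^ e / q : ℕ) + 1 : ℝ) * q * 1 ≤ ((4 ^ e / q : ℕ) + 1 : ℝ) * q * q := by gcongr
      linarith
    · have := Nat.mul_div_le (4 ^ e) q
      omega
    · have h1 : (1 / 2 : ℝ) ≤ Real.exp (-(1 / 2)) := by
        have := Real.add_one_le_exp (-(1 / 2) : ℝ)
        linarith
      calc (1 / 2 : ℝ) ^ q ≤ (Real.exp (-(1 / 2))) ^ q := by gcongr
        _ = Real.exp (-(q / 2)) := by rw [← Real.exp_nat_mul]; congr 1; ring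
        _ ≤ _ := by gcongr; norm_num
  have key := avg_window_le N₁ N₂ (3 * 4 ^ e - 1) (4 ^ e + 1) (by omega) (by omega) g
    (Real.exp (-(q / 16))) (2 * Real.exp (-(q / 16))) v hα (hγ N₁ (by omega)) (hγ N₂ (by omega))
  rw [show N₁ + (N₂ + (3 * 4 ^ e - 1 + (4 ^ e + 1))) = n by omega, show N₁ + N₂ = N by omega,
    show N + (3 * 4 ^ e - 1) + 1 = n - 4 ^ e by omega] at key
  refine key.trans ?_
  have hnpos : (0 : ℝ) < n := by
    have : 0 < n := by omega
    exact_mod_cast this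
  have hn1' : (n : ℝ) ≤ 4 * N₁ := by exact_mod_cast hn1
  have hn2' : (n : ℝ) ≤ 4 * N₂ := by exact_mod_cast hn2
  have i1 : 1 / (N₁ : ℝ) ≤ 4 / n := by
    rw [div_le_div_iff₀ (by linarith) hnpos]; linarith
  have i2 : 1 / (N₂ : ℝ) ≤ 4 / n := by
    rw [div_le_div_iff₀ (by linarith) hnpos]; linarith
  have hE := Real.exp_pos (-((q : ℝ) / 16))
  have j1 := mul_le_mul_of_nonneg_right i1 hE.le
  have j2 := mul_le_mul_of_nonneg_right i2 hE.le
  have e3 : 20 / (n : ℝ) * Real.exp (-(q / 16)) = 5 * (4 / n * Real.exp (-(q / 16))) := by ring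
  rw [e3]
  linarith

lemma hitProb_pos_le {κ q : ℝ} (hq : 1 ≤ q) (hκ : 0 < κ) (hκ1 : κ ≤ 1) {n e₀ I : ℕ}
    (hn : 4 ^ (e₀ + I) < n) (hκe : 2 ≤ κ ^ 2 * 4 ^ e₀) (hqe : q ≤ 6 * 2 ^ e₀)
    (x : ℤ) (T : ℕ) (l : List (Fin 4)) :
    hitProb (pos l) n x T ∅ 0 0 ≤ (Real.exp (-(q ^ 2 / 48)) + 2 * (1 - κ / (16 * q)) ^ I) +
      ∑ e ∈ Finset.Ico e₀ (e₀ + I),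
        ind ((newCount (pos l) (n - 4 ^ (e + 1)) (n - 4 ^ e) : ℝ) < κ ^ 2 * 4 ^ (e + 1)) := by
  have hκq : κ / (16 * q) ≤ 1 := by
    rw [div_le_one (by positivity)]; linarith
  have h0 : 0 ≤ Real.exp (-(q ^ 2 / 48)) + 2 * (1 - κ / (16 * q)) ^ I := by
    have : 0 ≤ 1 - κ / (16 * q) := by linarith
    positivity
  by_cases h : ∀ e, e₀ ≤ e → e < e₀ + I →
      κ ^ 2 * 4 ^ (e + 1) ≤ newCount (pos l) (n - 4 ^ (e + 1)) (n - 4 ^ e)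
  · have h1 := hitProb_le_of_counts (x := x) hq hκ hκ1 e₀ I hn hκe hqe h (by simp [pos]) T
    have h2 : 0 ≤ ∑ e ∈ Finset.Ico e₀ (e₀ + I),
        ind ((newCount (pos l) (n - 4 ^ (e + 1)) (n - 4 ^ e) : ℝ) < κ ^ 2 * 4 ^ (e + 1)) :=
      Finset.sum_nonneg fun _ _ => ind_nonneg _
    linarith
  · push Not at h
    obtain ⟨e, he, he', hlt⟩ := h
    have h1 : hitProb (pos l) n x T ∅ 0 0 ≤ 1 := hitProb_le_one _ _ _ _ (Nat.zero_le n)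
    have h2 := Finset.single_le_sum (f := fun e =>
        ind ((newCount (pos l) (n - 4 ^ (e + 1)) (n - 4 ^ e) : ℝ) < κ ^ 2 * 4 ^ (e + 1)))
      (fun _ _ => ind_nonneg _) (Finset.mem_Ico.2 ⟨he, he'⟩)
    simp only [ind_of hlt] at h2
    linarith

lemma pow_twelve_le_exp {q : ℝ} (hq : 0 ≤ q) :
    q ^ 12 ≤ 32 ^ 12 * (Nat.factorial 12 : ℝ) * Real.exp (q / 32) := by
  have := Real.pow_div_factorial_le_exp (q / 32) (by positivity) 12
  rw [div_le_iff₀ (by positivity), div_pow, div_le_iff₀ (by positivity)] at this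
  linarith

lemma scale_bounds {q E : ℕ} (hq : 2 ^ 12 ≤ q) (hE : q ^ 16 ≤ 2 * (E + 2)) :
    q ^ 12 ≤ E ∧ 2 ^ 50 * q ^ 42 ≤ 4 ^ (E - q ^ 12) ∧ q ≤ 2 ^ (E - q ^ 12) := by
  have h1 : q ^ 16 = q ^ 12 * q ^ 4 := by ring
  have h2 : (2 ^ 12) ^ 4 ≤ q ^ 4 := Nat.pow_le_pow_left hq 4
  have h3 : q ^ 12 * (2 ^ 12) ^ 4 ≤ q ^ 16 := by rw [h1]; exact Nat.mul_le_mul_left _ h2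
  have h4 : q ≤ q ^ 12 := Nat.le_self_pow (by norm_num) q
  have h5 : 50 + 42 * q ≤ 2 * (E - q ^ 12) := by omega
  refine ⟨by omega, ?_, ?_⟩
  · calc 2 ^ 50 * q ^ 42 ≤ 2 ^ 50 * (2 ^ q) ^ 42 := by
          gcongr; exact Nat.lt_two_pow_self.le
      _ = 2 ^ (50 + 42 * q) := by rw [← pow_mul, ← pow_add, mul_comm q]
      _ ≤ 2 ^ (2 * (E - q ^ 12)) := Nat.pow_le_pow_right (by norm_num) h5
      _ = _ := by rw [pow_mul]; norm_num
  · exact (show q ≤ E - q ^ 12 by omega).trans Nat.lt_two_pow_self.le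

lemma avg_hitProb_le_exp {q n E : ℕ} (hq : 2 ^ 12 ≤ q) (hlog : (q : ℝ) ^ 16 ≤ Real.log n)
    (hlog' : Real.log n ≤ 2 ^ 16 * (q : ℝ) ^ 16) (hE₁ : 4 ^ (E + 1) ≤ n) (hE₂ : n < 4 ^ (E + 2))
    (x : ℤ) (T : ℕ) (v : ℤ × ℤ) :
    avg n (fun l => ind (disp l = v) * hitProb (pos l) n x T ∅ 0 0)
      ≤ 1 / n * (3 + 20 * (32 ^ 12 * (Nat.factorial 12 : ℝ))) * Real.exp (-(q / 2 ^ 15)) := by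
  have hq' : (2 : ℝ) ^ 12 ≤ q := by exact_mod_cast hq
  have hqpos : (0 : ℝ) < q := lt_of_lt_of_le (by norm_num) hq'
  have hq1 : (1 : ℝ) ≤ q := by linarith
  have hnpos : 0 < n := lt_of_lt_of_le (by positivity) hE₁
  have hnpos' : (0 : ℝ) < n := by exact_mod_cast hnpos
  have hE : q ^ 16 ≤ 2 * (E + 2) := by
    have h1 : Real.log n ≤ Real.log (4 ^ (E + 2)) :=
      Real.log_le_log hnpos' (by exact_mod_cast hE₂.le)
    have h4 : Real.log 4 ≤ 2 := by
      rw [show (4 : ℝ) = 2 ^ 2 by norm_num, Real.log_pow]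
      push_cast; linarith [Real.log_two_lt_d9]
    rw [Real.log_pow] at h1
    have h2 : ((E + 2 : ℕ) : ℝ) * Real.log 4 ≤ (E + 2 : ℕ) * 2 := by gcongr
    have h3 : (q : ℝ) ^ 16 ≤ (E + 2 : ℕ) * 2 := by linarith
    have h5 : q ^ 16 ≤ (E + 2) * 2 := by exact_mod_cast h3
    omega
  obtain ⟨hI, he42, hqe⟩ := scale_bounds hq hE
  set e₀ := E - q ^ 12 with he₀
  have hE0 : e₀ + q ^ 12 = E := by omega
  set κ : ℝ := 1 / (2 ^ 11 * (q : ℝ) ^ 9) with hκ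
  have hκ0 : 0 < κ := by positivity
  have hκ1 : κ ≤ 1 := by
    rw [hκ, div_le_one (by positivity)]
    have : (1 : ℝ) ≤ q ^ 9 := one_le_pow₀ hq1
    linarith
  have he42' : (2 : ℝ) ^ 50 * q ^ 42 ≤ 4 ^ e₀ := by exact_mod_cast he42
  have hκe : 2 ≤ κ ^ 2 * 4 ^ e₀ := by
    rw [hκ, div_pow, div_mul_eq_mul_div, le_div_iff₀ (by positivity)]
    have : (q : ℝ) ^ 18 ≤ q ^ 42 := pow_le_pow_right₀ hq1 (by norm_num)
    have : (2 ^ 11 * (q : ℝ) ^ 9) ^ 2 = 2 ^ 22 * q ^ 18 := by ring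
    rw [this]
    have : (0 : ℝ) < q ^ 42 := by positivity
    linarith
  have hqe' : (q : ℝ) ≤ 6 * 2 ^ e₀ := by
    have : (q : ℝ) ≤ 2 ^ e₀ := by exact_mod_cast hqe
    have : (0 : ℝ) < 2 ^ e₀ := by positivity
    linarith
  have hn4 : 4 ^ (e₀ + q ^ 12) < n := by
    rw [hE0]
    exact lt_of_lt_of_le (Nat.pow_lt_pow_right (by norm_num) (by omega)) hE₁
  set D := Real.exp (-((q : ℝ) / 2 ^ 15)) with hD
  have hD0 : 0 < D := Real.exp_pos _
  set c₀ := Real.exp (-((q : ℝ) ^ 2 / 48)) + 2 * (1 - κ / (16 * q)) ^ (q ^ 12) with hc₀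
  have hqq : (q : ℝ) ≤ q ^ 2 := by
    simpa using pow_le_pow_right₀ hq1 (show 1 ≤ 2 by norm_num)
  have hc₀D : c₀ ≤ 3 * D := by
    have h1 : Real.exp (-((q : ℝ) ^ 2 / 48)) ≤ D := by
      apply Real.exp_le_exp.2
      linarith
    have h2 : (1 - κ / (16 * q)) ^ (q ^ 12) ≤ D := by
      have h3 : 1 - κ / (16 * q) ≤ Real.exp (-(κ / (16 * q))) := by
        linarith [Real.add_one_le_exp (-(κ / (16 * q)))]
      have h4 : 0 ≤ 1 - κ / (16 * q) := by
        have : κ / (16 * q) ≤ 1 := by rw [div_le_one (by positivity)]; linarith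
        linarith
      calc (1 - κ / (16 * q)) ^ (q ^ 12) ≤ Real.exp (-(κ / (16 * q))) ^ (q ^ 12) := by gcongr
        _ = Real.exp (-((q : ℝ) ^ 2 / 2 ^ 15)) := by
          rw [← Real.exp_nat_mul]
          congr 1
          rw [hκ]
          push_cast
          field_simp
          norm_num
        _ ≤ D := by
          apply Real.exp_le_exp.2
          have : (q : ℝ) / 2 ^ 15 ≤ q ^ 2 / 2 ^ 15 := by gcongr
          linarith
    linarith
  have hpt : ∀ l : List (Fin 4), l.length = n →
      ind (disp l = v) * hitProb (pos l) n x T ∅ 0 0 ≤ c₀ * ind (disp l = v) +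
        ∑ e ∈ Finset.Ico e₀ (e₀ + q ^ 12), ind (disp l = v) *
          ind ((newCount (pos l) (n - 4 ^ (e + 1)) (n - 4 ^ e) : ℝ) < κ ^ 2 * 4 ^ (e + 1)) := by
    intro l _
    have h1 := mul_le_mul_of_nonneg_left (hitProb_pos_le (q := q) hq1 hκ0 hκ1 hn4 hκe hqe' x T l)
      (ind_nonneg (disp l = v))
    rw [mul_add, Finset.mul_sum, mul_comm (ind _) (_ + _)] at h1
    exact h1
  refine (avg_mono hpt).trans ?_
  rw [avg_add, avg_const_mul, avg_sum, ← trans_eq_avg_ind]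
  have hbad : ∑ e ∈ Finset.Ico e₀ (e₀ + q ^ 12), avg n (fun l => ind (disp l = v) *
      ind ((newCount (pos l) (n - 4 ^ (e + 1)) (n - 4 ^ e) : ℝ) < κ ^ 2 * 4 ^ (e + 1)))
      ≤ q ^ 12 * (20 / n * Real.exp (-(q / 16))) := by
    have h1 : ∀ e ∈ Finset.Ico e₀ (e₀ + q ^ 12), avg n (fun l => ind (disp l = v) *
        ind ((newCount (pos l) (n - 4 ^ (e + 1)) (n - 4 ^ e) : ℝ) < κ ^ 2 * 4 ^ (e + 1)))
        ≤ 20 / n * Real.exp (-(q / 16)) := by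
      intro e he
      rw [Finset.mem_Ico] at he
      refine avg_bad_scale_le hq hlog hlog' ?_ ?_ ?_ v
      · exact (Nat.pow_le_pow_right (by norm_num) (by omega)).trans hE₁
      · exact hE₂.le.trans (Nat.pow_le_pow_right (by norm_num) (by omega))
      · exact he42.trans (Nat.pow_le_pow_right (by norm_num) he.1)
    have h2 := Finset.sum_le_card_nsmul _ _ _ h1
    rw [nsmul_eq_mul, Nat.card_Ico, Nat.add_sub_cancel_left] at h2
    exact_mod_cast h2
  have htr := trans_le n hnpos v
  have h1 : c₀ * trans n v ≤ 3 * D * (1 / n) :=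
    mul_le_mul hc₀D htr (trans_nonneg _ _) (by positivity)
  have h2 : (q : ℝ) ^ 12 * (20 / n * Real.exp (-(q / 16)))
      ≤ 32 ^ 12 * (Nat.factorial 12 : ℝ) * D * (20 / n) := by
    have h3 : (q : ℝ) ^ 12 * Real.exp (-(q / 16)) ≤ 32 ^ 12 * (Nat.factorial 12 : ℝ) * D := by
      have h4 := mul_le_mul_of_nonneg_right (pow_twelve_le_exp hqpos.le)
        (Real.exp_pos (-((q : ℝ) / 16))).le
      rw [mul_assoc (32 ^ 12 * _), ← Real.exp_add] at h4
      refine h4.trans ?_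
      refine mul_le_mul_of_nonneg_left (Real.exp_le_exp.2 ?_) (by positivity)
      linarith
    have h5 := mul_le_mul_of_nonneg_right h3 (show (0 : ℝ) ≤ 20 / n by positivity)
    linarith
  have e1 : 1 / (n : ℝ) * (3 + 20 * (32 ^ 12 * (Nat.factorial 12 : ℝ))) * D
      = 3 * D * (1 / n) + 32 ^ 12 * (Nat.factorial 12 : ℝ) * D * (20 / n) := by ring
  rw [e1]
  linarith

/-- Along a simple random walk path, the probability that the induced walk is at `x` at its `n`-th
exit is small, on average over the paths of length `n` ending at `v`. -/
theorem exists_avg_hitProb_le : ∃ C c : ℝ, 0 < C ∧ 0 < c ∧ ∃ n₀ : ℕ, ∀ n, n₀ ≤ n →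
    ∀ (x : ℤ) (T : ℕ) (v : ℤ × ℤ), avg n (fun l => ind (disp l = v) * hitProb (pos l) n x T ∅ 0 0)
      ≤ 1 / n * C * Real.exp (-c * Real.log n ^ (1 / 16 : ℝ)) := by
  refine ⟨(3 + 20 * (32 ^ 12 * (Nat.factorial 12 : ℝ))) * Real.exp (1 / 2 ^ 15), 1 / 2 ^ 15,
    by positivity, by positivity, ?_⟩
  have hev : ∀ᶠ n : ℕ in atTop, ((2 : ℝ) ^ 12) ^ 16 ≤ Real.log n :=
    (Real.tendsto_log_atTop.comp tendsto_natCast_atTop_atTop).eventually_ge_atTop _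
  obtain ⟨n₀, hn₀⟩ := eventually_atTop.1 hev
  refine ⟨max n₀ 4, fun n hn x T v => ?_⟩
  have hL := hn₀ n (le_of_max_le_left hn)
  have hn4 : 4 ≤ n := le_of_max_le_right hn
  set L := Real.log n with hLdef
  have hL0 : 0 ≤ L := le_trans (by positivity) hL
  set r := L ^ (1 / 16 : ℝ) with hr
  have hr0 : 0 ≤ r := Real.rpow_nonneg hL0 _
  have hr16 : r ^ 16 = L := by
    rw [hr, ← Real.rpow_natCast, ← Real.rpow_mul hL0]; norm_num
  set q := ⌊r⌋₊ with hqdef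
  have hqr : (q : ℝ) ≤ r := Nat.floor_le hr0
  have hrq : r < q + 1 := Nat.lt_floor_add_one r
  have hr12 : (2 : ℝ) ^ 12 ≤ r := by
    rw [← hr16] at hL
    exact le_of_pow_le_pow_left₀ (by norm_num) hr0 hL
  have hq : 2 ^ 12 ≤ q := Nat.le_floor (by exact_mod_cast hr12)
  have hq' : (2 : ℝ) ^ 12 ≤ q := by exact_mod_cast hq
  have hlog : (q : ℝ) ^ 16 ≤ L := by rw [← hr16]; gcongr
  have hlog' : L ≤ 2 ^ 16 * (q : ℝ) ^ 16 := by
    rw [← hr16, ← mul_pow]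
    gcongr
    linarith
  have hlog1 : 1 ≤ Nat.log 4 n := Nat.log_pos (by norm_num) hn4
  obtain ⟨E, hE⟩ : ∃ E, Nat.log 4 n = E + 1 := ⟨Nat.log 4 n - 1, by omega⟩
  have hE₁ : 4 ^ (E + 1) ≤ n := by rw [← hE]; exact Nat.pow_log_le_self 4 (by omega)
  have hE₂ : n < 4 ^ (E + 2) := by
    have := Nat.lt_pow_succ_log_self (b := 4) (by norm_num) n
    rwa [hE] at this
  refine (avg_hitProb_le_exp hq hlog hlog' hE₁ hE₂ x T v).trans ?_
  have h1 : Real.exp (-((q : ℝ) / 2 ^ 15))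
      ≤ Real.exp (1 / 2 ^ 15) * Real.exp (-(1 / 2 ^ 15) * r) := by
    rw [← Real.exp_add]
    apply Real.exp_le_exp.2
    linarith
  rw [← mul_assoc (1 / (n : ℝ)), mul_assoc _ (Real.exp (1 / 2 ^ 15))]
  gcongr

section

/-- The step `vec s` in the last two coordinates. -/
def oz (s : Fin 4) : Fin 4 → ℤ := ![0, 0, (vec s).1, (vec s).2]

/-- The six steps available from an old site. -/
def oldStep : Fin 6 → Fin 4 → ℤ := ![nb 2, nb 3, oz 0, oz 1, oz 2, oz 3]

lemma nb_injective : Function.Injective nb := by decide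

lemma oldStep_injective : Function.Injective oldStep := by decide

lemma nb_eq_unitVec (s : Fin 4) : ∃ i : Fin 4, ∃ ε : ℤ, i.1 < 2 ∧ (ε = 1 ∨ ε = -1) ∧
    nb s = ε • unitVec 4 i := by
  fin_cases s
  · exact ⟨0, 1, by decide, by decide, by decide⟩
  · exact ⟨0, -1, by decide, by decide, by decide⟩
  · exact ⟨1, 1, by decide, by decide, by decide⟩
  · exact ⟨1, -1, by decide, by decide, by decide⟩

lemma oldStep_eq_unitVec (s : Fin 6) : ∃ i : Fin 4, ∃ ε : ℤ, 4 - 3 ≤ i.1 ∧ (ε = 1 ∨ ε = -1) ∧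
    oldStep s = ε • unitVec 4 i := by
  fin_cases s
  · exact ⟨1, 1, by decide, by decide, by decide⟩
  · exact ⟨1, -1, by decide, by decide, by decide⟩
  · exact ⟨2, 1, by decide, by decide, by decide⟩
  · exact ⟨2, -1, by decide, by decide, by decide⟩
  · exact ⟨3, 1, by decide, by decide, by decide⟩
  · exact ⟨3, -1, by decide, by decide, by decide⟩

lemma zw_add_oz (p : Fin 4 → ℤ) (s : Fin 4) : zw (p + oz s) = zw p + vec s := by
  ext <;> simp [zw, oz]

lemma vec_ne_zero (s : Fin 4) : vec s ≠ 0 := by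
  revert s; decide

lemma vec_injective : Function.Injective vec := by decide

lemma zw_add_oz_ne (p : Fin 4 → ℤ) (s : Fin 4) : zw (p + oz s) ≠ zw p := by
  rw [zw_add_oz, Ne, add_eq_left]
  exact vec_ne_zero s

lemma add_oz_eq_exitPos {p : Fin 4 → ℤ} {s : Fin 4} {z : ℤ × ℤ} (h : zw (p + oz s) = z) :
    p + oz s = exitPos p z := by
  subst h
  ext i
  fin_cases i <;> simp [exitPos, oz, zw]

variable {Ω : Type*} {S : ℕ → Ω → Fin 4 → ℤ}

/-- The event that the process follows `h` up to time `t`. -/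
def cyl (S : ℕ → Ω → Fin 4 → ℤ) (t : ℕ) (h : ℕ → Fin 4 → ℤ) : Set Ω := {ω | ∀ k ≤ t, S k ω = h k}

/-- The trajectory `h` up to time `t`, continued by `y` at time `t + 1`. -/
def cont (h : ℕ → Fin 4 → ℤ) (t : ℕ) (y : Fin 4 → ℤ) : ℕ → Fin 4 → ℤ := Function.update h (t + 1) y

@[simp] lemma cont_succ (h : ℕ → Fin 4 → ℤ) (t : ℕ) (y : Fin 4 → ℤ) : cont h t y (t + 1) = y := by
  simp [cont]

lemma cont_of_le (h : ℕ → Fin 4 → ℤ) {t k : ℕ} (y : Fin 4 → ℤ) (hk : k ≤ t) :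
    cont h t y k = h k := by
  rw [cont, Function.update_of_ne (by omega)]

lemma cyl_cont (t : ℕ) (h : ℕ → Fin 4 → ℤ) (y : Fin 4 → ℤ) :
    cyl S (t + 1) (cont h t y) = {ω | (∀ k ≤ t, S k ω = h k) ∧ S (t + 1) ω = y} := by
  ext ω
  simp only [cyl, Set.mem_ofPred_eq]
  constructor
  · intro H
    refine ⟨fun k hk => ?_, ?_⟩
    · rw [H k (by omega), cont_of_le h y hk]
    · rw [H (t + 1) le_rfl, cont_succ]
  · rintro ⟨H₁, H₂⟩ k hk
    rcases Nat.lt_or_eq_of_le hk with hk | rfl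
    · rw [H₁ k (by omega), cont_of_le h y (by omega)]
    · rw [H₂, cont_succ]

variable [MeasurableSpace Ω] {P : Measure Ω}

lemma measurableSet_cyl (hS : IsBERW 4 2 3 P S) (t : ℕ) (h : ℕ → Fin 4 → ℤ) :
    MeasurableSet (cyl S t h) := by
  have : cyl S t h = ⋂ k ∈ Set.Iic t, S k ⁻¹' {h k} := by
    ext ω; simp [cyl]
  rw [this]
  exact MeasurableSet.biInter (Set.to_countable _)
    fun k _ => hS.1 k (MeasurableSet.singleton _)

lemma measureReal_cyl_cont_new (hS : IsBERW 4 2 3 P S) {t : ℕ} {h : ℕ → Fin 4 → ℤ}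
    (hnew : ∀ k < t, h t ≠ h k) (s : Fin 4) :
    P.real (cyl S (t + 1) (cont h t (h t + nb s))) = P.real (cyl S t h) / (4 : ℕ) := by
  obtain ⟨i, ε, hi, hε, heq⟩ := nb_eq_unitVec s
  have := hS.2.2.1 t h hnew i hi ε hε
  rw [cyl_cont, heq, measureReal_def, this, ENNReal.toReal_div]
  norm_num [measureReal_def, cyl]

lemma measureReal_cyl_cont_old (hS : IsBERW 4 2 3 P S) {t : ℕ} {h : ℕ → Fin 4 → ℤ}
    (hold : ∃ k < t, h t = h k) (s : Fin 6) :
    P.real (cyl S (t + 1) (cont h t (h t + oldStep s))) = P.real (cyl S t h) / (6 : ℕ) := by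
  obtain ⟨i, ε, hi, hε, heq⟩ := oldStep_eq_unitVec s
  have := hS.2.2.2 t h hold i hi ε hε
  rw [cyl_cont, heq, measureReal_def, this, ENNReal.toReal_div]
  norm_num [measureReal_def, cyl]

lemma measureReal_cyl_inter_le [IsFiniteMeasure P] (hS : IsBERW 4 2 3 P S) {m : ℕ} (hm : m ≠ 0)
    {f : Fin m → Fin 4 → ℤ} (hf : Function.Injective f) {t : ℕ} {h : ℕ → Fin 4 → ℤ}
    (hstep : ∀ s, P.real (cyl S (t + 1) (cont h t (h t + f s))) = P.real (cyl S t h) / m)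
    (B : Set Ω) :
    P.real (cyl S t h ∩ B) ≤ ∑ s, P.real (cyl S (t + 1) (cont h t (h t + f s)) ∩ B) := by
  set D : Fin m → Set Ω := fun s => cyl S (t + 1) (cont h t (h t + f s)) with hD
  have hDm : ∀ s, MeasurableSet (D s) := fun s => measurableSet_cyl hS _ _
  have hdisj : Pairwise (Function.onFun Disjoint D) := by
    intro s s' hss
    refine Set.disjoint_left.2 fun ω h1 h2 => hss ?_
    simp only [hD, cyl_cont, Set.mem_ofPred_eq] at h1 h2
    exact hf (add_left_cancel (h1.2.symm.trans h2.2))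
  have hsub : ⋃ s, D s ⊆ cyl S t h := by
    refine Set.iUnion_subset fun s ω hω => ?_
    simp only [hD, cyl_cont, Set.mem_ofPred_eq] at hω
    exact hω.1
  have hU : P.real (⋃ s, D s) = P.real (cyl S t h) := by
    rw [measureReal_iUnion_fintype hdisj hDm, Finset.sum_congr rfl fun s _ => hstep s]
    have : (m : ℝ) ≠ 0 := by exact_mod_cast hm
    simp
    field_simp
  have hnull : P.real (cyl S t h \ ⋃ s, D s) = 0 := by
    rw [measureReal_sdiff hsub (MeasurableSet.iUnion hDm), hU, sub_self]
  have hcov : cyl S t h ∩ B ⊆ (cyl S t h \ ⋃ s, D s) ∪ ⋃ s, D s ∩ B := by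
    rintro ω ⟨h1, h2⟩
    by_cases h3 : ω ∈ ⋃ s, D s
    · right
      obtain ⟨s, hs⟩ := Set.mem_iUnion.1 h3
      exact Set.mem_iUnion.2 ⟨s, hs, h2⟩
    · exact Or.inl ⟨h1, h3⟩
  calc P.real (cyl S t h ∩ B) ≤ P.real ((cyl S t h \ ⋃ s, D s) ∪ ⋃ s, D s ∩ B) :=
        measureReal_mono hcov
    _ ≤ P.real (cyl S t h \ ⋃ s, D s) + P.real (⋃ s, D s ∩ B) := measureReal_union_le _ _
    _ ≤ ∑ s, P.real (D s ∩ B) := by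
        rw [hnull, zero_add]
        exact measureReal_iUnion_fintype_le _

lemma measure_eq_zero_of_cyl [IsFiniteMeasure P] (t : ℕ) (B : Set Ω)
    (hB : ∀ h, P.real (cyl S t h ∩ B) = 0) : P B = 0 := by
  have hcov : B ⊆ ⋃ f : Fin (t + 1) → Fin 4 → ℤ,
      cyl S t (fun k => if hk : k < t + 1 then f ⟨k, hk⟩ else 0) ∩ B := by
    intro ω hω
    refine Set.mem_iUnion.2 ⟨fun k => S k ω, fun k hk => ?_, hω⟩
    simp [Nat.lt_succ_of_le hk]
  refine measure_mono_null hcov (measure_iUnion_null fun f => ?_)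
  have := hB (fun k => if hk : k < t + 1 then f ⟨k, hk⟩ else 0)
  rwa [measureReal_eq_zero_iff] at this

lemma new_or_old (h : ℕ → Fin 4 → ℤ) (t : ℕ) :
    (∀ k < t, h t ≠ h k) ∨ ∃ k < t, h t = h k := by
  by_cases H : ∃ k < t, h t = h k
  · exact Or.inr H
  · push Not at H
    exact Or.inl H

/-- Almost surely, every step changes either the first two or the last two coordinates, by one. -/
lemma ae_step [IsFiniteMeasure P] (hS : IsBERW 4 2 3 P S) :
    ∀ᵐ ω ∂P, ∀ t, ∃ s, S (t + 1) ω = S t ω + nb s ∨ S (t + 1) ω = S t ω + oz s := by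
  rw [ae_all_iff]
  intro t
  refine measure_eq_zero_of_cyl (S := S) t _ fun h => le_antisymm ?_ measureReal_nonneg
  have hempty : ∀ (y : Fin 4 → ℤ), (∃ s, y = nb s ∨ y = oz s) →
      P.real (cyl S (t + 1) (cont h t (h t + y)) ∩
        {ω | ∃ s, S (t + 1) ω = S t ω + nb s ∨ S (t + 1) ω = S t ω + oz s}ᶜ) = 0 := by
    rintro y ⟨s, hs⟩
    rw [cyl_cont]
    convert measureReal_empty
    rw [Set.eq_empty_iff_forall_notMem]
    rintro ω ⟨⟨h1, h2⟩, h3⟩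
    refine h3 ⟨s, ?_⟩
    rw [h2, h1 t le_rfl]
    rcases hs with rfl | rfl <;> simp
  rcases new_or_old h t with H | H
  · refine (measureReal_cyl_inter_le hS (by norm_num) nb_injective
      (measureReal_cyl_cont_new hS H) _).trans (le_of_eq ?_)
    exact Finset.sum_eq_zero fun s _ => hempty _ ⟨s, Or.inl rfl⟩
  · refine (measureReal_cyl_inter_le hS (by norm_num) oldStep_injective
      (measureReal_cyl_cont_old hS H) _).trans (le_of_eq ?_)
    refine Finset.sum_eq_zero fun s _ => hempty _ ?_
    fin_cases s
    exacts [⟨2, Or.inl rfl⟩, ⟨3, Or.inl rfl⟩, ⟨0, Or.inr rfl⟩, ⟨1, Or.inr rfl⟩, ⟨2, Or.inr rfl⟩,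
      ⟨3, Or.inr rfl⟩]

end

/-- The number of moves of the last two coordinates up to time `t`. -/
def moves (s : ℕ → Fin 4 → ℤ) (t : ℕ) : ℕ :=
  ((Finset.range t).filter (fun j => zw (s (j + 1)) ≠ zw (s j))).card

@[simp] lemma moves_zero (s : ℕ → Fin 4 → ℤ) : moves s 0 = 0 := by simp [moves]

lemma moves_succ_of_eq {s : ℕ → Fin 4 → ℤ} {t : ℕ} (h : zw (s (t + 1)) = zw (s t)) :
    moves s (t + 1) = moves s t := by
  simp [moves, Finset.range_add_one, Finset.filter_insert, h]

lemma moves_succ_of_ne {s : ℕ → Fin 4 → ℤ} {t : ℕ} (h : zw (s (t + 1)) ≠ zw (s t)) :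
    moves s (t + 1) = moves s t + 1 := by
  simp [moves, Finset.range_add_one, Finset.filter_insert, h]

lemma moves_mono (s : ℕ → Fin 4 → ℤ) : Monotone (moves s) := by
  refine monotone_nat_of_le_succ fun t => ?_
  by_cases h : zw (s (t + 1)) = zw (s t)
  · rw [moves_succ_of_eq h]
  · rw [moves_succ_of_ne h]; omega

lemma moves_congr {s s' : ℕ → Fin 4 → ℤ} {t : ℕ} (h : ∀ k ≤ t, s k = s' k) :
    moves s t = moves s' t := by
  unfold moves
  congr 1
  refine Finset.filter_congr fun j hj => ?_
  rw [Finset.mem_range] at hj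
  rw [h j (by omega), h (j + 1) (by omega)]

/-- The trajectory `s` makes its `n`-th move of the last two coordinates at time `r`, at first
coordinate `x`, and its last two coordinates have followed `u`. -/
def ReachAt (u : ℕ → ℤ × ℤ) (n : ℕ) (x : ℤ) (s : ℕ → Fin 4 → ℤ) (r : ℕ) : Prop :=
  moves s r = n ∧ (∀ j < r, moves s j < n) ∧ s r 0 = x ∧ ∀ j ≤ r, zw (s j) = u (moves s j)

lemma cont_image_Iio (h : ℕ → Fin 4 → ℤ) (t : ℕ) (y : Fin 4 → ℤ) :
    cont h t y '' Set.Iio (t + 1) = insert (h t) (h '' Set.Iio t) := by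
  ext p
  simp only [Set.mem_image, Set.mem_Iio, Set.mem_insert_iff]
  constructor
  · rintro ⟨k, hk, rfl⟩
    rw [cont_of_le h y (by omega)]
    rcases Nat.lt_or_eq_of_le (Nat.le_of_lt_succ hk) with hk | rfl
    · exact Or.inr ⟨k, hk, rfl⟩
    · exact Or.inl rfl
  · rintro (rfl | ⟨k, hk, rfl⟩)
    · exact ⟨t, by omega, cont_of_le h y le_rfl⟩
    · exact ⟨k, by omega, cont_of_le h y hk.le⟩

lemma moves_cont (h : ℕ → Fin 4 → ℤ) {t k : ℕ} (y : Fin 4 → ℤ) (hk : k ≤ t) :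
    moves (cont h t y) k = moves h k :=
  moves_congr fun _ hj => cont_of_le h y (hj.trans hk)

lemma moves_cont_succ_nb (h : ℕ → Fin 4 → ℤ) (t : ℕ) (s : Fin 4) :
    moves (cont h t (h t + nb s)) (t + 1) = moves h t := by
  rw [moves_succ_of_eq, moves_cont h _ le_rfl]
  rw [cont_succ, cont_of_le h _ le_rfl, zw_add_nb]

lemma moves_cont_succ_oz (h : ℕ → Fin 4 → ℤ) (t : ℕ) (s : Fin 4) :
    moves (cont h t (h t + oz s)) (t + 1) = moves h t + 1 := by
  rw [moves_succ_of_ne, moves_cont h _ le_rfl]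
  rw [cont_succ, cont_of_le h _ le_rfl]
  exact zw_add_oz_ne _ _

lemma mem_image_Iio_iff (h : ℕ → Fin 4 → ℤ) (t : ℕ) :
    h t ∈ h '' Set.Iio t ↔ ∃ k < t, h t = h k := by
  simp only [Set.mem_image, Set.mem_Iio]
  exact ⟨fun ⟨k, hk, he⟩ => ⟨k, hk, he.symm⟩, fun ⟨k, hk, he⟩ => ⟨k, hk, he.symm⟩⟩

lemma notMem_image_Iio_iff (h : ℕ → Fin 4 → ℤ) (t : ℕ) :
    h t ∉ h '' Set.Iio t ↔ ∀ k < t, h t ≠ h k := by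
  rw [mem_image_Iio_iff]; push Not; rfl

section

variable {Ω : Type*} [MeasurableSpace Ω] {P : Measure Ω} {S : ℕ → Ω → Fin 4 → ℤ}
  {u : ℕ → ℤ × ℤ} {n : ℕ} {x : ℤ}

lemma measureReal_cyl_cont_oz_le (t T : ℕ) (h : ℕ → Fin 4 → ℤ) (hlt : ∀ j ≤ t, moves h j < n)
    {c : ℝ} (hc : 0 ≤ c) (hle : ∀ s, zw (h t + oz s) = u (moves h t + 1) →
      P.real (cyl S (t + 1) (cont h t (h t + oz s)) ∩
        {ω | ∃ r ≤ t + 1 + T, ReachAt u n x (fun k => S k ω) r}) ≤ c) :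
    ∑ s, P.real (cyl S (t + 1) (cont h t (h t + oz s)) ∩
        {ω | ∃ r ≤ t + 1 + T, ReachAt u n x (fun k => S k ω) r}) ≤ c := by
  have hzero : ∀ s, zw (h t + oz s) ≠ u (moves h t + 1) →
      P.real (cyl S (t + 1) (cont h t (h t + oz s)) ∩
        {ω | ∃ r ≤ t + 1 + T, ReachAt u n x (fun k => S k ω) r}) = 0 := by
    intro s hs
    convert measureReal_empty
    rw [Set.eq_empty_iff_forall_notMem]
    rintro ω ⟨h1, r, hr, hr1, hr2, hr3, hr4⟩
    have hcm : ∀ j ≤ t + 1, moves (fun k => S k ω) j = moves (cont h t (h t + oz s)) j :=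
      fun j hj => moves_congr fun k hk => h1 k (hk.trans hj)
    have hrt : t + 1 ≤ r := by
      by_contra! hlt'
      have h2 := hlt r (by omega)
      rw [hcm r (by omega), moves_cont h _ (by omega)] at hr1
      omega
    have h3 := hr4 (t + 1) hrt
    have h4 : S (t + 1) ω = h t + oz s := by rw [h1 _ le_rfl, cont_succ]
    rw [hcm _ le_rfl, moves_cont_succ_oz] at h3
    simp only [h4] at h3
    exact hs h3
  by_cases hex : ∃ s, zw (h t + oz s) = u (moves h t + 1)
  · obtain ⟨s, hs⟩ := hex
    rw [Finset.sum_eq_single s]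
    · exact hle s hs
    · intro s' _ hne
      refine hzero s' fun hs' => hne ?_
      have := hs'.trans hs.symm
      rw [zw_add_oz, zw_add_oz] at this
      exact vec_injective (add_left_cancel this)
    · simp
  · push Not at hex
    rw [Finset.sum_eq_zero fun s _ => hzero s (hex s)]
    exact hc

variable [IsFiniteMeasure P]

lemma measureReal_cyl_reach_end (T t : ℕ) (h : ℕ → Fin 4 → ℤ)
    (hlt : ∀ j < t, moves h j < n) (hk : moves h t = n) :
    P.real (cyl S t h ∩ {ω | ∃ r ≤ t + T, ReachAt u n x (fun k => S k ω) r})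
      ≤ P.real (cyl S t h) * ((1 / 4) ^ (n - moves h t) *
        hitProb u n x T (h '' Set.Iio t) (h t) (moves h t)) := by
  rw [hk, hitProb_end, Nat.sub_self, pow_zero, one_mul]
  by_cases hx : h t 0 = x
  · rw [ind_of hx, mul_one]
    exact measureReal_mono Set.inter_subset_left
  · rw [ind_not hx, mul_zero]
    refine le_of_eq ?_
    convert measureReal_empty
    rw [Set.eq_empty_iff_forall_notMem]
    rintro ω ⟨h1, r, -, hr1, hr2, hr3, -⟩
    have hcm : ∀ j ≤ t, moves (fun k => S k ω) j = moves h j :=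
      fun j hj => moves_congr fun k hk => h1 k (hk.trans hj)
    have hrt : r = t := by
      refine le_antisymm ?_ ?_ <;> by_contra! hlt'
      · have := hr2 t hlt'
        rw [hcm t le_rfl] at this
        omega
      · have := hlt r hlt'
        rw [hcm r hlt'.le] at hr1
        omega
    subst hrt
    simp only [h1 r le_rfl] at hr3
    exact hx hr3

lemma measureReal_cyl_reach_le (hS : IsBERW 4 2 3 P S) (T t : ℕ) (h : ℕ → Fin 4 → ℤ)
    (hlt : ∀ j < t, moves h j < n) (hle : moves h t ≤ n) :
    P.real (cyl S t h ∩ {ω | ∃ r ≤ t + T, ReachAt u n x (fun k => S k ω) r})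
      ≤ P.real (cyl S t h) * ((1 / 4) ^ (n - moves h t) *
        hitProb u n x T (h '' Set.Iio t) (h t) (moves h t)) := by
  rcases Nat.lt_or_eq_of_le hle with hk | hk
  swap
  · exact measureReal_cyl_reach_end T t h hlt hk
  induction T generalizing t h with
  | zero =>
    rw [hitProb_zero _ _ hk.ne, mul_zero, mul_zero]
    refine le_of_eq ?_
    convert measureReal_empty
    rw [Set.eq_empty_iff_forall_notMem]
    rintro ω ⟨h1, r, hr, hr1, -⟩
    have h2 : moves (fun k => S k ω) t = moves h t := moves_congr h1
    have h3 := moves_mono (fun k => S k ω) (show r ≤ t from hr)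
    omega
  | succ T ih =>
    have hlt' : ∀ j ≤ t, moves h j < n := fun j hj => (moves_mono h hj).trans_lt hk
    have hnb : ∀ s, P.real (cyl S (t + 1) (cont h t (h t + nb s)) ∩
        {ω | ∃ r ≤ t + 1 + T, ReachAt u n x (fun k => S k ω) r})
          ≤ P.real (cyl S (t + 1) (cont h t (h t + nb s))) * ((1 / 4) ^ (n - moves h t) *
            hitProb u n x T (insert (h t) (h '' Set.Iio t)) (h t + nb s) (moves h t)) := by
      intro s
      have := ih (t + 1) (cont h t (h t + nb s))
        (fun j hj => by rw [moves_cont h _ (by omega)]; exact hlt' j (by omega))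
        (by rw [moves_cont_succ_nb]; exact hle) (by rw [moves_cont_succ_nb]; exact hk)
      rwa [moves_cont_succ_nb, cont_image_Iio, cont_succ] at this
    have e1 : t + (T + 1) = t + 1 + T := by ring
    rw [e1]
    rcases new_or_old h t with H | H
    · have hp : h t ∉ h '' Set.Iio t := (notMem_image_Iio_iff h t).2 H
      rw [hitProb_new T hk.ne hp]
      refine (measureReal_cyl_inter_le hS (by norm_num) nb_injective
        (measureReal_cyl_cont_new hS H) _).trans ?_
      refine (Finset.sum_le_sum fun s _ => hnb s).trans (le_of_eq ?_)
      simp only [measureReal_cyl_cont_new hS H]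
      simp only [Fin.sum_univ_four]
      push_cast
      ring
    · have hp : h t ∈ h '' Set.Iio t := (mem_image_Iio_iff h t).2 H
      rw [hitProb_old T hk.ne hp]
      have hold := measureReal_cyl_cont_old hS H
      refine (measureReal_cyl_inter_le hS (by norm_num) oldStep_injective hold _).trans ?_
      have hoz := measureReal_cyl_cont_oz_le (P := P) (S := S) (x := x) (u := u) t T h hlt'
        (c := P.real (cyl S t h) / 6 * ((1 / 4) ^ (n - (moves h t + 1)) * hitProb u n x T
          (h '' Set.Iio t) (exitPos (h t) (u (moves h t + 1))) (moves h t + 1)))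
        (mul_nonneg (by positivity) (mul_nonneg (by positivity) (hitProb_nonneg _ _ _ _))) (by
          intro s hs
          have hmeas : P.real (cyl S (t + 1) (cont h t (h t + oz s))) = P.real (cyl S t h) / 6 := by
            fin_cases s
            exacts [hold 2, hold 3, hold 4, hold 5]
          have hmv : moves (cont h t (h t + oz s)) (t + 1) = moves h t + 1 :=
            moves_cont_succ_oz _ _ _
          have hIns : h '' Set.Iio t = cont h t (h t + oz s) '' Set.Iio (t + 1) := by
            rw [cont_image_Iio, Set.insert_eq_of_mem hp]
          have hlt'' : ∀ j < t + 1, moves (cont h t (h t + oz s)) j < n := fun j hj => by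
            rw [moves_cont h _ (by omega)]; exact hlt' j (by omega)
          rw [← add_oz_eq_exitPos hs, ← hmeas]
          have key : P.real (cyl S (t + 1) (cont h t (h t + oz s)) ∩
              {ω | ∃ r ≤ t + 1 + T, ReachAt u n x (fun k => S k ω) r})
              ≤ P.real (cyl S (t + 1) (cont h t (h t + oz s))) * ((1 / 4) ^
                (n - moves (cont h t (h t + oz s)) (t + 1)) * hitProb u n x T
                (cont h t (h t + oz s) '' Set.Iio (t + 1)) (cont h t (h t + oz s) (t + 1))
                (moves (cont h t (h t + oz s)) (t + 1))) := by
            rcases Nat.lt_or_eq_of_le (show moves h t + 1 ≤ n from hk) with hk' | hk'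
            · exact ih _ _ hlt'' (hmv.trans_le hk'.le) (hmv.trans_lt hk')
            · exact measureReal_cyl_reach_end T _ _ hlt'' (hmv.trans hk')
          rwa [hmv, ← hIns, cont_succ] at key)
      rw [Set.insert_eq_of_mem hp] at hnb
      have h2 := hnb 2
      have h3 := hnb 3
      have m2 : P.real (cyl S (t + 1) (cont h t (h t + nb 2))) = P.real (cyl S t h) / 6 := hold 0
      have m3 : P.real (cyl S (t + 1) (cont h t (h t + nb 3))) = P.real (cyl S t h) / 6 := hold 1
      rw [m2] at h2
      rw [m3] at h3
      have e2 : n - moves h t = n - (moves h t + 1) + 1 := by omega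
      rw [e2, pow_succ] at h2 h3 ⊢
      rw [Fin.sum_univ_four] at hoz
      rw [Fin.sum_univ_six]
      simp only [oldStep, Matrix.cons_val]
      linarith

/-- A weight bounding, up to a factor, the tail of the time until the last two coordinates next
move from `p`, where `A` is the set of past sites. -/
noncomputable def stayCoef (A : Set (Fin 4 → ℤ)) (p : Fin 4 → ℤ) : ℝ :=
  3 - ind (p ∈ A) - ind (p ∈ A ∨ ∃ s, p + nb s ∈ A)

lemma one_le_stayCoef (A : Set (Fin 4 → ℤ)) (p : Fin 4 → ℤ) : 1 ≤ stayCoef A p := by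
  unfold stayCoef
  linarith [ind_le_one (p ∈ A), ind_le_one (p ∈ A ∨ ∃ s, p + nb s ∈ A)]

lemma stayCoef_of_mem {A : Set (Fin 4 → ℤ)} {p : Fin 4 → ℤ} (hp : p ∈ A) : stayCoef A p = 1 := by
  rw [stayCoef, ind_of hp, ind_of (Or.inl hp)]; norm_num

lemma stayCoef_insert_le (A : Set (Fin 4 → ℤ)) (p : Fin 4 → ℤ) (s : Fin 4) :
    stayCoef (insert p A) (p + nb s) ≤ 2 := by
  have : p + nb s + nb (opp s) ∈ insert p A := by
    rw [add_nb_add_nb_opp]; exact Set.mem_insert _ _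
  rw [stayCoef, ind_of (p := _ ∨ _) (Or.inr ⟨_, this⟩)]
  linarith [ind_nonneg (p + nb s ∈ insert p A)]

lemma sum_stayCoef_le {A : Set (Fin 4 → ℤ)} {p : Fin 4 → ℤ} (hp : p ∉ A) :
    ∑ s, stayCoef (insert p A) (p + nb s) ≤ 7 / 2 * stayCoef A p := by
  by_cases h : ∃ s, p + nb s ∈ A
  · obtain ⟨s, hs⟩ := h
    have h1 : stayCoef A p = 2 := by
      rw [stayCoef, ind_not hp, ind_of (Or.inr ⟨s, hs⟩)]; norm_num
    have h2 := stayCoef_of_mem (Set.mem_insert_of_mem p hs)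
    rw [h1]
    have h3 := Finset.sum_le_card_nsmul (Finset.univ.erase s)
      (fun s => stayCoef (insert p A) (p + nb s)) 2 (fun s _ => stayCoef_insert_le A p s)
    rw [Finset.card_erase_of_mem (Finset.mem_univ s), nsmul_eq_mul] at h3
    norm_num at h3
    linarith
  · have h1 : stayCoef A p = 3 := by
      rw [stayCoef, ind_not hp, ind_not (not_or.2 ⟨hp, h⟩)]; norm_num
    have h3 := Finset.sum_le_card_nsmul Finset.univ
      (fun s => stayCoef (insert p A) (p + nb s)) 2 (fun s _ => stayCoef_insert_le A p s)
    rw [nsmul_eq_mul] at h3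
    norm_num at h3
    rw [h1]
    linarith

lemma measureReal_cyl_stay_le (hS : IsBERW 4 2 3 P S) (T t : ℕ) (h : ℕ → Fin 4 → ℤ) :
    P.real (cyl S t h ∩ {ω | ∀ j, t ≤ j → j < t + T → zw (S (j + 1) ω) = zw (S j ω)})
      ≤ P.real (cyl S t h) * (stayCoef (h '' Set.Iio t) (h t) * (7 / 8) ^ T) := by
  induction T generalizing t h with
  | zero =>
    rw [pow_zero, mul_one]
    exact (measureReal_mono Set.inter_subset_left).trans
      (le_mul_of_one_le_right measureReal_nonneg (one_le_stayCoef _ _))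
  | succ T ih =>
    set B := {ω | ∀ j, t ≤ j → j < t + (T + 1) → zw (S (j + 1) ω) = zw (S j ω)} with hB
    have hnb : ∀ s, P.real (cyl S (t + 1) (cont h t (h t + nb s)) ∩ B)
        ≤ P.real (cyl S (t + 1) (cont h t (h t + nb s))) *
          (stayCoef (insert (h t) (h '' Set.Iio t)) (h t + nb s) * (7 / 8) ^ T) := by
      intro s
      have := ih (t + 1) (cont h t (h t + nb s))
      rw [cont_image_Iio, cont_succ] at this
      refine (measureReal_mono ?_).trans this
      rintro ω ⟨h1, h2⟩
      exact ⟨h1, fun j hj hj' => h2 j (by omega) (by omega)⟩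
    have hoz : ∀ s, P.real (cyl S (t + 1) (cont h t (h t + oz s)) ∩ B) = 0 := by
      intro s
      convert measureReal_empty
      rw [Set.eq_empty_iff_forall_notMem]
      rintro ω ⟨h1, h2⟩
      have h3 := h2 t le_rfl (by omega)
      rw [h1 _ le_rfl, h1 t (by omega), cont_succ, cont_of_le h _ le_rfl] at h3
      exact zw_add_oz_ne _ _ h3
    have hP : 0 ≤ P.real (cyl S t h) := measureReal_nonneg
    have h7 : (0 : ℝ) ≤ (7 / 8) ^ T := by positivity
    rcases new_or_old h t with H | H
    · have hp : h t ∉ h '' Set.Iio t := (notMem_image_Iio_iff h t).2 H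
      refine (measureReal_cyl_inter_le hS (by norm_num) nb_injective
        (measureReal_cyl_cont_new hS H) _).trans ?_
      refine (Finset.sum_le_sum fun s _ => hnb s).trans ?_
      simp only [measureReal_cyl_cont_new hS H]
      rw [← Finset.mul_sum, ← Finset.sum_mul, pow_succ]
      have := mul_le_mul_of_nonneg_left (mul_le_mul_of_nonneg_right (sum_stayCoef_le hp) h7)
        (show 0 ≤ P.real (cyl S t h) / (4 : ℕ) by positivity)
      refine this.trans (le_of_eq ?_)
      push_cast
      ring
    · have hp : h t ∈ h '' Set.Iio t := (mem_image_Iio_iff h t).2 H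
      have hold := measureReal_cyl_cont_old hS H
      refine (measureReal_cyl_inter_le hS (by norm_num) oldStep_injective hold _).trans ?_
      have h2 := hnb 2
      have h3 := hnb 3
      have m2 : P.real (cyl S (t + 1) (cont h t (h t + nb 2))) = P.real (cyl S t h) / 6 := hold 0
      have m3 : P.real (cyl S (t + 1) (cont h t (h t + nb 3))) = P.real (cyl S t h) / 6 := hold 1
      rw [m2] at h2
      rw [m3] at h3
      have c2 := mul_le_mul_of_nonneg_left (mul_le_mul_of_nonneg_right
        (stayCoef_insert_le (h '' Set.Iio t) (h t) 2) h7)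
        (show 0 ≤ P.real (cyl S t h) / 6 by positivity)
      have c3 := mul_le_mul_of_nonneg_left (mul_le_mul_of_nonneg_right
        (stayCoef_insert_le (h '' Set.Iio t) (h t) 3) h7)
        (show 0 ≤ P.real (cyl S t h) / 6 by positivity)
      rw [Fin.sum_univ_six, stayCoef_of_mem hp, pow_succ]
      simp only [oldStep, Matrix.cons_val, hoz]
      have := mul_nonneg hP h7
      linarith

/-- Almost surely, the last two coordinates move infinitely often. -/
lemma ae_exists_move (hS : IsBERW 4 2 3 P S) :
    ∀ᵐ ω ∂P, ∀ t, ∃ j, t ≤ j ∧ zw (S (j + 1) ω) ≠ zw (S j ω) := by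
  rw [ae_all_iff]
  intro t
  refine measure_eq_zero_of_cyl (S := S) t _ fun h => le_antisymm ?_ measureReal_nonneg
  have hlim : Tendsto (fun T : ℕ => P.real (cyl S t h) *
      (stayCoef (h '' Set.Iio t) (h t) * (7 / 8 : ℝ) ^ T)) atTop (nhds 0) := by
    have := tendsto_pow_atTop_nhds_zero_of_lt_one (show (0 : ℝ) ≤ 7 / 8 by norm_num) (by norm_num)
    simpa using (this.const_mul (stayCoef (h '' Set.Iio t) (h t))).const_mul (P.real (cyl S t h))
  refine ge_of_tendsto' hlim fun T => (measureReal_mono ?_).trans (measureReal_cyl_stay_le hS T t h)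
  rintro ω ⟨h1, h2⟩
  refine ⟨h1, fun j hj _ => ?_⟩
  by_contra hne
  exact h2 ⟨j, hj, hne⟩

end

/-- A trajectory starting at `0` with steps of size one whose last two coordinates move infinitely
often. -/
def Good (s : ℕ → Fin 4 → ℤ) : Prop :=
  s 0 = 0 ∧ (∀ t, ∃ a, s (t + 1) = s t + nb a ∨ s (t + 1) = s t + oz a) ∧
    ∀ t, ∃ j, t ≤ j ∧ zw (s (j + 1)) ≠ zw (s j)

lemma exists_list_of_good {s : ℕ → Fin 4 → ℤ} (hs : Good s) (t : ℕ) :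
    ∃ l : List (Fin 4), l.length = moves s t ∧ ∀ j ≤ t, zw (s j) = pos l (moves s j) := by
  induction t with
  | zero =>
    refine ⟨[], by simp, fun j hj => ?_⟩
    obtain rfl : j = 0 := by omega
    rw [hs.1]
    simp [pos, zw]
  | succ t ih =>
    obtain ⟨l, hl, hlj⟩ := ih
    obtain ⟨a, ha | ha⟩ := hs.2.1 t
    · have hzw : zw (s (t + 1)) = zw (s t) := by rw [ha, zw_add_nb]
      have hm := moves_succ_of_eq hzw
      refine ⟨l, by rw [hl, hm], fun j hj => ?_⟩
      rcases Nat.lt_or_eq_of_le hj with hj | rfl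
      · exact hlj j (by omega)
      · rw [hm, hzw, hlj t le_rfl]
    · have hzw : zw (s (t + 1)) ≠ zw (s t) := by rw [ha]; exact zw_add_oz_ne _ _
      have hm := moves_succ_of_ne hzw
      refine ⟨l ++ [a], by simp [hl, hm], fun j hj => ?_⟩
      rcases Nat.lt_or_eq_of_le hj with hj | rfl
      · have hmj : moves s j ≤ l.length := by
          rw [hl]; exact moves_mono s (by omega)
        rw [hlj j (by omega), pos, pos, List.take_append_of_le_length hmj]
      · have h1 := hlj t le_rfl
        rw [← hl, pos, List.take_length] at h1
        rw [ha, zw_add_oz, h1, hm, ← hl, pos, List.take_of_length_le (by simp)]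
        simp [disp_append]

section

variable {Ω : Type*} {S : ℕ → Ω → Fin 4 → ℤ}

lemma tau_spec {ω : Ω} (hs : ∀ t, ∃ j, t ≤ j ∧ zw (S (j + 1) ω) ≠ zw (S j ω)) (k : ℕ) :
    moves (fun t => S t ω) (tau S k ω) = k ∧ ∀ j < tau S k ω, moves (fun t => S t ω) j < k := by
  induction k with
  | zero => simp [tau]
  | succ k ih =>
    set A := {n : ℕ | tau S k ω < n ∧
      ¬(S n ω 2 = S (n - 1) ω 2 ∧ S n ω 3 = S (n - 1) ω 3)} with hA
    have hmem : ∀ m, m + 1 ∈ A ↔ tau S k ω ≤ m ∧ zw (S (m + 1) ω) ≠ zw (S m ω) := by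
      intro m
      simp [hA, zw]
    have hne : A.Nonempty := by
      obtain ⟨j, hj, hj'⟩ := hs (tau S k ω)
      exact ⟨j + 1, (hmem j).2 ⟨hj, hj'⟩⟩
    have htau : tau S (k + 1) ω = sInf A := rfl
    have hin : sInf A ∈ A := Nat.sInf_mem hne
    obtain ⟨m, hm⟩ : ∃ m, sInf A = m + 1 := by
      refine ⟨sInf A - 1, ?_⟩
      have := hin.1
      omega
    rw [hm] at hin
    obtain ⟨h1, h2⟩ := (hmem m).1 hin
    have hconst : ∀ j, tau S k ω ≤ j → j ≤ m → moves (fun t => S t ω) j = k := by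
      intro j hj
      induction j, hj using Nat.le_induction with
      | base => exact fun _ => ih.1
      | succ j hj ih' =>
        intro hjm
        rw [moves_succ_of_eq, ih' (by omega)]
        by_contra hcon
        have := Nat.sInf_le ((hmem j).2 ⟨hj, hcon⟩)
        omega
    rw [htau, hm]
    refine ⟨?_, fun j hj => ?_⟩
    · rw [moves_succ_of_ne h2, hconst m h1 le_rfl]
    · have := moves_mono (fun t => S t ω) (show j ≤ m by omega)
      rw [hconst m h1 le_rfl] at this
      omega

lemma tau_eq {ω : Ω} (hs : ∀ t, ∃ j, t ≤ j ∧ zw (S (j + 1) ω) ≠ zw (S j ω)) {k r : ℕ}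
    (h₁ : moves (fun t => S t ω) r = k) (h₂ : ∀ j < r, moves (fun t => S t ω) j < k) :
    tau S k ω = r := by
  obtain ⟨h3, h4⟩ := tau_spec hs k
  refine le_antisymm ?_ ?_ <;> by_contra! hlt
  · have := h4 r hlt; omega
  · have := h₂ _ hlt; omega

variable [MeasurableSpace Ω] {P : Measure Ω} [IsProbabilityMeasure P]

lemma ae_good (hS : IsBERW 4 2 3 P S) : ∀ᵐ ω ∂P, Good (fun t => S t ω) := by
  filter_upwards [hS.2.1, ae_step hS, ae_exists_move hS] with ω h1 h2 h3
  exact ⟨h1, h2, h3⟩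

lemma measureReal_reach_le (hS : IsBERW 4 2 3 P S) (u : ℕ → ℤ × ℤ) (n : ℕ) (x : ℤ) (T : ℕ) :
    P.real ({ω | S 0 ω = 0} ∩ {ω | ∃ r ≤ T, ReachAt u n x (fun k => S k ω) r})
      ≤ (1 / 4) ^ n * hitProb u n x T ∅ 0 0 := by
  have := measureReal_cyl_reach_le (u := u) (n := n) (x := x) hS T 0 (fun _ => 0)
    (by simp) (by simp)
  have hc : cyl S 0 (fun _ => 0) = {ω | S 0 ω = 0} := by
    ext ω; simp [cyl]
  rw [hc, zero_add, moves_zero, Nat.sub_zero, show Set.Iio (0 : ℕ) = ∅ by ext; simp,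
    Set.image_empty] at this
  refine this.trans (mul_le_of_le_one_left ?_ measureReal_le_one)
  exact mul_nonneg (by positivity) (hitProb_nonneg _ _ _ _)

lemma measureReal_mart_le (hS : IsBERW 4 2 3 P S) {n : ℕ} {x : ℤ} {v : ℤ × ℤ} {K : ℝ}
    (hK : ∀ T, avg n (fun l => ind (disp l = v) * hitProb (pos l) n x T ∅ 0 0) ≤ K) :
    P.real {ω | MartMZ S n ω = x ∧ Uproc S n ω = v} ≤ K := by
  set D : ℕ → Set Ω := fun T => {ω | Good (fun k => S k ω) ∧ ∃ r ≤ T,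
    moves (fun k => S k ω) r = n ∧ (∀ j < r, moves (fun k => S k ω) j < n) ∧ S r ω 0 = x ∧
      zw (S r ω) = v} with hD
  have hDK : ∀ T, P.real (D T) ≤ K := by
    intro T
    refine le_trans ?_ (hK T)
    set F : (Fin n → Fin 4) → Set Ω := fun g => if disp (List.ofFn g) = v then
      {ω | S 0 ω = 0} ∩ {ω | ∃ r ≤ T, ReachAt (pos (List.ofFn g)) n x (fun k => S k ω) r}
        else ∅ with hF
    have hsub : D T ⊆ ⋃ g, F g := by
      rintro ω ⟨hg, r, hr, h1, h2, h3, h4⟩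
      obtain ⟨l, hl, hlj⟩ := exists_list_of_good hg r
      rw [h1] at hl
      subst hl
      have hv : disp l = v := by
        have := hlj r le_rfl
        rw [h1, pos, List.take_length] at this
        exact this.symm.trans h4
      refine Set.mem_iUnion.2 ⟨l.get, ?_⟩
      rw [hF]
      simp only [List.ofFn_get, if_pos hv]
      exact ⟨hg.1, r, hr, h1, h2, h3, hlj⟩
    calc P.real (D T) ≤ P.real (⋃ g, F g) := measureReal_mono hsub
      _ ≤ ∑ g, P.real (F g) := measureReal_iUnion_fintype_le _
      _ ≤ ∑ g : Fin n → Fin 4, (1 / 4) ^ n * (ind (disp (List.ofFn g) = v) *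
            hitProb (pos (List.ofFn g)) n x T ∅ 0 0) := by
          refine Finset.sum_le_sum fun g _ => ?_
          by_cases hv : disp (List.ofFn g) = v
          · simp only [hF, if_pos hv, ind_of hv, one_mul]
            exact measureReal_reach_le hS _ _ _ _
          · simp [hF, if_neg hv, ind_not hv]
      _ = _ := by
          rw [← Finset.mul_sum, avg, one_div, inv_pow, inv_mul_eq_div]
  have hK0 : 0 ≤ K := measureReal_nonneg.trans (hDK 0)
  have hmono : Monotone D := by
    rintro T T' hT ω ⟨hg, r, hr, h⟩
    exact ⟨hg, r, hr.trans hT, h⟩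
  have hle : P {ω | MartMZ S n ω = x ∧ Uproc S n ω = v} ≤ P (⋃ T, D T) := by
    refine measure_mono_ae ?_
    filter_upwards [ae_good hS] with ω hg
    rintro ⟨h1, h2⟩
    obtain ⟨h3, h4⟩ := tau_spec hg.2.2 n
    exact Set.mem_iUnion.2 ⟨tau S n ω, hg, _, le_rfl, h3, h4, h1, h2⟩
  refine ENNReal.toReal_le_of_le_ofReal hK0 (hle.trans ?_)
  rw [hmono.measure_iUnion]
  refine iSup_le fun T => ?_
  rw [← ofReal_measureReal]
  exact ENNReal.ofReal_le_ofReal (hDK T)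

end

lemma summable_exp_neg_mul_rpow {c β : ℝ} (hc : 0 < c) (hβ : 0 < β) :
    Summable fun k : ℕ => Real.exp (-c * (k : ℝ) ^ β) := by
  obtain ⟨m, hm⟩ := exists_nat_ge (2 / β)
  have hmβ : 2 ≤ β * m := by
    rw [div_le_iff₀ hβ] at hm; linarith
  have hsum : Summable fun k : ℕ => (Nat.factorial m / c ^ m) * (1 / (k : ℝ) ^ 2) :=
    (Real.summable_one_div_nat_pow.2 (by norm_num)).mul_left _
  refine Summable.of_norm_bounded_eventually_nat hsum ?_
  filter_upwards [eventually_ge_atTop 1] with k hk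
  have hk' : (1 : ℝ) ≤ k := by exact_mod_cast hk
  rw [Real.norm_of_nonneg (Real.exp_pos _).le]
  have h1 := Real.pow_div_factorial_le_exp (c * (k : ℝ) ^ β) (by positivity) m
  have h2 : (k : ℝ) ^ 2 ≤ ((k : ℝ) ^ β) ^ m := by
    rw [← Real.rpow_natCast ((k : ℝ) ^ β) m, ← Real.rpow_mul (by positivity), ← Real.rpow_natCast]
    exact Real.rpow_le_rpow_of_exponent_le hk' (by exact_mod_cast hmβ)
  have h3 : c ^ m * (k : ℝ) ^ 2 / Nat.factorial m ≤ Real.exp (c * (k : ℝ) ^ β) := by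
    refine le_trans ?_ h1
    rw [mul_pow]
    gcongr
  rw [neg_mul, Real.exp_neg, ← one_div, div_mul_div_comm, mul_one,
    div_le_div_iff₀ (Real.exp_pos _) (by positivity)]
  rw [div_le_iff₀ (by positivity)] at h3
  linarith

lemma summable_one_div_mul_exp {C c β : ℝ} (hc : 0 < c) (hβ : 0 < β) :
    Summable fun n : ℕ => 1 / (n : ℝ) * C * Real.exp (-c * Real.log n ^ β) := by
  have hmain : Summable fun n : ℕ => 1 / (n : ℝ) * Real.exp (-c * Real.log n ^ β) := by
    rw [← summable_condensed_iff_of_nonneg]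
    · have hlog2 : 0 < Real.log 2 := Real.log_pos (by norm_num)
      refine (summable_exp_neg_mul_rpow (c := c * Real.log 2 ^ β) (by positivity) hβ).congr
        fun k => ?_
      push_cast
      rw [Real.log_pow, Real.mul_rpow (by positivity) hlog2.le]
      field_simp
    · intro n; positivity
    · intro m n hm hmn
      have hm' : (1 : ℝ) ≤ m := by exact_mod_cast hm
      have hmn' : (m : ℝ) ≤ n := by exact_mod_cast hmn
      have hl : 0 ≤ Real.log m := Real.log_nonneg hm'
      have h1 : Real.log m ^ β ≤ Real.log n ^ β :=
        Real.rpow_le_rpow hl (Real.log_le_log (by linarith) hmn') hβ.le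
      have h2 := mul_le_mul_of_nonneg_left h1 hc.le
      gcongr 1 / ?_ * Real.exp ?_
      linarith
  exact (hmain.mul_left C).congr fun n => by ring

section

variable {Ω : Type*} [MeasurableSpace Ω] {P : Measure Ω} {S : ℕ → Ω → Fin 4 → ℤ}

lemma exists_measureReal_mart_le [IsProbabilityMeasure P] (hS : IsBERW 4 2 3 P S) :
    ∃ C c : ℝ, 0 < C ∧ 0 < c ∧ ∃ n₀ : ℕ, ∀ n, n₀ ≤ n → ∀ (x : ℤ) (v : ℤ × ℤ),
      P.real {ω | MartMZ S n ω = x ∧ Uproc S n ω = v}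
        ≤ 1 / n * C * Real.exp (-c * Real.log n ^ (1 / 16 : ℝ)) := by
  obtain ⟨C, c, hC, hc, n₀, h⟩ := exists_avg_hitProb_le
  exact ⟨C, c, hC, hc, n₀, fun n hn x v => measureReal_mart_le hS fun T => h n hn x T v⟩

lemma tsum_mart_ne_top [IsProbabilityMeasure P] (hS : IsBERW 4 2 3 P S) (x : ℤ) (v : ℤ × ℤ) :
    ∑' n, P {ω | MartMZ S n ω = x ∧ Uproc S n ω = v} ≠ ⊤ := by
  obtain ⟨C, c, hC, hc, n₀, h⟩ := exists_measureReal_mart_le hS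
  have hsum : Summable fun n => P.real {ω | MartMZ S n ω = x ∧ Uproc S n ω = v} := by
    refine Summable.of_norm_bounded_eventually_nat
      (summable_one_div_mul_exp (C := C) hc (show (0 : ℝ) < 1 / 16 by norm_num)) ?_
    filter_upwards [eventually_ge_atTop n₀] with n hn
    rw [Real.norm_of_nonneg measureReal_nonneg]
    exact h n hn x v
  have := hsum.tsum_ofReal_ne_top
  have heq : ∀ n, ENNReal.ofReal (P.real {ω | MartMZ S n ω = x ∧ Uproc S n ω = v})
      = P {ω | MartMZ S n ω = x ∧ Uproc S n ω = v} := fun n => ofReal_measureReal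
  rwa [tsum_congr heq] at this

lemma ae_finite_mart [IsProbabilityMeasure P] (hS : IsBERW 4 2 3 P S) :
    ∀ᵐ ω ∂P, ∀ p : ℤ × (ℤ × ℤ), {n : ℕ | (MartMZ S n ω, Uproc S n ω) = p}.Finite := by
  rw [ae_all_iff]
  rintro ⟨x, v⟩
  have := ae_finite_setOfPred_mem (tsum_mart_ne_top hS x v)
  simpa only [Prod.mk.injEq, Set.mem_ofPred_eq] using this

/-- The event that the process is at `p` at time `t`, not for the first time. -/
def oldVisit (S : ℕ → Ω → Fin 4 → ℤ) (p : Fin 4 → ℤ) (t : ℕ) : Set Ω :=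
  {ω | S t ω = p ∧ ∃ k < t, S t ω = S k ω}

lemma measure_oldVisit_le (hS : IsBERW 4 2 3 P S) (p : Fin 4 → ℤ) (t : ℕ) :
    P (oldVisit S p t) ≤ 6 * P (oldVisit S p t ∩ {ω | S (t + 1) ω = p + oz 0}) := by
  set F : Set (Fin (t + 1) → Fin 4 → ℤ) :=
    {f | f (Fin.last t) = p ∧ ∃ k : Fin (t + 1), k ≠ Fin.last t ∧ f (Fin.last t) = f k} with hF
  set e : (Fin (t + 1) → Fin 4 → ℤ) → ℕ → Fin 4 → ℤ :=
    fun f k => if hk : k < t + 1 then f ⟨k, hk⟩ else 0 with he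
  have he_lt : ∀ f k (hk : k < t + 1), e f k = f ⟨k, hk⟩ := fun f k hk => dif_pos hk
  have he_last : ∀ f, e f t = f (Fin.last t) := fun f => he_lt f t (by omega)
  have hmem : ∀ f ω, ω ∈ cyl S t (e f) ↔ f = fun k : Fin (t + 1) => S k ω := by
    intro f ω
    constructor
    · intro h
      funext k
      exact (he_lt f k k.isLt).symm.trans (h k (by omega)).symm
    · rintro rfl k hk
      exact (he_lt (fun k => S k ω) k (Nat.lt_succ_of_le hk)).symm
  set B : Set Ω := {ω | S (t + 1) ω = p + oz 0} with hB
  have hcov : oldVisit S p t = ⋃ f : F, cyl S t (e f) := by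
    ext ω
    simp only [Set.mem_iUnion, hmem]
    constructor
    · rintro ⟨h1, k, hk, h2⟩
      refine ⟨⟨fun k => S k ω, by simpa using h1, ⟨k, by omega⟩, ?_, by simpa using h2⟩, rfl⟩
      simp [Fin.ext_iff]
      omega
    · rintro ⟨⟨f, h1, k, hk, h2⟩, h3⟩
      simp only at h3
      subst h3
      refine ⟨by simpa using h1, k, ?_, by simpa using h2⟩
      have := Fin.val_lt_last hk
      exact this
  have hdisj : Pairwise (Function.onFun Disjoint fun f : F => cyl S t (e f)) := by
    intro f g hfg
    refine Set.disjoint_left.2 fun ω h1 h2 => hfg (Subtype.ext ?_)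
    rw [(hmem _ _).1 h1, (hmem _ _).1 h2]
  have hBm : MeasurableSet B := hS.1 (t + 1) (MeasurableSet.singleton _)
  have hstep : ∀ f : F, P (cyl S t (e f)) = 6 * P (cyl S t (e f) ∩ B) := by
    rintro ⟨f, h1, k, hk, h2⟩
    have := hS.2.2.2 t (e f) ⟨k, Fin.val_lt_last hk, by
      rw [he_last, he_lt f k k.isLt, h2]⟩ 2 (by decide) 1
      (Or.inl rfl)
    have hset : {ω | (∀ k ≤ t, S k ω = e f k) ∧ S (t + 1) ω = e f t + (1 : ℤ) • unitVec 4 2}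
        = cyl S t (e f) ∩ B := by
      rw [he_last, h1, show (1 : ℤ) • unitVec 4 2 = oz 0 by decide]
      rfl
    rw [hset] at this
    rw [this]
    change P (cyl S t (e f)) = 6 * (P (cyl S t (e f)) / _)
    rw [show (2 * ((3 : ℕ) : ENNReal)) = 6 by norm_num, ENNReal.mul_div_cancel (by norm_num)
      (by norm_num)]
  rw [hcov, Set.iUnion_inter, measure_iUnion hdisj fun f => measurableSet_cyl hS _ _,
    measure_iUnion (fun f g hfg => (hdisj hfg).mono Set.inter_subset_left Set.inter_subset_left)
      fun f => (measurableSet_cyl hS _ _).inter hBm, ← ENNReal.tsum_mul_left]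
  exact (ENNReal.tsum_le_tsum fun f => (hstep f).le)

/-- The event that the `k`-th move of the last two coordinates happens at time `t + 1`, and leads
to first coordinate `x` and last coordinates `v`. -/
def moveEvent (S : ℕ → Ω → Fin 4 → ℤ) (x : ℤ) (v : ℤ × ℤ) (k t : ℕ) : Set Ω :=
  {ω | moves (fun j => S j ω) (t + 1) = k ∧ moves (fun j => S j ω) t < k ∧
    S (t + 1) ω 0 = x ∧ zw (S (t + 1) ω) = v}

lemma measurableSet_moveEvent (hS : IsBERW 4 2 3 P S) (x : ℤ) (v : ℤ × ℤ) (k t : ℕ) :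
    MeasurableSet (moveEvent S x v k t) := by
  set Y : Ω → Fin (t + 2) → Fin 4 → ℤ := fun ω k => S k ω with hY
  have hYm : Measurable Y := measurable_pi_lambda _ fun k => hS.1 k
  set e : (Fin (t + 2) → Fin 4 → ℤ) → ℕ → Fin 4 → ℤ :=
    fun f k => if hk : k < t + 2 then f ⟨k, hk⟩ else 0 with he
  have hm : ∀ ω, ∀ j ≤ t + 1, moves (fun j => S j ω) j = moves (e (Y ω)) j := fun ω j hj =>
    moves_congr fun i hi => by simp [he, hY, show i < t + 2 by omega]
  have : moveEvent S x v k t = Y ⁻¹' {f | moves (e f) (t + 1) = k ∧ moves (e f) t < k ∧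
      f (Fin.last _) 0 = x ∧ zw (f (Fin.last _)) = v} := by
    ext ω
    simp only [moveEvent, Set.mem_ofPred_eq, Set.mem_preimage, hm ω (t + 1) le_rfl,
      hm ω t (by omega)]
    rfl
  rw [this]
  exact hYm (Set.to_countable _).measurableSet

lemma tsum_moveEvent_le [IsProbabilityMeasure P] (hS : IsBERW 4 2 3 P S) (x : ℤ) (v : ℤ × ℤ)
    (k : ℕ) :
    ∑' t, P (moveEvent S x v k t) ≤ P {ω | MartMZ S k ω = x ∧ Uproc S k ω = v} := by
  have hdisj : Pairwise (Function.onFun Disjoint (moveEvent S x v k)) := by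
    refine (pairwise_disjoint_on _).2 fun t t' htt => Set.disjoint_left.2 ?_
    rintro ω ⟨h1, -⟩ ⟨-, h2, -⟩
    have := moves_mono (fun j => S j ω) (show t + 1 ≤ t' from htt)
    omega
  rw [← measure_iUnion hdisj fun t => measurableSet_moveEvent hS x v k t]
  refine measure_mono_ae ?_
  filter_upwards [ae_exists_move hS] with ω hω h
  obtain ⟨t, h1, h2, h3, h4⟩ := Set.mem_iUnion.1 h
  have ht : tau S k ω = t + 1 := tau_eq hω h1 fun j hj =>
    (moves_mono (fun j => S j ω) (show j ≤ t by omega)).trans_lt h2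
  exact ⟨by rw [MartMZ, ht, h3], by rw [← h4, Uproc, ht]; rfl⟩

lemma tsum_oldVisit_ne_top [IsProbabilityMeasure P] (hS : IsBERW 4 2 3 P S) (p : Fin 4 → ℤ) :
    ∑' t, P (oldVisit S p t) ≠ ⊤ := by
  set v := zw (p + oz 0) with hv
  have hsub : ∀ t, oldVisit S p t ∩ {ω | S (t + 1) ω = p + oz 0}
      ⊆ ⋃ k, moveEvent S (p 0) v k t := by
    rintro t ω ⟨⟨h1, -⟩, h2⟩
    have h2' : S (t + 1) ω = p + oz 0 := h2
    refine Set.mem_iUnion.2 ⟨moves (fun j => S j ω) (t + 1), rfl, ?_, ?_, ?_⟩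
    · rw [moves_succ_of_ne]
      · omega
      · simp only [h1, h2']
        exact zw_add_oz_ne _ _
    · rw [h2']; simp [oz]
    · rw [h2']
  have hle : ∑' t, P (oldVisit S p t)
      ≤ 6 * ∑' k, P {ω | MartMZ S k ω = p 0 ∧ Uproc S k ω = v} := by
    calc ∑' t, P (oldVisit S p t) ≤ ∑' t, 6 * ∑' k, P (moveEvent S (p 0) v k t) := by
          refine ENNReal.tsum_le_tsum fun t => (measure_oldVisit_le hS p t).trans ?_
          gcongr
          exact (measure_mono (hsub t)).trans (measure_iUnion_le _)
      _ = 6 * ∑' k, ∑' t, P (moveEvent S (p 0) v k t) := by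
          rw [ENNReal.tsum_mul_left, ENNReal.tsum_comm]
      _ ≤ _ := by
          gcongr with k
          exact tsum_moveEvent_le hS _ _ k
  exact ne_top_of_le_ne_top (ENNReal.mul_ne_top (by norm_num) (tsum_mart_ne_top hS _ _)) hle

lemma isTransientWalk [IsProbabilityMeasure P] (hS : IsBERW 4 2 3 P S) :
    IsTransientWalk 4 P S := by
  unfold IsTransientWalk
  rw [ae_all_iff]
  intro p
  filter_upwards [ae_finite_setOfPred_mem (tsum_oldVisit_ne_top hS p)] with ω hω
  have hfirst : {t | S t ω = p ∧ ∀ k < t, S t ω ≠ S k ω}.Subsingleton := by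
    rintro t ⟨h1, h2⟩ t' ⟨h1', h2'⟩
    by_contra hne
    rcases Nat.lt_or_gt_of_ne hne with h | h
    · exact h2' t h (h1'.trans h1.symm)
    · exact h2 t' h (h1.trans h1'.symm)
  refine (hω.union hfirst.finite).subset fun t ht => ?_
  by_cases H : ∃ k < t, S t ω = S k ω
  · exact Or.inl ⟨ht, H⟩
  · push Not at H
    exact Or.inr ⟨ht, H⟩

end

end BERW

/-- For the `M₄(2,3)` balanced excited random walk `S = (X, Y, Z, W)` with
`M_m = X_{τ_m}` and `U_k = (Z_{τ_k}, W_{τ_k})`, there are constants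
`C₈, C₉, β > 0` with `P(M_n = 0, U_n = 0) ≤ (1/n) C₈ exp(−C₉ (log n)^β)` for all
`n` large enough; consequently the process `(M, U)` is transient, and hence the
`M₄(2,3)` walk is transient. -/
theorem berw_M4_2_3_transient {Ω : Type*} [MeasurableSpace Ω]
    (P : Measure Ω) [IsProbabilityMeasure P]
    (S : ℕ → Ω → Fin 4 → ℤ) (hS : IsBERW 4 2 3 P S) :
    (∃ C₈ C₉ β : ℝ, 0 < C₈ ∧ 0 < C₉ ∧ 0 < β ∧ ∃ n₀ : ℕ, ∀ n : ℕ, n₀ ≤ n →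
      (P {ω | MartMZ S n ω = 0 ∧ Uproc S n ω = 0}).toReal
        ≤ (1 / n) * C₈ * Real.exp (-C₉ * (Real.log n) ^ β)) ∧
    (∀ᵐ ω ∂P, ∀ p : ℤ × (ℤ × ℤ), {n : ℕ | (MartMZ S n ω, Uproc S n ω) = p}.Finite) ∧
    IsTransientWalk 4 P S := by
  refine ⟨?_, BERW.ae_finite_mart hS, BERW.isTransientWalk hS⟩
  obtain ⟨C, c, hC, hc, n₀, h⟩ := BERW.exists_measureReal_mart_le hS
  exact ⟨C, c, 1 / 16, hC, hc, by norm_num, n₀, fun n hn => h n hn 0 0⟩
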